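/- Let n ≥ 3 and m ≥ 2, and let f = (f^1,…,f^m) : ℝ^n → ℝ^m be a smooth map whose graph M = {(x, f(x)) : x ∈ ℝ^n} ⊂ ℝ^{n+m} has parallel mean curvature (in the sense defined in the context). Suppose there exists a real number β₀ < 3 such that Δ_f(x) = [det(δ_{ij} + Σ_{α=1}^m ∂f^α/∂x^i (x) ∂f^α/∂x^j (x))]^{1/2} ≤ β₀ for all x ∈ ℝ^n. Then f^1,…,f^m are affine linear, i.e. there exist a real m×n matrix A and b ∈ ℝ^m with f(x) = Ax + b for all x (so that M is an affine n-plane). -/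

import Mathlib

noncomputable section

open scoped BigOperators

/-- Partial derivative of a scalar function on `ℝ^n` in the `i`-th coordinate direction. -/
def pderiv' {n : ℕ} (i : Fin n) (φ : (Fin n → ℝ) → ℝ) (x : Fin n → ℝ) : ℝ :=
  fderiv ℝ φ x (Pi.single i 1)

/-- The induced metric `g_{ij} = δ_{ij} + Σ_α ∂f^α/∂x^i ∂f^α/∂x^j` of the graph of `f`. -/
def graphMetric {n m : ℕ} (f : (Fin n → ℝ) → (Fin m → ℝ)) (x : Fin n → ℝ) :
    Matrix (Fin n) (Fin n) ℝ :=
  Matrix.of fun i j => (if i = j then (1 : ℝ) else 0) +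
    ∑ α : Fin m, pderiv' i (fun y => f y α) x * pderiv' j (fun y => f y α) x

/-- The slope function `Δ_f = (det g)^{1/2}`. -/
def slopeFunction {n m : ℕ} (f : (Fin n → ℝ) → (Fin m → ℝ)) (x : Fin n → ℝ) : ℝ :=
  Real.sqrt (graphMetric f x).det

/-- The graph map `F(x) = (x, f(x)) ∈ ℝ^{n+m}`, with `ℝ^{n+m}` realized as `Fin n ⊕ Fin m → ℝ`. -/
def graphMap {n m : ℕ} (f : (Fin n → ℝ) → (Fin m → ℝ)) (x : Fin n → ℝ) :
    Fin n ⊕ Fin m → ℝ :=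
  Sum.elim x (f x)

/-- The tangent vector `∂_i F(x)` of the graph. -/
def graphTangent {n m : ℕ} (f : (Fin n → ℝ) → (Fin m → ℝ)) (i : Fin n) (x : Fin n → ℝ) :
    Fin n ⊕ Fin m → ℝ :=
  fun k => pderiv' i (fun y => graphMap f y k) x

/-- The orthogonal projection onto the normal space of the graph at `F(x)`:
`P_N = I_{n+m} − Σ_{i,j} g^{ij} ∂_iF (∂_jF)ᵀ`. -/
def normalProjection {n m : ℕ} (f : (Fin n → ℝ) → (Fin m → ℝ)) (x : Fin n → ℝ) :
    Matrix (Fin n ⊕ Fin m) (Fin n ⊕ Fin m) ℝ :=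
  Matrix.of fun k l => (if k = l then (1 : ℝ) else 0) -
    ∑ i : Fin n, ∑ j : Fin n,
      (graphMetric f x)⁻¹ i j * graphTangent f i x k * graphTangent f j x l

/-- The mean curvature vector `H(x) = Σ_{i,j} g^{ij} P_N(∂_i∂_jF)` of the graph. -/
def meanCurvature {n m : ℕ} (f : (Fin n → ℝ) → (Fin m → ℝ)) (x : Fin n → ℝ) :
    Fin n ⊕ Fin m → ℝ :=
  fun k => ∑ i : Fin n, ∑ j : Fin n, (graphMetric f x)⁻¹ i j *
    ∑ l : Fin n ⊕ Fin m,
      normalProjection f x k l * pderiv' i (fun y => graphTangent f j y l) x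

/-- The graph of `f` has parallel mean curvature: the normal projection of every directional
derivative of the mean curvature vector field vanishes, `P_N(D_v H) = 0`. -/
def HasParallelMeanCurvature {n m : ℕ} (f : (Fin n → ℝ) → (Fin m → ℝ)) : Prop :=
  ∀ (x v : Fin n → ℝ) (k : Fin n ⊕ Fin m),
    ∑ l : Fin n ⊕ Fin m,
      normalProjection f x k l * fderiv ℝ (fun y => meanCurvature f y l) x v = 0

/-! ### Coordinate partial derivatives -/

section PartialDerivatives

variable {n : ℕ} {φ ψ : (Fin n → ℝ) → ℝ} {x : Fin n → ℝ}

theorem pderiv'_const (i : Fin n) (c : ℝ) (x : Fin n → ℝ) : pderiv' i (fun _ => c) x = 0 := by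
  simp [pderiv']

theorem pderiv'_add (i : Fin n) (hφ : DifferentiableAt ℝ φ x) (hψ : DifferentiableAt ℝ ψ x) :
    pderiv' i (fun y => φ y + ψ y) x = pderiv' i φ x + pderiv' i ψ x := by
  simp [pderiv', fderiv_fun_add hφ hψ]

theorem pderiv'_sub (i : Fin n) (hφ : DifferentiableAt ℝ φ x) (hψ : DifferentiableAt ℝ ψ x) :
    pderiv' i (fun y => φ y - ψ y) x = pderiv' i φ x - pderiv' i ψ x := by
  simp [pderiv', fderiv_fun_sub hφ hψ]

theorem pderiv'_mul (i : Fin n) (hφ : DifferentiableAt ℝ φ x) (hψ : DifferentiableAt ℝ ψ x) :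
    pderiv' i (fun y => φ y * ψ y) x = pderiv' i φ x * ψ x + φ x * pderiv' i ψ x := by
  simp [pderiv', fderiv_fun_mul hφ hψ]; ring

theorem pderiv'_const_mul (i : Fin n) (c : ℝ) (hφ : DifferentiableAt ℝ φ x) :
    pderiv' i (fun y => c * φ y) x = c * pderiv' i φ x := by
  rw [pderiv'_mul i (differentiableAt_const c) hφ, pderiv'_const]; ring

theorem pderiv'_sum {ι : Type*} (s : Finset ι) (i : Fin n) {Φ : ι → (Fin n → ℝ) → ℝ}
    (h : ∀ a ∈ s, DifferentiableAt ℝ (Φ a) x) :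
    pderiv' i (fun y => ∑ a ∈ s, Φ a y) x = ∑ a ∈ s, pderiv' i (Φ a) x := by
  simp [pderiv', fderiv_fun_sum h]

theorem pderiv'_pow (i : Fin n) (k : ℕ) (hφ : DifferentiableAt ℝ φ x) :
    pderiv' i (fun y => φ y ^ k) x = k * φ x ^ (k - 1) * pderiv' i φ x := by
  simp [pderiv', fderiv_fun_pow k hφ]

theorem pderiv'_comp (i : Fin n) {G : ℝ → ℝ} {G' : ℝ} (hG : HasDerivAt G G' (φ x))
    (hφ : DifferentiableAt ℝ φ x) :
    pderiv' i (fun y => G (φ y)) x = G' * pderiv' i φ x := by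
  have := (hG.comp_hasFDerivAt x hφ.hasFDerivAt).fderiv
  simp only [pderiv']
  rw [show (fun y => G (φ y)) = G ∘ φ from rfl, this]
  simp

theorem pderiv'_coord (i k : Fin n) (x : Fin n → ℝ) :
    pderiv' i (fun y => y k) x = if k = i then 1 else 0 := by
  have : (fun y : Fin n → ℝ => y k) = ContinuousLinearMap.proj (R := ℝ) k := rfl
  simp only [pderiv']
  rw [this, ContinuousLinearMap.fderiv]
  simp [Pi.single_apply]

theorem fderiv_eq_sum_pderiv' (φ : (Fin n → ℝ) → ℝ) (x v : Fin n → ℝ) :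
    fderiv ℝ φ x v = ∑ i, v i * pderiv' i φ x := by
  have hv : v = ∑ i, v i • (Pi.single i (1 : ℝ) : Fin n → ℝ) := by
    ext j; simp [Pi.single_apply]
  conv_lhs => rw [hv]
  simp [pderiv', map_sum]

theorem ContDiff.pderiv' (i : Fin n) (hφ : ContDiff ℝ (⊤ : ℕ∞) φ) :
    ContDiff ℝ (⊤ : ℕ∞) (pderiv' i φ) := by
  unfold _root_.pderiv'
  exact (hφ.fderiv_right (m := (⊤ : ℕ∞)) (by simp)).clm_apply contDiff_const

theorem ContDiff.diffAt_of_smooth (hφ : ContDiff ℝ (⊤ : ℕ∞) φ) (x : Fin n → ℝ) :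
    DifferentiableAt ℝ φ x :=
  (hφ.differentiable (by simp)).differentiableAt

theorem pderiv'_comm (i j : Fin n) (hφ : ContDiff ℝ (⊤ : ℕ∞) φ) (x : Fin n → ℝ) :
    pderiv' i (pderiv' j φ) x = pderiv' j (pderiv' i φ) x := by
  have hd : DifferentiableAt ℝ (fderiv ℝ φ) x :=
    ((hφ.fderiv_right (m := (⊤ : ℕ∞)) (by simp)).differentiable (by simp)).differentiableAt
  have key : ∀ a b : Fin n, pderiv' a (pderiv' b φ) x
      = fderiv ℝ (fderiv ℝ φ) x (Pi.single a 1) (Pi.single b 1) := by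
    intro a b
    have : (pderiv' b φ) = fun y => (fderiv ℝ φ y) (Pi.single b 1) := rfl
    rw [this]
    simp only [pderiv']
    rw [fderiv_clm_apply hd (differentiableAt_const _)]
    simp
  rw [key, key]
  have := (hφ.contDiffAt (x := x)).isSymmSndFDerivAt
    (by
      simp only [minSmoothness_of_isRCLikeNormedField]
      exact WithTop.coe_le_coe.2 (le_top (a := (2 : ℕ∞))))
  exact this _ _

theorem pderiv'_comp_affine (a : Fin n) (E : Matrix (Fin n) (Fin n) ℝ) (x₀ y : Fin n → ℝ)
    (hφ : Differentiable ℝ φ) :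
    pderiv' a (fun z => φ (x₀ + E.mulVec z)) y = ∑ i, E i a * pderiv' i φ (x₀ + E.mulVec y) := by
  have h1 : HasFDerivAt (fun z : Fin n → ℝ => x₀ + E.mulVec z)
      (LinearMap.toContinuousLinearMap (Matrix.mulVecLin E)) y := by
    have := (LinearMap.toContinuousLinearMap (Matrix.mulVecLin E)).hasFDerivAt (x := y)
    simpa using this.const_add x₀
  have := ((hφ _).hasFDerivAt.comp y h1).fderiv
  rw [pderiv', show (fun z => φ (x₀ + E.mulVec z)) = φ ∘ (fun z => x₀ + E.mulVec z) from rfl, this]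
  simp only [ContinuousLinearMap.comp_apply, LinearMap.coe_toContinuousLinearMap',
    Matrix.mulVecLin_apply, Matrix.mulVec_single_one]
  rw [fderiv_eq_sum_pderiv']
  rfl

theorem integral_pderiv'_eq_zero (i : Fin n) (hφ : ContDiff ℝ 1 φ) (hc : HasCompactSupport φ) :
    ∫ x, pderiv' i φ x = 0 := by
  have hcont : Continuous (fun x => pderiv' i φ x) := by
    unfold pderiv'
    exact (hφ.continuous_fderiv (by simp)).clm_apply continuous_const
  have hc' : HasCompactSupport (fun x => pderiv' i φ x) :=
    (hc.fderiv (𝕜 := ℝ)).comp_left (g := fun L : (Fin n → ℝ) →L[ℝ] ℝ => L (Pi.single i 1)) rfl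
  have := integral_mul_fderiv_eq_neg_fderiv_mul_of_integrable (𝕜 := ℝ) (μ := MeasureTheory.volume)
    (f := fun _ : Fin n → ℝ => (1 : ℝ)) (g := φ) (v := Pi.single i 1) (by simp)
    (by simpa [pderiv'] using hcont.integrable_of_hasCompactSupport (μ := MeasureTheory.volume) hc')
    (by simpa using hφ.continuous.integrable_of_hasCompactSupport (μ := MeasureTheory.volume) hc)
    (by simp) (fun x _ => (hφ.differentiable (by simp)).differentiableAt)
  simpa [pderiv'] using this

end PartialDerivatives

/-! ### Smooth matrix-valued functions -/

section MatrixFunctions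

variable {n : ℕ} {ι : Type*} [Fintype ι] [DecidableEq ι]
  {M : (Fin n → ℝ) → Matrix ι ι ℝ}

theorem ContDiff.matrix_det (hM : ∀ i j, ContDiff ℝ (⊤ : ℕ∞) fun x => M x i j) :
    ContDiff ℝ (⊤ : ℕ∞) fun x => (M x).det := by
  simp only [Matrix.det_apply]
  refine ContDiff.sum fun σ _ => ?_
  exact (contDiff_prod fun i _ => hM _ _).const_smul _

theorem ContDiff.matrix_adjugate (hM : ∀ i j, ContDiff ℝ (⊤ : ℕ∞) fun x => M x i j) (i j : ι) :
    ContDiff ℝ (⊤ : ℕ∞) fun x => (M x).adjugate i j := by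
  simp only [Matrix.adjugate_apply]
  refine ContDiff.matrix_det (M := fun x => (M x).updateRow j (Pi.single i 1)) fun k l => ?_
  by_cases h : k = j
  · subst h; simpa using contDiff_const
  · simpa [Matrix.updateRow_ne h] using hM k l

theorem ContDiff.matrix_inv (hM : ∀ i j, ContDiff ℝ (⊤ : ℕ∞) fun x => M x i j)
    (hdet : ∀ x, (M x).det ≠ 0) (i j : ι) :
    ContDiff ℝ (⊤ : ℕ∞) fun x => (M x)⁻¹ i j := by
  simp only [Matrix.inv_def, Ring.inverse_eq_inv', Matrix.smul_apply, smul_eq_mul]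
  exact ((ContDiff.matrix_det hM).inv hdet).mul (ContDiff.matrix_adjugate hM i j)

theorem pderiv'_inv (hM : ∀ i j, ContDiff ℝ (⊤ : ℕ∞) fun x => M x i j)
    (hdet : ∀ x, (M x).det ≠ 0) (k : Fin n) (x : Fin n → ℝ) :
    (Matrix.of fun i j => pderiv' k (fun y => (M y)⁻¹ i j) x) =
      -((M x)⁻¹ * (Matrix.of fun i j => pderiv' k (fun y => M y i j) x) * (M x)⁻¹) := by
  have hW := ContDiff.matrix_inv hM hdet
  have hprod : (Matrix.of fun i j => pderiv' k (fun y => M y i j) x) * (M x)⁻¹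
      + M x * (Matrix.of fun i j => pderiv' k (fun y => (M y)⁻¹ i j) x) = 0 := by
    ext a b
    have h1 : (fun y => ∑ c, M y a c * (M y)⁻¹ c b) = fun _ => (1 : Matrix ι ι ℝ) a b := by
      funext y
      rw [← Matrix.mul_apply, Matrix.mul_nonsing_inv _ (isUnit_iff_ne_zero.mpr (hdet y))]
    have h2 := pderiv'_const k ((1 : Matrix ι ι ℝ) a b) x
    rw [← h1, pderiv'_sum _ _ fun c _ =>
      ((hM a c).mul (hW c b)).diffAt_of_smooth x] at h2
    simp only [Matrix.add_apply, Matrix.mul_apply, Matrix.of_apply, Matrix.zero_apply,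
      ← Finset.sum_add_distrib]
    rw [← h2]
    refine Finset.sum_congr rfl fun c _ => ?_
    rw [pderiv'_mul k ((hM a c).diffAt_of_smooth x) ((hW c b).diffAt_of_smooth x)]
  have hu : IsUnit (M x).det := isUnit_iff_ne_zero.mpr (hdet x)
  have h3 := congrArg (fun A => (M x)⁻¹ * A) (eq_neg_of_add_eq_zero_right hprod)
  simp only [← Matrix.mul_assoc, Matrix.nonsing_inv_mul _ hu, Matrix.one_mul, Matrix.mul_neg] at h3
  exact h3

theorem pderiv'_det (hM : ∀ i j, ContDiff ℝ (⊤ : ℕ∞) fun x => M x i j)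
    (hdet : ∀ x, (M x).det ≠ 0) (k : Fin n) (x : Fin n → ℝ) :
    pderiv' k (fun y => (M y).det) x =
      (M x).det * ∑ i, ∑ j, (M x)⁻¹ j i * pderiv' k (fun y => M y i j) x := by
  have hdiff : DifferentiableAt ℝ (fun y => (fun i j => M y i j : ι → ι → ℝ)) x := by
    rw [differentiableAt_pi]; intro i
    rw [differentiableAt_pi]; intro j
    exact (hM i j).diffAt_of_smooth x
  let T : ContinuousMultilinearMap ℝ (fun _ : ι => ι → ℝ) ℝ :=
    { toMultilinearMap := (Matrix.detRowAlternating (R := ℝ) (n := ι)).toMultilinearMap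
      cont := Continuous.matrix_det (A := fun X : ι → ι → ℝ => (X : Matrix ι ι ℝ)) continuous_id }
  have hfd := ((T.hasFDerivAt (fun i j => M x i j)).comp x hdiff.hasFDerivAt).fderiv
  have hentry : ∀ i j, (fderiv ℝ (fun y => (fun i j => M y i j : ι → ι → ℝ)) x) (Pi.single k 1) i j
      = pderiv' k (fun y => M y i j) x := by
    intro i j
    have h1 := (hasFDerivAt_pi'.1 (hasFDerivAt_pi'.1 hdiff.hasFDerivAt i) j).fderiv
    simp only [pderiv']
    rw [h1]; rfl
  have hfun : (fun y => (M y).det) = (⇑T ∘ fun y => (fun i j => M y i j : ι → ι → ℝ)) := rfl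
  rw [hfun, pderiv', hfd]
  simp only [ContinuousLinearMap.comp_apply, ContinuousMultilinearMap.linearDeriv_apply]
  rw [Finset.mul_sum]
  refine Finset.sum_congr rfl fun i _ => ?_
  set b := (fderiv ℝ (fun y => (fun i j => M y i j : ι → ι → ℝ)) x) (Pi.single k 1) i with hb
  have h2 : T (Function.update (fun i j => M x i j) i b) = ((M x).updateRow i b).det := rfl
  rw [h2, ← Matrix.cramer_transpose_apply, Matrix.cramer_eq_adjugate_mulVec,
    ← Matrix.adjugate_transpose, Matrix.mulVec, dotProduct, Finset.mul_sum]
  refine Finset.sum_congr rfl fun j _ => ?_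
  rw [Matrix.inv_def, Ring.inverse_eq_inv', ← hentry i j, ← hb]
  simp only [Matrix.transpose_apply, Matrix.smul_apply, smul_eq_mul]
  field_simp [hdet x]

end MatrixFunctions

/-! ### The algebraic inequality behind the Bochner formula -/

section AlgebraicInequality

theorem two_var_form_nonneg {k x Z A a m l : ℝ} (hl : l ^ 2 = x)
    (hZ : 0 ≤ Z) (hA : 0 ≤ A) (hm : m ^ 2 ≤ Z * A) (hkZ : k * Z < 2)
    (h : (k * x - 2) * (2 - k * Z + Z) ≤ x * (2 - k * Z)) :
    0 ≤ (2 - k * x) * a ^ 2 + (2 - k * Z) * A + (l * a + m) ^ 2 := by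
  have hx : 0 ≤ x := hl ▸ sq_nonneg l
  have hc : 0 < 2 - k * Z := by linarith
  have hs : 0 < 2 - k * Z + Z := by linarith
  rcases hZ.eq_or_lt with rfl | hZ
  · have : m = 0 := by nlinarith [sq_nonneg m]
    subst this
    have : (l * a + 0) ^ 2 = x * a ^ 2 := by rw [← hl]; ring
    rw [this]
    nlinarith [sq_nonneg a]
  · have h1 : (2 - k * Z) * m ^ 2 ≤ Z * ((2 - k * Z) * A) := by nlinarith
    have h2 : 0 ≤ Z * ((2 - k * x) * a ^ 2 + (l * a + m) ^ 2) + (2 - k * Z) * m ^ 2 := by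
      have h3 : (2 - k * Z + Z) * (Z * ((2 - k * x) * a ^ 2 + (l * a + m) ^ 2) + (2 - k * Z) * m ^ 2)
          = ((2 - k * Z + Z) * m + Z * l * a) ^ 2
            + Z * a ^ 2 * (x * (2 - k * Z) - (k * x - 2) * (2 - k * Z + Z)) := by
        rw [← hl]; ring
      have h4 : 0 ≤ (2 - k * Z + Z) *
          (Z * ((2 - k * x) * a ^ 2 + (l * a + m) ^ 2) + (2 - k * Z) * m ^ 2) := by
        rw [h3]
        have : 0 ≤ Z * a ^ 2 * (x * (2 - k * Z) - (k * x - 2) * (2 - k * Z + Z)) :=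
          mul_nonneg (by positivity) (by linarith)
        positivity
      exact nonneg_of_mul_nonneg_right h4 hs
    have h5 : 0 ≤ Z * ((2 - k * x) * a ^ 2 + (2 - k * Z) * A + (l * a + m) ^ 2) := by
      nlinarith
    exact nonneg_of_mul_nonneg_right h5 hZ

theorem sum_form_nonneg {ι : Type*} [DecidableEq ι] (s : Finset ι) (l a : ι → ℝ) (k : ℝ)
    (h : ∀ i ∈ s, 2 < k * l i ^ 2 → k * (∑ j ∈ s.erase i, l j ^ 2) < 2 ∧
      (k * l i ^ 2 - 2) * (2 - k * (∑ j ∈ s.erase i, l j ^ 2) + ∑ j ∈ s.erase i, l j ^ 2)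
        ≤ l i ^ 2 * (2 - k * (∑ j ∈ s.erase i, l j ^ 2))) :
    0 ≤ ∑ i ∈ s, (2 - k * l i ^ 2) * a i ^ 2 + (∑ i ∈ s, l i * a i) ^ 2 := by
  by_cases hs : ∃ i ∈ s, 2 < k * l i ^ 2
  · obtain ⟨i, hi, hki⟩ := hs
    obtain ⟨h1, h2⟩ := h i hi hki
    rw [← Finset.add_sum_erase s _ hi, ← Finset.add_sum_erase s (fun i => l i * a i) hi]
    set Z := ∑ j ∈ s.erase i, l j ^ 2 with hZ
    have hk : 0 < k := by
      by_contra hk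
      nlinarith [sq_nonneg (l i)]
    have h3 : (2 - k * Z) * ∑ j ∈ s.erase i, a j ^ 2 ≤
        ∑ j ∈ s.erase i, (2 - k * l j ^ 2) * a j ^ 2 := by
      rw [Finset.mul_sum]
      refine Finset.sum_le_sum fun j hj => ?_
      have : l j ^ 2 ≤ Z := Finset.single_le_sum (f := fun j => l j ^ 2)
        (fun j _ => sq_nonneg _) hj
      have := mul_le_mul_of_nonneg_left this hk.le
      exact mul_le_mul_of_nonneg_right (by linarith) (sq_nonneg _)
    have h4 := two_var_form_nonneg (a := a i) (l := l i) (m := ∑ j ∈ s.erase i, l j * a j)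
      (A := ∑ j ∈ s.erase i, a j ^ 2) rfl
      (Finset.sum_nonneg fun j _ => sq_nonneg (l j)) (Finset.sum_nonneg fun j _ => sq_nonneg (a j))
      (Finset.sum_mul_sq_le_sq_mul_sq _ _ _) h1 h2
    linarith
  · push Not at hs
    have : 0 ≤ ∑ i ∈ s, (2 - k * l i ^ 2) * a i ^ 2 :=
      Finset.sum_nonneg fun i hi => mul_nonneg (by linarith [hs i hi]) (sq_nonneg _)
    positivity

theorem one_add_sum_le_prod {ι : Type*} (s : Finset ι) (z : ι → ℝ) (hz : ∀ i ∈ s, 0 ≤ z i) :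
    1 + ∑ i ∈ s, z i ≤ ∏ i ∈ s, (1 + z i) := by
  classical
  induction s using Finset.induction_on with
  | empty => simp
  | insert i s hi ih =>
    rw [Finset.sum_insert hi, Finset.prod_insert hi]
    have h1 := ih fun j hj => hz j (Finset.mem_insert_of_mem hj)
    have h2 := hz i (Finset.mem_insert_self i s)
    have h3 : 0 ≤ ∑ j ∈ s, z j := Finset.sum_nonneg fun j hj => hz j (Finset.mem_insert_of_mem hj)
    nlinarith

theorem slope_polynomial_bound {x y Z : ℝ} (hx : 0 ≤ x) (hy : 0 ≤ y) (hZ : 0 ≤ Z)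
    (h : (1 + y) * (1 + x) * (1 + Z) ≤ 9) (hk : 2 < (y - 1) * x) :
    (y - 1) * Z < 2 ∧
      ((y - 1) * x - 2) * (2 - (y - 1) * Z + Z) ≤ x * (2 - (y - 1) * Z) := by
  have hy1 : 1 < y := by
    by_contra hcon
    nlinarith
  have hxy : (1 + y) * (1 + x) ≤ 9 := by
    have : 0 ≤ (1 + y) * (1 + x) * Z := by positivity
    nlinarith
  have hy5 : y ≤ 5 := by
    have : (1 + y) * (y + 1) < 9 * (y - 1) := by nlinarith
    nlinarith
  have hx2 : x ≤ 2 := by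
    have h1 : 2 * (1 + x) ^ 2 ≤ 9 * x := by nlinarith
    by_contra hcon
    nlinarith
  have h8 : 8 ≤ (1 + y) * (1 + x) := by
    have h1 : (1 + y) * (y + 1) ≤ (1 + y) * (1 + x) * (y - 1) := by nlinarith
    by_contra hcon
    push Not at hcon
    nlinarith [sq_nonneg (y - 3)]
  have hZ8 : Z ≤ 1 / 8 := by nlinarith
  have hP : x * (y - 2) ≤ 81 / 50 := by
    rcases le_total y 2 with h2 | h2
    · nlinarith
    · have h1 : (1 + y) * (x * (y - 2)) ≤ (8 - y) * (y - 2) := by nlinarith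
      have h3 : (8 - y) * (y - 2) ≤ 81 / 50 * (1 + y) := by nlinarith [sq_nonneg (y - 4.19)]
      have h4 : (1 + y) * (x * (y - 2)) ≤ (1 + y) * (81 / 50) := by linarith
      exact le_of_mul_le_mul_left h4 (by linarith)
  have hB : x * (y - 1) * (3 - y) + 2 * (y - 2) ≤ 6 := by
    rcases le_total y 3 with h3 | h3
    · have : (y - 1) * (3 - y) ≤ 1 := by nlinarith [sq_nonneg (y - 2)]
      nlinarith
    · have : 0 ≤ x * (y - 1) * (y - 3) :=
        mul_nonneg (mul_nonneg hx (by linarith)) (by linarith)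
      nlinarith
  refine ⟨by nlinarith, ?_⟩
  have hZB : Z * (x * (y - 1) * (3 - y) + 2 * (y - 2)) ≤ 3 / 4 := by nlinarith
  nlinarith

theorem triple_form_nonneg {a b c : ℝ} (h : (1 + a ^ 2) * (1 + b ^ 2) * (1 + c ^ 2) ≤ 9)
    (x y z : ℝ) :
    0 ≤ x ^ 2 + y ^ 2 + z ^ 2 + a * b * (x * y) + b * c * (y * z) + a * c * (x * z) := by
  have key : ∀ p q r : ℝ, 0 ≤ p → 0 ≤ q → 0 ≤ r → (1 + p) * (1 + q) * (1 + r) ≤ 9 → 2 < 1 * p →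
      1 * (q + r) < 2 ∧ (1 * p - 2) * (2 - 1 * (q + r) + (q + r)) ≤ p * (2 - 1 * (q + r)) := by
    intro p q r hp hq hr h hp2
    have h1 : (1 + p) * (1 + (q + r)) ≤ 9 := by
      have : 0 ≤ (1 + p) * (q * r) := by positivity
      nlinarith
    refine ⟨by nlinarith, ?_⟩
    have h2 : p * (q + r) ≤ 4 := by
      by_contra hcon
      push Not at hcon
      have h3 : p + (q + r) < 4 := by nlinarith
      nlinarith [sq_nonneg (p - (q + r))]
    nlinarith
  have h0 := sum_form_nonneg (Finset.univ : Finset (Fin 3)) ![a, b, c] ![x, y, z] 1 (by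
    intro i _ hi
    fin_cases i
    · have e : (Finset.univ : Finset (Fin 3)).erase 0 = {1, 2} := by decide
      simp only [Fin.zero_eta, e] at hi ⊢
      simp only [Finset.sum_pair (show (1 : Fin 3) ≠ 2 by decide), Matrix.cons_val] at hi ⊢
      exact key _ _ _ (sq_nonneg _) (sq_nonneg _) (sq_nonneg _) (by linarith) hi
    · have e : (Finset.univ : Finset (Fin 3)).erase 1 = {0, 2} := by decide
      simp only [Fin.mk_one, e] at hi ⊢
      simp only [Finset.sum_pair (show (0 : Fin 3) ≠ 2 by decide), Matrix.cons_val] at hi ⊢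
      exact key _ _ _ (sq_nonneg _) (sq_nonneg _) (sq_nonneg _) (by linarith) hi
    · have e : (Finset.univ : Finset (Fin 3)).erase 2 = {0, 1} := by decide
      simp only [Fin.reduceFinMk, e] at hi ⊢
      simp only [Finset.sum_pair (show (0 : Fin 3) ≠ 1 by decide), Matrix.cons_val] at hi ⊢
      exact key _ _ _ (sq_nonneg _) (sq_nonneg _) (sq_nonneg _) (by linarith) hi)
  simp only [Fin.sum_univ_three, Matrix.cons_val] at h0
  nlinarith

theorem column_form_nonneg {n : ℕ} (l : Fin n → ℝ) (hl : ∏ i, (1 + l i ^ 2) ≤ 9) (β : Fin n)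
    (t : ℝ) (a b : Fin n → ℝ) :
    0 ≤ (1 + l β ^ 2) * t ^ 2 + ∑ i ∈ Finset.univ.erase β,
        ((2 + l i ^ 2) * a i ^ 2 + b i ^ 2 + 2 * (l i * l β * (a i * b i)))
      + 10 * (l β * t + ∑ i ∈ Finset.univ.erase β, l i * a i) ^ 2 := by
  set s := (Finset.univ : Finset (Fin n)).erase β
  set y := l β ^ 2 with hy
  have hprod : (1 + y) * ∏ i ∈ s, (1 + l i ^ 2) ≤ 9 := by
    rwa [hy, Finset.mul_prod_erase _ (fun i => 1 + l i ^ 2) (Finset.mem_univ β)]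
  have hy0 : 0 ≤ y := sq_nonneg _
  have h1 := sum_form_nonneg s l a (y - 1) (by
    intro i hi hki
    refine slope_polynomial_bound (sq_nonneg _) hy0 (Finset.sum_nonneg fun j _ => sq_nonneg _)
      (le_trans ?_ hprod) hki
    rw [← Finset.mul_prod_erase s (fun i => 1 + l i ^ 2) hi, mul_assoc]
    exact mul_le_mul_of_nonneg_left (mul_le_mul_of_nonneg_left
      (one_add_sum_le_prod _ _ fun j _ => sq_nonneg _) (by positivity)) (by positivity))
  have h2 : ∑ i ∈ s, (2 - (y - 1) * l i ^ 2) * a i ^ 2 ≤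
      ∑ i ∈ s, ((2 + l i ^ 2) * a i ^ 2 + b i ^ 2 + 2 * (l i * l β * (a i * b i))) := by
    refine Finset.sum_le_sum fun i _ => ?_
    rw [hy]
    nlinarith [sq_nonneg (b i + l i * l β * a i)]
  set m := ∑ i ∈ s, l i * a i
  have hy9 : 1 + y ≤ 9 := by
    have : 1 ≤ ∏ i ∈ s, (1 + l i ^ 2) := by
      have := one_add_sum_le_prod s (fun i => l i ^ 2) fun i _ => sq_nonneg _
      linarith [Finset.sum_nonneg (s := s) fun i _ => sq_nonneg (l i)]
    nlinarith
  have h3 : m ^ 2 ≤ (1 + y) * t ^ 2 + 10 * (l β * t + m) ^ 2 := by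
    have : (1 + y) * t ^ 2 + 10 * (l β * t + m) ^ 2 - m ^ 2
        = (t + l β * (l β * t + m)) ^ 2 + (9 - y) * (l β * t + m) ^ 2 := by
      rw [hy]; ring
    have h9 : 0 ≤ (9 - y) * (l β * t + m) ^ 2 := mul_nonneg (by linarith) (sq_nonneg _)
    linarith [sq_nonneg (t + l β * (l β * t + m))]
  linarith

end AlgebraicInequality

section TensorInequality

variable {n : ℕ}

theorem prod_subset_le_of_one_le {ι : Type*} [Fintype ι] [DecidableEq ι] (s : Finset ι)
    (z : ι → ℝ) (hz : ∀ i, 0 ≤ z i) : ∏ i ∈ s, (1 + z i) ≤ ∏ i, (1 + z i) := by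
  rw [← Finset.prod_mul_prod_compl s]
  have h1 : 1 ≤ ∏ i ∈ sᶜ, (1 + z i) := by
    have := one_add_sum_le_prod sᶜ z fun i _ => hz i
    linarith [Finset.sum_nonneg (s := sᶜ) fun i _ => hz i]
  exact le_mul_of_one_le_right (Finset.prod_nonneg fun i _ => by linarith [hz i]) h1

theorem sum_triple_split (X : Fin n → Fin n → Fin n → ℝ) :
    ∑ i, ∑ j, ∑ k, X i j k =
      ∑ i, ∑ j, ∑ k, (if i ≠ j ∧ j ≠ k ∧ i ≠ k then X i j k else 0) +
      ∑ β, (X β β β + ∑ γ ∈ Finset.univ.erase β, (X γ γ β + X γ β γ + X β γ γ)) := by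
  have h0 : ∀ i j k, X i j k = (if i ≠ j ∧ j ≠ k ∧ i ≠ k then X i j k else 0)
      + (if i = j then (if i = k then X i j k else 0) else 0)
      + (if i = j then (if i = k then 0 else X i j k) else 0)
      + (if i = k then (if i = j then 0 else X i j k) else 0)
      + (if j = k then (if i = j then 0 else X i j k) else 0) := by
    intro i j k
    by_cases h1 : i = j <;> by_cases h2 : j = k <;> by_cases h3 : i = k <;>
      simp_all
  have hs : ∀ (Y : Fin n → Fin n → ℝ), ∑ β, ∑ γ ∈ Finset.univ.erase β, Y β γ =
      ∑ β, ∑ γ, if γ = β then 0 else Y β γ := by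
    intro Y
    refine Finset.sum_congr rfl fun β _ => ?_
    rw [← Finset.add_sum_erase (Finset.univ) _ (Finset.mem_univ β)]
    simp only [if_true, zero_add]
    exact Finset.sum_congr rfl fun γ hγ => by rw [if_neg (Finset.ne_of_mem_erase hγ)]
  rw [Finset.sum_add_distrib, hs]
  have h1 : ∑ i, ∑ j, ∑ k, (if i = j then (if i = k then X i j k else 0) else 0)
      = ∑ β, X β β β := by
    refine Finset.sum_congr rfl fun i _ => ?_
    simp [Finset.sum_ite_irrel]
  have h2 : ∑ i, ∑ j, ∑ k, (if i = j then (if i = k then 0 else X i j k) else 0)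
      = ∑ β, ∑ γ, if γ = β then 0 else X γ γ β := by
    rw [Finset.sum_comm (s := Finset.univ) (t := Finset.univ)
      (f := fun β γ => if γ = β then 0 else X γ γ β)]
    refine Finset.sum_congr rfl fun i _ => ?_
    simp [Finset.sum_ite_irrel]
  have h3 : ∑ i, ∑ j, ∑ k, (if i = k then (if i = j then 0 else X i j k) else 0)
      = ∑ β, ∑ γ, if γ = β then 0 else X γ β γ := by
    rw [Finset.sum_comm (s := Finset.univ) (t := Finset.univ)
      (f := fun β γ => if γ = β then 0 else X γ β γ)]
    refine Finset.sum_congr rfl fun i _ => Finset.sum_congr rfl fun j _ => ?_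
    simp
  have h4 : ∑ i, ∑ j, ∑ k, (if j = k then (if i = j then 0 else X i j k) else 0)
      = ∑ β, ∑ γ, if γ = β then 0 else X β γ γ := by
    refine Finset.sum_congr rfl fun i _ => Finset.sum_congr rfl fun j _ => ?_
    simp [eq_comm]
  have h5 : ∀ β γ, (if γ = β then 0 else X γ γ β + X γ β γ + X β γ γ)
      = (if γ = β then 0 else X γ γ β) + (if γ = β then 0 else X γ β γ)
        + (if γ = β then 0 else X β γ γ) := by
    intro β γ; split_ifs <;> simp
  simp only [h5, Finset.sum_add_distrib]
  rw [← h1, ← h2, ← h3, ← h4]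
  simp only [add_assoc, ← Finset.sum_add_distrib]
  refine Finset.sum_congr rfl fun i _ => Finset.sum_congr rfl fun j _ =>
    Finset.sum_congr rfl fun k _ => ?_
  exact (h0 i j k).trans (by ring)

theorem second_fundamental_form_inequality (l : Fin n → ℝ) (hl : ∏ i, (1 + l i ^ 2) ≤ 9)
    (h : Fin n → Fin n → Fin n → ℝ) (hsymm : ∀ j i k, h j i k = h j k i) :
    0 ≤ ∑ i, ∑ j, ∑ k, (h j i k ^ 2 + l i * l j * (h j i k * h i j k))
      + 10 * ∑ k, (∑ i, l i * h i i k) ^ 2 := by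
  rw [sum_triple_split, Finset.mul_sum, add_assoc, ← Finset.sum_add_distrib]
  refine add_nonneg ?_ (Finset.sum_nonneg fun β _ => ?_)
  · set Φ : Fin n → Fin n → Fin n → ℝ := fun i j k =>
      if i ≠ j ∧ j ≠ k ∧ i ≠ k then h j i k ^ 2 + l i * l j * (h j i k * h i j k) else 0 with hΦ
    have h1 : ∑ i, ∑ j, ∑ k, Φ i j k = ∑ i, ∑ j, ∑ k, Φ j k i := by
      rw [Finset.sum_comm' (t' := Finset.univ) (s' := fun _ => Finset.univ) (by simp)]
      conv_rhs => rw [Finset.sum_comm]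
      rw [Finset.sum_comm]
      refine Finset.sum_congr rfl fun i _ => ?_
      rw [Finset.sum_comm]
    have h2 : ∑ i, ∑ j, ∑ k, Φ i j k = ∑ i, ∑ j, ∑ k, Φ k i j := by
      rw [Finset.sum_comm]
      refine Finset.sum_congr rfl fun i _ => ?_
      rw [Finset.sum_comm]
    have h3 : 0 ≤ ∑ i, ∑ j, ∑ k, (Φ i j k + Φ j k i + Φ k i j) := by
      refine Finset.sum_nonneg fun i _ => Finset.sum_nonneg fun j _ =>
        Finset.sum_nonneg fun k _ => ?_
      by_cases hd : i ≠ j ∧ j ≠ k ∧ i ≠ k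
      · obtain ⟨hij, hjk, hik⟩ := hd
        have hp : (1 + l i ^ 2) * (1 + l j ^ 2) * (1 + l k ^ 2) ≤ 9 := by
          refine le_trans ?_ (le_trans (prod_subset_le_of_one_le {i, j, k} (fun i => l i ^ 2)
            fun i => sq_nonneg _) hl)
          rw [Finset.prod_insert (by simp [hij, hik]), Finset.prod_pair hjk, mul_assoc]
        have := triple_form_nonneg hp (h i j k) (h j i k) (h k i j)
        simp only [hΦ, ne_eq, hij, hjk, hik, Ne.symm hij, Ne.symm hjk, Ne.symm hik,
          not_false_eq_true, and_self, if_true]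
        rw [hsymm k j i, hsymm j k i, hsymm i k j]
        linarith
      · have e1 : ¬ (j ≠ k ∧ k ≠ i ∧ j ≠ i) := by tauto
        have e2 : ¬ (k ≠ i ∧ i ≠ j ∧ k ≠ j) := by tauto
        simp only [hΦ, if_neg hd, if_neg e1, if_neg e2]; simp
    simp only [Finset.sum_add_distrib] at h3
    linarith
  · have := column_form_nonneg l hl β (h β β β) (fun i => h i i β) (fun i => h β i i)
    rw [← Finset.add_sum_erase Finset.univ (fun i => l i * h i i β) (Finset.mem_univ β)]
    refine this.trans (le_of_eq ?_)
    congr 1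
    congr 1
    · ring
    · refine Finset.sum_congr rfl fun γ _ => ?_
      rw [hsymm γ β γ]; ring

theorem second_fundamental_form_strict_inequality {ε : ℝ} (hε : 0 ≤ ε) (l : Fin n → ℝ)
    (hl : (1 + ε) ^ n * ∏ i, (1 + l i ^ 2) ≤ 9)
    (h : Fin n → Fin n → Fin n → ℝ) (hsymm : ∀ j i k, h j i k = h j k i) :
    ε / (1 + ε) * ∑ i, ∑ j, ∑ k, h j i k ^ 2 ≤
      ∑ i, ∑ j, ∑ k, (h j i k ^ 2 + l i * l j * (h j i k * h i j k))
      + 10 * ∑ k, (∑ i, l i * h i i k) ^ 2 := by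
  have hs : √(1 + ε) ^ 2 = 1 + ε := Real.sq_sqrt (by linarith)
  have hs' : √(1 + ε) * √(1 + ε) = 1 + ε :=
    Real.mul_self_sqrt (by linarith)
  have h1 := second_fundamental_form_inequality (fun i => √(1 + ε) * l i) (by
    refine le_trans ?_ hl
    have : (1 + ε) ^ n * ∏ i, (1 + l i ^ 2) = ∏ i : Fin n, ((1 + ε) * (1 + l i ^ 2)) := by
      rw [Finset.prod_mul_distrib]; simp
    rw [this]
    refine Finset.prod_le_prod (fun i _ => by positivity) fun i _ => ?_
    rw [mul_pow, hs]; nlinarith) h hsymm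
  have h2 : ∀ i j k, √(1 + ε) * l i * (√(1 + ε) * l j) * (h j i k * h i j k)
      = (1 + ε) * (l i * l j * (h j i k * h i j k)) := by
    intro i j k; linear_combination (l i * l j * (h j i k * h i j k)) * hs'
  have h3 : ∀ k, (∑ i, √(1 + ε) * l i * h i i k) ^ 2 = (1 + ε) * (∑ i, l i * h i i k) ^ 2 := by
    intro k
    have : ∑ i, √(1 + ε) * l i * h i i k = √(1 + ε) * ∑ i, l i * h i i k := by
      rw [Finset.mul_sum]; exact Finset.sum_congr rfl fun i _ => mul_assoc _ _ _
    rw [this, mul_pow, hs]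
  simp only [h2, h3, Finset.sum_add_distrib, ← Finset.mul_sum] at h1 ⊢
  have h4 : 0 < 1 + ε := by linarith
  rw [div_mul_eq_mul_div, div_le_iff₀ h4]
  linarith

theorem frame_bochner_inequality {m : ℕ} {ε : ℝ} (hε : 0 ≤ ε) (μ : Fin n → ℝ) (hμ : ∀ i, 0 ≤ μ i)
    (hμp : (1 + ε) ^ n * ∏ i, (1 + μ i) ≤ 9) (F : Fin n → Fin m → ℝ)
    (hF : ∀ i j, ∑ α, F i α * F j α = if i = j then μ i / (1 + μ i) else 0)
    (B : Fin n → Fin n → Fin m → ℝ) (hB : ∀ i k, B i k = B k i) :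
    ε / (9 * (1 + ε)) * ∑ i, ∑ k, ∑ α, B i k α ^ 2 ≤
      ∑ i, ∑ k, ∑ α, B i k α ^ 2
      + ∑ i, ∑ j, ∑ k, ((∑ α, B i k α * F j α) * (∑ α, B j k α * F i α)
          - (∑ α, B i k α * F j α) ^ 2)
      + 10 * ∑ k, (∑ i, ∑ α, B i k α * F i α) ^ 2 := by
  set p : Fin n → Fin n → Fin n → ℝ := fun i k j => ∑ α, B i k α * F j α with hp
  set l : Fin n → ℝ := fun i => √(μ i) with hl
  have hl2 : ∀ i, l i ^ 2 = μ i := fun i => Real.sq_sqrt (hμ i)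
  set h : Fin n → Fin n → Fin n → ℝ := fun j i k => p i k j / l j with hh
  have hsymm : ∀ j i k, h j i k = h j k i := by
    intro j i k; simp only [hh, hp]; rw [hB i k]
  have hμ9 : ∀ i, 1 + μ i ≤ 9 := by
    intro i
    have h1 := prod_subset_le_of_one_le {i} μ hμ
    rw [Finset.prod_singleton] at h1
    have h2 : 1 ≤ (1 + ε) ^ n := one_le_pow₀ (by linarith)
    nlinarith [hμ i]
  have hF0 : ∀ j, μ j = 0 → ∀ α, F j α = 0 := by
    intro j hj α
    have h1 := hF j j
    rw [if_pos rfl, hj] at h1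
    have h2 : ∀ β ∈ Finset.univ, 0 ≤ F j β * F j β := fun β _ => mul_self_nonneg _
    have := (Finset.sum_eq_zero_iff_of_nonneg h2).1 (by simpa using h1) α (Finset.mem_univ _)
    exact mul_self_eq_zero.1 this
  have hph : ∀ i k j, p i k j = l j * h j i k := by
    intro i k j
    by_cases hj : μ j = 0
    · have : p i k j = 0 := by simp [hp, hF0 j hj]
      simp [hh, this]
    · have : l j ≠ 0 := by
        intro h0; apply hj; rw [← hl2, h0]; ring
      simp only [hh]; field_simp
  have hbessel : ∀ i k, ∑ j, (1 + μ j) * h j i k ^ 2 ≤ ∑ α, B i k α ^ 2 := by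
    intro i k
    have hsq : 0 ≤ ∑ α, (B i k α - ∑ j, (1 + μ j) / μ j * p i k j * F j α) ^ 2 :=
      Finset.sum_nonneg fun α _ => sq_nonneg _
    have e1 : ∑ α, B i k α * (∑ j, (1 + μ j) / μ j * p i k j * F j α)
        = ∑ j, (1 + μ j) / μ j * p i k j ^ 2 := by
      simp only [Finset.mul_sum]
      rw [Finset.sum_comm]
      refine Finset.sum_congr rfl fun j _ => ?_
      have hpd : ∑ α, B i k α * F j α = p i k j := rfl
      have hcong : ∑ α, B i k α * ((1 + μ j) / μ j * p i k j * F j α)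
          = ∑ α, (1 + μ j) / μ j * p i k j * (B i k α * F j α) :=
        Finset.sum_congr rfl fun α _ => by ring
      rw [hcong, ← Finset.mul_sum, hpd]; ring
    have e2 : ∑ α, (∑ j, (1 + μ j) / μ j * p i k j * F j α) ^ 2
        = ∑ j, (1 + μ j) / μ j * p i k j ^ 2 := by
      simp only [sq, Finset.sum_mul_sum]
      rw [Finset.sum_comm]
      refine Finset.sum_congr rfl fun j _ => ?_
      rw [Finset.sum_comm]
      have : ∀ q, ∑ α, (1 + μ j) / μ j * p i k j * F j α * ((1 + μ q) / μ q * p i k q * F q α)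
          = if j = q then (1 + μ j) / μ j * (p i k j * p i k j) else 0 := by
        intro q
        have : ∑ α, (1 + μ j) / μ j * p i k j * F j α * ((1 + μ q) / μ q * p i k q * F q α)
          = (1 + μ j) / μ j * p i k j * ((1 + μ q) / μ q * p i k q) * ∑ α, F j α * F q α := by
          generalize p i k j = a, p i k q = b
          rw [Finset.mul_sum]; exact Finset.sum_congr rfl fun α _ => by ring
        rw [this, hF]
        split_ifs with hq
        · subst hq
          by_cases hj : μ j = 0
          · simp [hj]
          · have := hμ j
            field_simp
        · simp
      simp only [this]
      simp
    have e3 : ∀ j, (1 + μ j) / μ j * p i k j ^ 2 = (1 + μ j) * h j i k ^ 2 := by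
      intro j
      rw [hph, mul_pow, hl2]
      by_cases hj : μ j = 0
      · have : h j i k = 0 := by simp [hh, hl, hj]
        simp [this]
      · field_simp
    have e4 : ∑ α, (B i k α - ∑ j, (1 + μ j) / μ j * p i k j * F j α) ^ 2
        = ∑ α, B i k α ^ 2 - 2 * ∑ α, B i k α * (∑ j, (1 + μ j) / μ j * p i k j * F j α)
          + ∑ α, (∑ j, (1 + μ j) / μ j * p i k j * F j α) ^ 2 := by
      rw [Finset.mul_sum, ← Finset.sum_sub_distrib, ← Finset.sum_add_distrib]
      exact Finset.sum_congr rfl fun α _ => by ring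
    rw [e4, e1, e2] at hsq
    simp only [e3] at hsq
    linarith
  have hmain := second_fundamental_form_strict_inequality hε l (by simpa only [hl2] using hμp)
    h hsymm
  set S := ∑ i, ∑ k, ∑ α, B i k α ^ 2
  set T := ∑ i, ∑ k, ∑ j, (1 + μ j) * h j i k ^ 2 with hT
  set W := ∑ i, ∑ j, ∑ k, h j i k ^ 2 with hW
  have hTS : T ≤ S := Finset.sum_le_sum fun i _ => Finset.sum_le_sum fun k _ => hbessel i k
  have hTW : T ≤ 9 * W := by
    rw [hW, Finset.mul_sum]
    refine Finset.sum_le_sum fun i _ => ?_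
    rw [Finset.sum_comm, Finset.mul_sum]
    refine Finset.sum_le_sum fun j _ => ?_
    rw [Finset.mul_sum]
    exact Finset.sum_le_sum fun k _ => mul_le_mul_of_nonneg_right (hμ9 j) (sq_nonneg _)
  have hT' : T = ∑ i, ∑ j, ∑ k, (1 + μ j) * h j i k ^ 2 :=
    Finset.sum_congr rfl fun i _ => Finset.sum_comm
  have e5 : ∑ i, ∑ j, ∑ k, (p i k j * p j k i - p i k j ^ 2) =
      ∑ i, ∑ j, ∑ k, (h j i k ^ 2 + l i * l j * (h j i k * h i j k)) - T := by
    rw [hT', ← Finset.sum_sub_distrib]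
    refine Finset.sum_congr rfl fun i _ => ?_
    rw [← Finset.sum_sub_distrib]
    refine Finset.sum_congr rfl fun j _ => ?_
    rw [← Finset.sum_sub_distrib]
    refine Finset.sum_congr rfl fun k _ => ?_
    rw [hph, hph, ← hl2]; ring
  have e6 : ∀ k, ∑ i, ∑ α, B i k α * F i α = ∑ i, l i * h i i k := fun k =>
    Finset.sum_congr rfl fun i _ => hph i k i
  simp only [e6]
  change _ ≤ S + ∑ i, ∑ j, ∑ k, (p i k j * p j k i - p i k j ^ 2) + _
  rw [e5]
  have h4 : 0 < 1 + ε := by linarith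
  have h5 : ε / (9 * (1 + ε)) * T ≤ ε / (1 + ε) * W := by
    rw [show ε / (1 + ε) * W = ε / (9 * (1 + ε)) * (9 * W) by field_simp]
    exact mul_le_mul_of_nonneg_left hTW (by positivity)
  have h6 : ε / (9 * (1 + ε)) ≤ 1 := by
    rw [div_le_one (by positivity)]; linarith
  have h7 : ε / (9 * (1 + ε)) * (S - T) ≤ 1 * (S - T) :=
    mul_le_mul_of_nonneg_right h6 (by linarith)
  nlinarith

end TensorInequality

/-- The matrix `I + F Fᵀ` attached to the rows `F i`; the graph metric is of this form. -/
def onePlusGram {n m : ℕ} (F : Fin n → Fin m → ℝ) : Matrix (Fin n) (Fin n) ℝ :=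
  Matrix.of fun i j => (if i = j then (1 : ℝ) else 0) + ∑ α, F i α * F j α

section OnePlusGram

open Matrix

variable {n m : ℕ}

theorem onePlusGram_eq (F : Fin n → Fin m → ℝ) :
    onePlusGram F = 1 + Matrix.of F * (Matrix.of F)ᵀ := by
  ext i j
  simp [onePlusGram, Matrix.one_apply, Matrix.mul_apply]

theorem exists_orthogonal_diagonalization (F : Fin n → Fin m → ℝ) :
    ∃ (U : Matrix (Fin n) (Fin n) ℝ) (μ : Fin n → ℝ), (∀ i, 0 ≤ μ i) ∧ Uᵀ * U = 1 ∧ U * Uᵀ = 1 ∧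
      Uᵀ * (Matrix.of F * (Matrix.of F)ᵀ) * U = diagonal μ := by
  have hps : (Matrix.of F * (Matrix.of F)ᵀ).PosSemidef := by
    have := posSemidef_self_mul_conjTranspose (Matrix.of F)
    rwa [conjTranspose_eq_transpose_of_trivial] at this
  have h1 := hps.isHermitian.conjStarAlgAut_star_eigenvectorUnitary
  rw [Unitary.conjStarAlgAut_star_apply] at h1
  refine ⟨hps.isHermitian.eigenvectorUnitary, hps.isHermitian.eigenvalues,
    hps.eigenvalues_nonneg, ?_, ?_, ?_⟩
  · have := Unitary.coe_star_mul_self hps.isHermitian.eigenvectorUnitary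
    rwa [star_eq_conjTranspose, conjTranspose_eq_transpose_of_trivial] at this
  · have := Unitary.coe_mul_star_self hps.isHermitian.eigenvectorUnitary
    rwa [Unitary.coe_star, star_eq_conjTranspose, conjTranspose_eq_transpose_of_trivial] at this
  · rw [star_eq_conjTranspose, conjTranspose_eq_transpose_of_trivial] at h1
    rw [h1]; rfl

theorem transpose_mul_onePlusGram_mul {F : Fin n → Fin m → ℝ} {U : Matrix (Fin n) (Fin n) ℝ}
    {μ : Fin n → ℝ} (hU : Uᵀ * U = 1)
    (h : Uᵀ * (Matrix.of F * (Matrix.of F)ᵀ) * U = diagonal μ) :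
    Uᵀ * onePlusGram F * U = diagonal fun i => 1 + μ i := by
  rw [onePlusGram_eq, Matrix.mul_add, Matrix.add_mul, h, Matrix.mul_one, hU,
    ← diagonal_one, diagonal_add]

theorem det_onePlusGram_eq_prod {F : Fin n → Fin m → ℝ} {U : Matrix (Fin n) (Fin n) ℝ}
    {μ : Fin n → ℝ} (hU : Uᵀ * U = 1)
    (h : Uᵀ * (Matrix.of F * (Matrix.of F)ᵀ) * U = diagonal μ) :
    (onePlusGram F).det = ∏ i, (1 + μ i) := by
  have h1 := congrArg Matrix.det (transpose_mul_onePlusGram_mul hU h)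
  have h2 := congrArg Matrix.det hU
  rw [det_mul, det_mul, det_diagonal] at h1
  rw [det_mul, det_one] at h2
  rw [← h1]
  linear_combination -(onePlusGram F).det * h2

theorem one_add_sum_sq_le_det (F : Fin n → Fin m → ℝ) :
    1 + ∑ i, ∑ α, F i α ^ 2 ≤ (onePlusGram F).det := by
  obtain ⟨U, μ, hμ, hU, hU', h⟩ := exists_orthogonal_diagonalization F
  rw [det_onePlusGram_eq_prod hU h]
  refine le_trans (le_of_eq ?_) (one_add_sum_le_prod Finset.univ μ fun i _ => hμ i)
  congr 1
  have h1 := congrArg Matrix.trace h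
  rw [trace_mul_comm, ← Matrix.mul_assoc, hU', Matrix.one_mul, trace_diagonal] at h1
  rw [← h1]
  simp [Matrix.trace, Matrix.mul_apply, sq]

theorem one_le_det_onePlusGram (F : Fin n → Fin m → ℝ) : 1 ≤ (onePlusGram F).det := by
  have := one_add_sum_sq_le_det F
  have h : 0 ≤ ∑ i, ∑ α, F i α ^ 2 :=
    Finset.sum_nonneg fun i _ => Finset.sum_nonneg fun α _ => sq_nonneg _
  linarith

theorem sum_sq_conj_orthogonal {U : Matrix (Fin n) (Fin n) ℝ} (hU : U * Uᵀ = 1)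
    (X : Matrix (Fin n) (Fin n) ℝ) :
    ∑ i, ∑ j, X i j ^ 2 = ∑ i, ∑ j, (Uᵀ * X * U) i j ^ 2 := by
  have key : ∀ Y : Matrix (Fin n) (Fin n) ℝ, ∑ i, ∑ j, Y i j ^ 2 = (Y * Yᵀ).trace := by
    intro Y; simp [Matrix.trace, Matrix.mul_apply, sq]
  rw [key, key, transpose_mul, transpose_mul, transpose_transpose]
  have : Uᵀ * X * U * (Uᵀ * (Xᵀ * U)) = Uᵀ * (X * (U * Uᵀ) * Xᵀ) * U := by
    simp only [Matrix.mul_assoc]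
  rw [this, hU, Matrix.mul_one, trace_mul_comm (Uᵀ * _), ← Matrix.mul_assoc U, hU, Matrix.one_mul]

/-- A frame which is orthonormal for the metric `I + F Fᵀ` and diagonalizes `F Fᵀ`. -/
theorem exists_adapted_frame (F : Fin n → Fin m → ℝ) (h9 : (onePlusGram F).det ≤ 9) :
    ∃ (μ : Fin n → ℝ) (E : Matrix (Fin n) (Fin n) ℝ), (∀ i, 0 ≤ μ i) ∧
      ∏ i, (1 + μ i) = (onePlusGram F).det ∧ Eᵀ * onePlusGram F * E = 1 ∧
      E * Eᵀ = (onePlusGram F)⁻¹ ∧ E.det ^ 2 * (onePlusGram F).det = 1 ∧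
      (∀ a b, ∑ α, (∑ i, E i a * F i α) * (∑ i, E i b * F i α)
        = if a = b then μ a / (1 + μ a) else 0) ∧
      ∀ X : Matrix (Fin n) (Fin n) ℝ,
        ∑ i, ∑ j, X i j ^ 2 ≤ 81 * ∑ i, ∑ j, (Eᵀ * X * E) i j ^ 2 := by
  obtain ⟨U, μ, hμ, hU, hU', h⟩ := exists_orthogonal_diagonalization F
  have hdet := det_onePlusGram_eq_prod hU h
  have hpos : ∀ i, 0 < 1 + μ i := fun i => by linarith [hμ i]
  have hsq : ∀ i, √(1 + μ i) * √(1 + μ i) = 1 + μ i := fun i => Real.mul_self_sqrt (hpos i).le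
  have hspos : ∀ i, 0 < √(1 + μ i) := fun i => Real.sqrt_pos.2 (hpos i)
  have hμ9 : ∀ i, 1 + μ i ≤ 9 := by
    intro i
    have h1 := prod_subset_le_of_one_le {i} μ hμ
    rw [Finset.prod_singleton] at h1
    linarith
  set d : Fin n → ℝ := fun i => (√(1 + μ i))⁻¹ with hd
  have hdd : ∀ i, d i * d i = (1 + μ i)⁻¹ := fun i => by
    simp only [hd]; rw [← mul_inv, hsq]
  set E := U * diagonal d with hE
  have hET : Eᵀ = diagonal d * Uᵀ := by rw [hE, transpose_mul, diagonal_transpose]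
  have hconj : ∀ X : Matrix (Fin n) (Fin n) ℝ,
      Eᵀ * X * E = diagonal d * (Uᵀ * X * U) * diagonal d := by
    intro X; rw [hET, hE]; simp only [Matrix.mul_assoc]
  have horth : Eᵀ * onePlusGram F * E = 1 := by
    rw [hconj, transpose_mul_onePlusGram_mul hU h, diagonal_mul_diagonal, diagonal_mul_diagonal,
      ← diagonal_one]
    congr 1; ext i
    rw [mul_right_comm, hdd, inv_mul_cancel₀ (hpos i).ne']
  have hinv : E * Eᵀ = (onePlusGram F)⁻¹ := by
    symm
    apply Matrix.inv_eq_left_inv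
    rw [Matrix.mul_assoc]
    exact mul_eq_one_comm.1 horth
  refine ⟨μ, E, hμ, hdet.symm, horth, hinv, ?_, ?_, ?_⟩
  · have := congrArg Matrix.det horth
    rw [det_mul, det_mul, det_transpose, det_one] at this
    linarith
  · intro a b
    have h1 : ∑ α, (∑ i, E i a * F i α) * (∑ i, E i b * F i α)
        = (Eᵀ * (Matrix.of F * (Matrix.of F)ᵀ) * E) a b := by
      have : Eᵀ * (Matrix.of F * (Matrix.of F)ᵀ) * E
          = (Eᵀ * Matrix.of F) * (Eᵀ * Matrix.of F)ᵀ := by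
        rw [transpose_mul Eᵀ, transpose_transpose]; simp only [Matrix.mul_assoc]
      rw [this, Matrix.mul_apply]
      simp [Matrix.mul_apply]
    rw [h1, hconj, h, diagonal_mul_diagonal, diagonal_mul_diagonal, diagonal_apply]
    split_ifs with hab
    · rw [mul_right_comm, hdd]; field_simp
    · rfl
  · intro X
    rw [sum_sq_conj_orthogonal hU' X, Finset.mul_sum]
    refine Finset.sum_le_sum fun i _ => ?_
    rw [Finset.mul_sum]
    refine Finset.sum_le_sum fun j _ => ?_
    rw [hconj, mul_diagonal, diagonal_mul]
    have h1 : 1 ≤ 9 * (d i * d i) := by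
      rw [hdd, ← div_eq_mul_inv, one_le_div (hpos i)]; exact hμ9 i
    have h2 : 1 ≤ 9 * (d j * d j) := by
      rw [hdd, ← div_eq_mul_inv, one_le_div (hpos j)]; exact hμ9 j
    have h3 : 1 ≤ (9 * (d i * d i)) * (9 * (d j * d j)) := one_le_mul_of_one_le_of_one_le h1 h2
    nlinarith [sq_nonneg ((Uᵀ * X * U) i j)]

end OnePlusGram

section Minimality

open Matrix

variable {n m : ℕ}

theorem graphMetric_eq_onePlusGram (f : (Fin n → ℝ) → (Fin m → ℝ)) (x : Fin n → ℝ) :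
    graphMetric f x = onePlusGram fun i α => pderiv' i (fun y => f y α) x := rfl

theorem one_le_det_graphMetric (f : (Fin n → ℝ) → (Fin m → ℝ)) (x : Fin n → ℝ) :
    1 ≤ (graphMetric f x).det :=
  one_le_det_onePlusGram _

theorem isUnit_det_graphMetric (f : (Fin n → ℝ) → (Fin m → ℝ)) (x : Fin n → ℝ) :
    IsUnit (graphMetric f x).det :=
  isUnit_iff_ne_zero.2 (by linarith [one_le_det_graphMetric f x])

theorem graphMetric_transpose (f : (Fin n → ℝ) → (Fin m → ℝ)) (x : Fin n → ℝ) :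
    (graphMetric f x)ᵀ = graphMetric f x := by
  ext i j
  simp only [graphMetric, Matrix.transpose_apply, Matrix.of_apply, eq_comm, mul_comm]

theorem graphMetric_inv_transpose (f : (Fin n → ℝ) → (Fin m → ℝ)) (x : Fin n → ℝ) :
    ((graphMetric f x)⁻¹)ᵀ = (graphMetric f x)⁻¹ := by
  rw [transpose_nonsing_inv, graphMetric_transpose]

theorem contDiff_component {f : (Fin n → ℝ) → (Fin m → ℝ)} (hf : ContDiff ℝ (⊤ : ℕ∞) f)
    (α : Fin m) : ContDiff ℝ (⊤ : ℕ∞) fun y => f y α :=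
  contDiff_pi.1 hf α

theorem contDiff_graphMetric {f : (Fin n → ℝ) → (Fin m → ℝ)} (hf : ContDiff ℝ (⊤ : ℕ∞) f)
    (i j : Fin n) : ContDiff ℝ (⊤ : ℕ∞) fun y => graphMetric f y i j := by
  refine contDiff_const.add (ContDiff.sum fun α _ => ?_)
  exact ((contDiff_component hf α).pderiv' i).mul ((contDiff_component hf α).pderiv' j)

theorem contDiff_graphMetric_inv {f : (Fin n → ℝ) → (Fin m → ℝ)} (hf : ContDiff ℝ (⊤ : ℕ∞) f)
    (i j : Fin n) : ContDiff ℝ (⊤ : ℕ∞) fun y => (graphMetric f y)⁻¹ i j :=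
  ContDiff.matrix_inv (contDiff_graphMetric hf) (fun x => (isUnit_det_graphMetric f x).ne_zero) i j

theorem contDiff_graphTangent {f : (Fin n → ℝ) → (Fin m → ℝ)} (hf : ContDiff ℝ (⊤ : ℕ∞) f)
    (i : Fin n) (k : Fin n ⊕ Fin m) : ContDiff ℝ (⊤ : ℕ∞) fun y => graphTangent f i y k := by
  have h : ContDiff ℝ (⊤ : ℕ∞) fun y => graphMap f y k := by
    cases k with
    | inl k => exact contDiff_apply ℝ ℝ k
    | inr α => exact contDiff_component hf α
  exact ContDiff.pderiv' i h

theorem contDiff_meanCurvature {f : (Fin n → ℝ) → (Fin m → ℝ)} (hf : ContDiff ℝ (⊤ : ℕ∞) f)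
    (k : Fin n ⊕ Fin m) : ContDiff ℝ (⊤ : ℕ∞) fun y => meanCurvature f y k := by
  refine ContDiff.sum fun i _ => ContDiff.sum fun j _ => (contDiff_graphMetric_inv hf i j).mul
    (ContDiff.sum fun l _ => ContDiff.mul ?_ ((contDiff_graphTangent hf j l).pderiv' i))
  refine contDiff_const.sub (ContDiff.sum fun a _ => ContDiff.sum fun b _ => ?_)
  exact ((contDiff_graphMetric_inv hf a b).mul (contDiff_graphTangent hf a k)).mul
    (contDiff_graphTangent hf b l)

theorem graphTangent_inl (f : (Fin n → ℝ) → (Fin m → ℝ)) (i k : Fin n) (x : Fin n → ℝ) :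
    graphTangent f i x (Sum.inl k) = if k = i then 1 else 0 :=
  pderiv'_coord i k x

theorem graphTangent_inr (f : (Fin n → ℝ) → (Fin m → ℝ)) (i : Fin n) (α : Fin m)
    (x : Fin n → ℝ) : graphTangent f i x (Sum.inr α) = pderiv' i (fun y => f y α) x := rfl

/-- The matrix whose rows are the coordinate tangent vectors of the graph. -/
def tangentMatrix (f : (Fin n → ℝ) → (Fin m → ℝ)) (x : Fin n → ℝ) :
    Matrix (Fin n) (Fin n ⊕ Fin m) ℝ :=
  Matrix.of fun i k => graphTangent f i x k

theorem tangentMatrix_mul_transpose (f : (Fin n → ℝ) → (Fin m → ℝ)) (x : Fin n → ℝ) :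
    tangentMatrix f x * (tangentMatrix f x)ᵀ = graphMetric f x := by
  ext i j
  simp [Matrix.mul_apply, tangentMatrix, graphTangent_inl, graphTangent_inr, graphMetric, eq_comm]

theorem normalProjection_eq (f : (Fin n → ℝ) → (Fin m → ℝ)) (x : Fin n → ℝ) :
    normalProjection f x =
      1 - (tangentMatrix f x)ᵀ * (graphMetric f x)⁻¹ * tangentMatrix f x := by
  ext k l
  simp only [normalProjection, Matrix.of_apply, Matrix.sub_apply, Matrix.one_apply,
    Matrix.mul_apply, Matrix.transpose_apply, tangentMatrix, Finset.sum_mul]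
  rw [Finset.sum_comm]
  congr 1
  exact Finset.sum_congr rfl fun j _ => Finset.sum_congr rfl fun i _ => by ring

theorem tangentMatrix_mul_normalProjection (f : (Fin n → ℝ) → (Fin m → ℝ)) (x : Fin n → ℝ) :
    tangentMatrix f x * normalProjection f x = 0 := by
  rw [normalProjection_eq, Matrix.mul_sub, Matrix.mul_one, ← Matrix.mul_assoc,
    ← Matrix.mul_assoc, tangentMatrix_mul_transpose,
    Matrix.mul_nonsing_inv _ (isUnit_det_graphMetric f x), Matrix.one_mul, sub_self]

/-- The metric trace of the second derivatives of the graph map. -/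
def graphMapTrace (f : (Fin n → ℝ) → (Fin m → ℝ)) (x : Fin n → ℝ) : Fin n ⊕ Fin m → ℝ :=
  fun l => ∑ i, ∑ j, (graphMetric f x)⁻¹ i j * pderiv' i (fun y => graphTangent f j y l) x

theorem meanCurvature_eq (f : (Fin n → ℝ) → (Fin m → ℝ)) (x : Fin n → ℝ) :
    meanCurvature f x = normalProjection f x *ᵥ graphMapTrace f x := by
  ext k
  simp only [meanCurvature, mulVec, dotProduct, graphMapTrace, Finset.mul_sum]
  symm
  rw [Finset.sum_comm]
  refine Finset.sum_congr rfl fun i _ => ?_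
  rw [Finset.sum_comm]
  exact Finset.sum_congr rfl fun j _ => Finset.sum_congr rfl fun l _ => by ring

theorem tangentMatrix_mulVec_meanCurvature (f : (Fin n → ℝ) → (Fin m → ℝ)) (x : Fin n → ℝ) :
    tangentMatrix f x *ᵥ meanCurvature f x = 0 := by
  rw [meanCurvature_eq, mulVec_mulVec, tangentMatrix_mul_normalProjection, zero_mulVec]

/-- A vector with vanishing normal part is recovered from its tangential products. -/
theorem eq_tangential_of_normalProjection_eq_zero {f : (Fin n → ℝ) → (Fin m → ℝ)}
    {x : Fin n → ℝ} {w : Fin n ⊕ Fin m → ℝ} (h : normalProjection f x *ᵥ w = 0) :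
    w = (tangentMatrix f x)ᵀ *ᵥ ((graphMetric f x)⁻¹ *ᵥ (tangentMatrix f x *ᵥ w)) := by
  rw [normalProjection_eq, sub_mulVec, one_mulVec, sub_eq_zero] at h
  rwa [mulVec_mulVec, mulVec_mulVec]

theorem transpose_tangentMatrix_mulVec_inl (f : (Fin n → ℝ) → (Fin m → ℝ)) (x z : Fin n → ℝ)
    (k : Fin n) : ((tangentMatrix f x)ᵀ *ᵥ z) (Sum.inl k) = z k := by
  simp [mulVec, dotProduct, tangentMatrix, graphTangent_inl]

theorem pderiv'_meanCurvature_eq {f : (Fin n → ℝ) → (Fin m → ℝ)}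
    (hpmc : HasParallelMeanCurvature f) (i : Fin n) (x : Fin n → ℝ) :
    (fun k => pderiv' i (fun y => meanCurvature f y k) x) =
      (tangentMatrix f x)ᵀ *ᵥ ((graphMetric f x)⁻¹ *ᵥ (tangentMatrix f x *ᵥ
        fun k => pderiv' i (fun y => meanCurvature f y k) x)) :=
  eq_tangential_of_normalProjection_eq_zero (funext fun k => hpmc x (Pi.single i 1) k)

theorem tangentMatrix_mulVec_pderiv'_meanCurvature {f : (Fin n → ℝ) → (Fin m → ℝ)}
    (hf : ContDiff ℝ (⊤ : ℕ∞) f) (i b : Fin n) (x : Fin n → ℝ) :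
    (tangentMatrix f x *ᵥ fun k => pderiv' i (fun y => meanCurvature f y k) x) b =
      -∑ l, pderiv' i (fun y => graphTangent f b y l) x * meanCurvature f x l := by
  have h0 : (fun y => ∑ l, graphTangent f b y l * meanCurvature f y l) = fun _ => (0 : ℝ) := by
    funext y
    exact congrFun (tangentMatrix_mulVec_meanCurvature f y) b
  have h1 := pderiv'_sum (Finset.univ) i (x := x)
    (Φ := fun l y => graphTangent f b y l * meanCurvature f y l)
    (fun l _ => (((contDiff_graphTangent hf b l).mul (contDiff_meanCurvature hf l))).diffAt_of_smooth
      x)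
  rw [h0, pderiv'_const] at h1
  simp only [mulVec, dotProduct, tangentMatrix, Matrix.of_apply]
  rw [eq_neg_iff_add_eq_zero, ← Finset.sum_add_distrib, h1]
  refine Finset.sum_congr rfl fun l _ => ?_
  rw [pderiv'_mul i ((contDiff_graphTangent hf b l).diffAt_of_smooth x)
    ((contDiff_meanCurvature hf l).diffAt_of_smooth x)]
  ring

theorem pderiv'_sum_sq_meanCurvature {f : (Fin n → ℝ) → (Fin m → ℝ)}
    (hf : ContDiff ℝ (⊤ : ℕ∞) f) (hpmc : HasParallelMeanCurvature f) (i : Fin n)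
    (x : Fin n → ℝ) :
    pderiv' i (fun y => ∑ k, meanCurvature f y k * meanCurvature f y k) x = 0 := by
  have hd := fun k => (contDiff_meanCurvature hf k).diffAt_of_smooth x
  rw [pderiv'_sum (Finset.univ) i (Φ := fun k y => meanCurvature f y k * meanCurvature f y k)
    fun k _ => (hd k).mul (hd k)]
  have h1 : meanCurvature f x ⬝ᵥ (fun k => pderiv' i (fun y => meanCurvature f y k) x) = 0 := by
    rw [pderiv'_meanCurvature_eq hpmc, dotProduct_mulVec, vecMul_transpose,
      tangentMatrix_mulVec_meanCurvature, zero_dotProduct]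
  rw [dotProduct] at h1
  rw [← mul_zero (2 : ℝ), ← h1, Finset.mul_sum]
  refine Finset.sum_congr rfl fun k _ => ?_
  rw [pderiv'_mul i (hd k) (hd k)]
  ring

theorem sum_pderiv'_meanCurvature_inl {f : (Fin n → ℝ) → (Fin m → ℝ)}
    (hf : ContDiff ℝ (⊤ : ℕ∞) f) (hpmc : HasParallelMeanCurvature f) (x : Fin n → ℝ) :
    ∑ i, pderiv' i (fun y => meanCurvature f y (Sum.inl i)) x =
      -∑ k, meanCurvature f x k * meanCurvature f x k := by
  have h1 : ∀ i, pderiv' i (fun y => meanCurvature f y (Sum.inl i)) x =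
      -∑ b, (graphMetric f x)⁻¹ i b *
        ∑ l, pderiv' i (fun y => graphTangent f b y l) x * meanCurvature f x l := by
    intro i
    refine (congrFun (pderiv'_meanCurvature_eq hpmc i x) (Sum.inl i)).trans ?_
    rw [transpose_tangentMatrix_mulVec_inl]
    simp only [mulVec, dotProduct] 
    rw [← Finset.sum_neg_distrib]
    refine Finset.sum_congr rfl fun b _ => ?_
    have := tangentMatrix_mulVec_pderiv'_meanCurvature hf i b x
    simp only [mulVec, dotProduct] at this
    rw [this]; ring
  have h2 : meanCurvature f x ⬝ᵥ graphMapTrace f x = meanCurvature f x ⬝ᵥ meanCurvature f x := by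
    have : normalProjection f x *ᵥ graphMapTrace f x = graphMapTrace f x -
        (tangentMatrix f x)ᵀ *ᵥ (((graphMetric f x)⁻¹ * tangentMatrix f x) *ᵥ
          graphMapTrace f x) := by
      rw [normalProjection_eq, sub_mulVec, one_mulVec, mulVec_mulVec, Matrix.mul_assoc]
    rw [← meanCurvature_eq] at this
    have h3 : graphMapTrace f x = meanCurvature f x + (tangentMatrix f x)ᵀ *ᵥ
        (((graphMetric f x)⁻¹ * tangentMatrix f x) *ᵥ graphMapTrace f x) := by
      rw [this, sub_add_cancel]
    rw [h3, dotProduct_add, dotProduct_mulVec, vecMul_transpose,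
      tangentMatrix_mulVec_meanCurvature, zero_dotProduct, add_zero]
  simp only [h1, Finset.sum_neg_distrib]
  congr 1
  rw [dotProduct, dotProduct] at h2
  rw [← h2]
  simp only [graphMapTrace, Finset.mul_sum]
  symm
  rw [Finset.sum_comm]
  refine Finset.sum_congr rfl fun i _ => ?_
  rw [Finset.sum_comm]
  exact Finset.sum_congr rfl fun j _ => Finset.sum_congr rfl fun l _ => by ring

theorem sum_inv_mul_second_pderiv'_eq_zero {f : (Fin n → ℝ) → (Fin m → ℝ)}
    {x : Fin n → ℝ} (h : meanCurvature f x = 0) (α : Fin m) :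
    ∑ i, ∑ j, (graphMetric f x)⁻¹ i j *
      pderiv' i (fun y => pderiv' j (fun z => f z α) y) x = 0 := by
  rw [meanCurvature_eq] at h
  have h1 := eq_tangential_of_normalProjection_eq_zero h
  have h2 : (graphMetric f x)⁻¹ *ᵥ (tangentMatrix f x *ᵥ graphMapTrace f x) = 0 := by
    ext k
    rw [← transpose_tangentMatrix_mulVec_inl f x
      ((graphMetric f x)⁻¹ *ᵥ (tangentMatrix f x *ᵥ graphMapTrace f x)), ← h1]
    simp [graphMapTrace, graphTangent_inl, pderiv'_const]
  rw [h2, mulVec_zero] at h1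
  exact congrFun h1 (Sum.inr α)

/-- A bounded smooth vector field with constant divergence is divergence free. -/
theorem divergence_eq_zero_of_bounded {X : Fin n → (Fin n → ℝ) → ℝ}
    (hX : ∀ i, ContDiff ℝ (⊤ : ℕ∞) (X i)) {K c : ℝ} (hK : ∀ i x, |X i x| ≤ K)
    (hc : ∀ x, ∑ i, pderiv' i (X i) x = -c) (hc0 : 0 ≤ c) : c = 0 := by
  let b : ContDiffBump (0 : Fin n → ℝ) := ⟨1, 2, one_pos, one_lt_two⟩
  have hb : ContDiff ℝ (⊤ : ℕ∞) b := b.contDiff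
  have hI : 0 < ∫ x, b x := b.integral_pos
  have hdb : ∀ i, Continuous (pderiv' i b) := fun i => (hb.pderiv' i).continuous
  have hdbc : ∀ i, HasCompactSupport (pderiv' i b) := fun i => by
    unfold pderiv'
    exact b.hasCompactSupport.fderiv_apply ℝ _
  set S : ℝ := ∫ x, ∑ i, |pderiv' i b x| with hS
  have key : ∀ R : ℝ, R * c * ∫ x, b x ≤ K * S := by
    intro R
    have hXR : ∀ i, ContDiff ℝ (⊤ : ℕ∞) fun y => X i (R • y) := fun i =>
      (hX i).comp (contDiff_const_smul R)
    have hdX : ∀ i y, pderiv' i (fun z => X i (R • z)) y = R * pderiv' i (X i) (R • y) := by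
      intro i y
      have := pderiv'_comp_affine (φ := X i) i (R • (1 : Matrix (Fin n) (Fin n) ℝ)) 0 y
        ((hX i).differentiable (by simp))
      simpa [Matrix.smul_mulVec, Matrix.one_apply] using this
    have h1 : ∀ i, ∫ x, pderiv' i (fun y => b y * X i (R • y)) x = 0 := fun i =>
      integral_pderiv'_eq_zero i ((hb.mul (hXR i)).of_le (by simp))
        (b.hasCompactSupport.mul_right)
    have hint1 : ∀ i, MeasureTheory.Integrable fun x => pderiv' i b x * X i (R • x) := fun i =>
      ((hdb i).mul (hXR i).continuous).integrable_of_hasCompactSupport (hdbc i).mul_right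
    have hint2 : ∀ i, MeasureTheory.Integrable fun x => b x * (R * pderiv' i (X i) (R • x)) :=
      fun i => (hb.continuous.mul (continuous_const.mul (((hX i).pderiv' i).continuous.comp
        (continuous_const_smul R)))).integrable_of_hasCompactSupport
          b.hasCompactSupport.mul_right
    have h2 : ∀ i, ∫ x, pderiv' i b x * X i (R • x) =
        -∫ x, b x * (R * pderiv' i (X i) (R • x)) := by
      intro i
      rw [eq_neg_iff_add_eq_zero, ← MeasureTheory.integral_add (hint1 i) (hint2 i), ← h1 i]
      refine MeasureTheory.integral_congr_ae (.of_forall fun x => ?_)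
      simp only
      rw [pderiv'_mul i (hb.diffAt_of_smooth x) ((hXR i).diffAt_of_smooth x), hdX]
    have h3 : ∫ x, ∑ i, pderiv' i b x * X i (R • x) = R * c * ∫ x, b x := by
      rw [MeasureTheory.integral_finsetSum _ fun i _ => hint1 i]
      simp only [h2]
      rw [Finset.sum_neg_distrib, ← MeasureTheory.integral_finsetSum _ fun i _ => hint2 i,
        ← MeasureTheory.integral_const_mul, ← MeasureTheory.integral_neg]
      refine MeasureTheory.integral_congr_ae (.of_forall fun x => ?_)
      simp only [← Finset.mul_sum, hc]
      ring
    rw [← h3, hS, ← MeasureTheory.integral_const_mul]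
    refine MeasureTheory.integral_mono (MeasureTheory.integrable_finsetSum _ fun i _ => hint1 i)
      ((MeasureTheory.integrable_finsetSum _ fun i _ =>
        ((hdb i).integrable_of_hasCompactSupport (hdbc i)).abs).const_mul K) fun x => ?_
    simp only [Finset.mul_sum]
    refine Finset.sum_le_sum fun i _ => (le_abs_self _).trans ?_
    rw [abs_mul, mul_comm]
    exact mul_le_mul_of_nonneg_right (hK i _) (abs_nonneg _)
  by_contra hne
  have hcpos : 0 < c := lt_of_le_of_ne hc0 (Ne.symm hne)
  have h4 := key ((K * S + 1) / (c * ∫ x, b x))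
  rw [mul_assoc, div_mul_cancel₀ _ (mul_pos hcpos hI).ne'] at h4
  linarith

theorem meanCurvature_eq_zero {f : (Fin n → ℝ) → (Fin m → ℝ)}
    (hf : ContDiff ℝ (⊤ : ℕ∞) f) (hpmc : HasParallelMeanCurvature f) (x : Fin n → ℝ) :
    meanCurvature f x = 0 := by
  set N : (Fin n → ℝ) → ℝ := fun y => ∑ k, meanCurvature f y k * meanCurvature f y k with hN
  have hNs : ContDiff ℝ (⊤ : ℕ∞) N :=
    ContDiff.sum fun k _ => (contDiff_meanCurvature hf k).mul (contDiff_meanCurvature hf k)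
  have hN0 : ∀ y, 0 ≤ N y := fun y => Finset.sum_nonneg fun k _ => mul_self_nonneg _
  have hconst : ∀ y, N y = N x := by
    refine fun y => is_const_of_fderiv_eq_zero (𝕜 := ℝ) (fun z => hNs.diffAt_of_smooth z) ?_ y x
    intro z; ext v
    rw [fderiv_eq_sum_pderiv']
    simp only [hN, pderiv'_sum_sq_meanCurvature hf hpmc]
    simp
  have h1 : N x = 0 := by
    refine divergence_eq_zero_of_bounded (X := fun i y => meanCurvature f y (Sum.inl i))
      (K := √(N x)) (fun i => contDiff_meanCurvature hf _) (fun i y => ?_) (fun y => ?_) (hN0 x)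
    · rw [← hconst y]
      apply Real.abs_le_sqrt
      rw [sq]
      exact Finset.single_le_sum (f := fun k => meanCurvature f y k * meanCurvature f y k)
        (fun k _ => mul_self_nonneg _) (Finset.mem_univ _)
    · rw [sum_pderiv'_meanCurvature_inl hf hpmc, ← hconst y]
  ext k
  exact mul_self_eq_zero.1 ((Finset.sum_eq_zero_iff_of_nonneg fun k _ => mul_self_nonneg _).1 h1 k
    (Finset.mem_univ k))

end Minimality

section Bochner

variable {n m : ℕ}

theorem second_pderiv'_det_pow_five {M : (Fin n → ℝ) → Matrix (Fin n) (Fin n) ℝ}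
    (hM : ∀ i j, ContDiff ℝ (⊤ : ℕ∞) fun x => M x i j) (hdet : ∀ x, (M x).det ≠ 0)
    (k : Fin n) {y₀ : Fin n → ℝ} (h1 : M y₀ = 1) :
    pderiv' k (pderiv' k fun y => (M y).det ^ 5) y₀ =
      25 * (∑ i, pderiv' k (fun y => M y i i) y₀) ^ 2 +
      5 * (∑ i, pderiv' k (pderiv' k fun y => M y i i) y₀ -
        ∑ i, ∑ j, pderiv' k (fun y => M y j i) y₀ * pderiv' k (fun y => M y i j) y₀) := by
  have hW := ContDiff.matrix_inv hM hdet
  have hD : ContDiff ℝ (⊤ : ℕ∞) fun x => (M x).det := ContDiff.matrix_det hM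
  have hdM : ∀ i j, ContDiff ℝ (⊤ : ℕ∞) (pderiv' k fun y => M y i j) := fun i j =>
    (hM i j).pderiv' k
  have hWdM : ∀ i j, ContDiff ℝ (⊤ : ℕ∞) fun y => (M y)⁻¹ j i * pderiv' k (fun z => M z i j) y :=
    fun i j => (hW j i).mul (hdM i j)
  set s : (Fin n → ℝ) → ℝ := fun y => ∑ i, ∑ j, (M y)⁻¹ j i * pderiv' k (fun z => M z i j) y
    with hs
  have hss : ContDiff ℝ (⊤ : ℕ∞) s := ContDiff.sum fun i _ => ContDiff.sum fun j _ => hWdM i j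
  have hD5 : ContDiff ℝ (⊤ : ℕ∞) fun x => (M x).det ^ 5 := hD.pow 5
  have hdD5 : pderiv' k (fun y => (M y).det ^ 5) = fun y => 5 * ((M y).det ^ 5 * s y) := by
    funext y
    rw [pderiv'_pow k 5 (hD.diffAt_of_smooth y), pderiv'_det hM hdet]
    push_cast
    ring
  have hs0 : s y₀ = ∑ i, pderiv' k (fun y => M y i i) y₀ := by
    simp only [hs, h1, inv_one, Matrix.one_apply]
    simp
  have hdW : ∀ i j, pderiv' k (fun y => (M y)⁻¹ i j) y₀ = -pderiv' k (fun y => M y i j) y₀ := by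
    intro i j
    have := congrFun (congrFun (pderiv'_inv hM hdet k y₀) i) j
    simpa [h1] using this
  have hds : pderiv' k s y₀ = ∑ i, pderiv' k (pderiv' k fun y => M y i i) y₀ -
      ∑ i, ∑ j, pderiv' k (fun y => M y j i) y₀ * pderiv' k (fun y => M y i j) y₀ := by
    rw [hs, pderiv'_sum Finset.univ k (Φ := fun i y => ∑ j, (M y)⁻¹ j i *
      pderiv' k (fun z => M z i j) y) fun i _ =>
        (ContDiff.sum fun j _ => hWdM i j).diffAt_of_smooth y₀, ← Finset.sum_sub_distrib]
    refine Finset.sum_congr rfl fun i _ => ?_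
    rw [pderiv'_sum Finset.univ k (Φ := fun j y => (M y)⁻¹ j i *
      pderiv' k (fun z => M z i j) y) fun j _ => (hWdM i j).diffAt_of_smooth y₀]
    have : ∀ j, pderiv' k (fun y => (M y)⁻¹ j i * pderiv' k (fun z => M z i j) y) y₀ =
        (if j = i then pderiv' k (pderiv' k fun y => M y i j) y₀ else 0) -
        pderiv' k (fun y => M y j i) y₀ * pderiv' k (fun y => M y i j) y₀ := by
      intro j
      rw [pderiv'_mul k ((hW j i).diffAt_of_smooth y₀) ((hdM i j).diffAt_of_smooth y₀), hdW, h1,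
        inv_one, Matrix.one_apply]
      split_ifs <;> ring
    simp only [this, Finset.sum_sub_distrib]
    simp
  rw [hdD5, pderiv'_const_mul k 5 ((hD5.mul hss).diffAt_of_smooth y₀),
    pderiv'_mul k (hD5.diffAt_of_smooth y₀) (hss.diffAt_of_smooth y₀), hdD5]
  simp only [hds, hs0, h1, Matrix.det_one]
  ring

/-- The pulled back metric of a graph in affine coordinates, with constant part `C`. -/
def affineMetric (C : Matrix (Fin n) (Fin n) ℝ) (φ : Fin m → (Fin n → ℝ) → ℝ) (y : Fin n → ℝ) :
    Matrix (Fin n) (Fin n) ℝ :=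
  Matrix.of fun i j => C i j + ∑ α, pderiv' i (φ α) y * pderiv' j (φ α) y

section

variable {C : Matrix (Fin n) (Fin n) ℝ} {φ : Fin m → (Fin n → ℝ) → ℝ}

theorem contDiff_affineMetric (hφ : ∀ α, ContDiff ℝ (⊤ : ℕ∞) (φ α)) (i j : Fin n) :
    ContDiff ℝ (⊤ : ℕ∞) fun y => affineMetric C φ y i j :=
  contDiff_const.add (ContDiff.sum fun α _ => ((hφ α).pderiv' i).mul ((hφ α).pderiv' j))

theorem pderiv'_affineMetric (hφ : ∀ α, ContDiff ℝ (⊤ : ℕ∞) (φ α)) (k i j : Fin n)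
    (y : Fin n → ℝ) :
    pderiv' k (fun y => affineMetric C φ y i j) y =
      ∑ α, pderiv' k (pderiv' i (φ α)) y * pderiv' j (φ α) y +
      ∑ α, pderiv' k (pderiv' j (φ α)) y * pderiv' i (φ α) y := by
  have hm : ∀ α, ContDiff ℝ (⊤ : ℕ∞) fun y => pderiv' i (φ α) y * pderiv' j (φ α) y := fun α =>
    ((hφ α).pderiv' i).mul ((hφ α).pderiv' j)
  have : (fun y => affineMetric C φ y i j) =
      fun y => C i j + ∑ α, pderiv' i (φ α) y * pderiv' j (φ α) y := rfl
  rw [this, pderiv'_add k (differentiableAt_const _)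
    ((ContDiff.sum fun α _ => hm α).diffAt_of_smooth y), pderiv'_const, zero_add,
    pderiv'_sum Finset.univ k (Φ := fun α y => pderiv' i (φ α) y * pderiv' j (φ α) y)
      fun α _ => (hm α).diffAt_of_smooth y, ← Finset.sum_add_distrib]
  refine Finset.sum_congr rfl fun α _ => ?_
  rw [pderiv'_mul k (((hφ α).pderiv' i).diffAt_of_smooth y)
    (((hφ α).pderiv' j).diffAt_of_smooth y)]
  ring

theorem second_pderiv'_affineMetric (hφ : ∀ α, ContDiff ℝ (⊤ : ℕ∞) (φ α)) (k i : Fin n)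
    (y : Fin n → ℝ) :
    pderiv' k (pderiv' k fun y => affineMetric C φ y i i) y =
      2 * (∑ α, pderiv' i (pderiv' k (pderiv' k (φ α))) y * pderiv' i (φ α) y +
      ∑ α, pderiv' k (pderiv' i (φ α)) y ^ 2) := by
  have h2 : ∀ α, ContDiff ℝ (⊤ : ℕ∞) (pderiv' k (pderiv' i (φ α))) := fun α =>
    ((hφ α).pderiv' i).pderiv' k
  have hm : ∀ α, ContDiff ℝ (⊤ : ℕ∞) fun y =>
      pderiv' k (pderiv' i (φ α)) y * pderiv' i (φ α) y := fun α => (h2 α).mul ((hφ α).pderiv' i)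
  have : pderiv' k (fun y => affineMetric C φ y i i) = fun y =>
      2 * ∑ α, pderiv' k (pderiv' i (φ α)) y * pderiv' i (φ α) y := by
    funext y; rw [pderiv'_affineMetric hφ]; ring
  rw [this, pderiv'_const_mul k 2 ((ContDiff.sum fun α _ => hm α).diffAt_of_smooth y),
    pderiv'_sum Finset.univ k (Φ := fun α y => pderiv' k (pderiv' i (φ α)) y * pderiv' i (φ α) y)
      fun α _ => (hm α).diffAt_of_smooth y, ← Finset.sum_add_distrib]
  congr 1
  refine Finset.sum_congr rfl fun α _ => ?_
  rw [pderiv'_mul k ((h2 α).diffAt_of_smooth y) (((hφ α).pderiv' i).diffAt_of_smooth y)]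
  have : pderiv' k (pderiv' k (pderiv' i (φ α))) y = pderiv' i (pderiv' k (pderiv' k (φ α))) y := by
    rw [show pderiv' k (pderiv' i (φ α)) = pderiv' i (pderiv' k (φ α)) from
      funext fun z => pderiv'_comm k i (hφ α) z, pderiv'_comm k i ((hφ α).pderiv' k)]
  rw [this]; ring

theorem sum_third_pderiv'_eq (hφ : ∀ α, ContDiff ℝ (⊤ : ℕ∞) (φ α))
    (hdet : ∀ y, (affineMetric C φ y).det ≠ 0)
    (hpde : ∀ α y, ∑ k, ∑ l, (affineMetric C φ y)⁻¹ k l * pderiv' k (pderiv' l (φ α)) y = 0)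
    {y₀ : Fin n → ℝ} (h1 : affineMetric C φ y₀ = 1) (i : Fin n) (α : Fin m) :
    ∑ k, pderiv' i (pderiv' k (pderiv' k (φ α))) y₀ =
      ∑ k, ∑ l, pderiv' i (fun y => affineMetric C φ y k l) y₀ *
        pderiv' k (pderiv' l (φ α)) y₀ := by
  have hM := contDiff_affineMetric (C := C) hφ
  have hW := ContDiff.matrix_inv hM hdet
  have h2 : ∀ k l, ContDiff ℝ (⊤ : ℕ∞) (pderiv' k (pderiv' l (φ α))) := fun k l =>
    ((hφ α).pderiv' l).pderiv' k
  have hm : ∀ k l, ContDiff ℝ (⊤ : ℕ∞) fun y =>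
      (affineMetric C φ y)⁻¹ k l * pderiv' k (pderiv' l (φ α)) y := fun k l =>
    (hW k l).mul (h2 k l)
  have hdW : ∀ k l, pderiv' i (fun y => (affineMetric C φ y)⁻¹ k l) y₀ =
      -pderiv' i (fun y => affineMetric C φ y k l) y₀ := by
    intro k l
    have := congrFun (congrFun (pderiv'_inv hM hdet i y₀) k) l
    simpa [h1] using this
  have h3 : pderiv' i (fun y => ∑ k, ∑ l, (affineMetric C φ y)⁻¹ k l *
      pderiv' k (pderiv' l (φ α)) y) y₀ = 0 := by
    rw [show (fun y => ∑ k, ∑ l, (affineMetric C φ y)⁻¹ k l * pderiv' k (pderiv' l (φ α)) y) =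
      fun _ => (0 : ℝ) from funext fun y => hpde α y, pderiv'_const]
  rw [pderiv'_sum Finset.univ i (Φ := fun k y => ∑ l, (affineMetric C φ y)⁻¹ k l *
    pderiv' k (pderiv' l (φ α)) y) fun k _ =>
      (ContDiff.sum fun l _ => hm k l).diffAt_of_smooth y₀] at h3
  rw [← sub_eq_zero, ← h3, ← Finset.sum_sub_distrib]
  refine Finset.sum_congr rfl fun k _ => ?_
  rw [pderiv'_sum Finset.univ i (Φ := fun l y => (affineMetric C φ y)⁻¹ k l *
    pderiv' k (pderiv' l (φ α)) y) fun l _ => (hm k l).diffAt_of_smooth y₀]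
  have : ∀ l, pderiv' i (fun y => (affineMetric C φ y)⁻¹ k l * pderiv' k (pderiv' l (φ α)) y) y₀ =
      (if k = l then pderiv' i (pderiv' k (pderiv' l (φ α))) y₀ else 0) -
      pderiv' i (fun y => affineMetric C φ y k l) y₀ * pderiv' k (pderiv' l (φ α)) y₀ := by
    intro l
    rw [pderiv'_mul i ((hW k l).diffAt_of_smooth y₀) ((h2 k l).diffAt_of_smooth y₀), hdW, h1,
      inv_one, Matrix.one_apply]
    split_ifs <;> ring
  simp only [this, Finset.sum_sub_distrib]
  simp

theorem sum_second_pderiv'_det_pow_five (hφ : ∀ α, ContDiff ℝ (⊤ : ℕ∞) (φ α))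
    (hdet : ∀ y, (affineMetric C φ y).det ≠ 0)
    (hpde : ∀ α y, ∑ k, ∑ l, (affineMetric C φ y)⁻¹ k l * pderiv' k (pderiv' l (φ α)) y = 0)
    {y₀ : Fin n → ℝ} (h1 : affineMetric C φ y₀ = 1)
    (F : Fin n → Fin m → ℝ) (hF : ∀ i α, F i α = pderiv' i (φ α) y₀)
    (B : Fin n → Fin n → Fin m → ℝ) (hB : ∀ i k α, B i k α = pderiv' i (pderiv' k (φ α)) y₀) :
    ∑ k, pderiv' k (pderiv' k fun y => (affineMetric C φ y).det ^ 5) y₀ =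
      10 * (∑ i, ∑ k, ∑ α, B i k α ^ 2
      + ∑ i, ∑ j, ∑ k, ((∑ α, B i k α * F j α) * (∑ α, B j k α * F i α)
          - (∑ α, B i k α * F j α) ^ 2)
      + 10 * ∑ k, (∑ i, ∑ α, B i k α * F i α) ^ 2) := by
  have hBs : ∀ i k α, B i k α = B k i α := fun i k α => by
    rw [hB, hB, pderiv'_comm i k (hφ α)]
  obtain ⟨p, hp⟩ : ∃ p : Fin n → Fin n → Fin n → ℝ, ∀ i k j, p i k j = ∑ α, B i k α * F j α :=
    ⟨_, fun _ _ _ => rfl⟩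
  have hps : ∀ i k j, p i k j = p k i j := fun i k j => by simp only [hp, hBs i k]
  have hd1 : ∀ k i j, pderiv' k (fun y => affineMetric C φ y i j) y₀ = p i k j + p j k i := by
    intro k i j
    rw [pderiv'_affineMetric hφ, hps i k, hps j k]
    simp only [hp, hB, hF]
  have hthird : ∑ k, ∑ i, ∑ α, pderiv' i (pderiv' k (pderiv' k (φ α))) y₀ * F i α =
      2 * ∑ i, ∑ j, ∑ k, p i k j * p j k i := by
    have e1 : ∀ i, ∑ k, ∑ α, pderiv' i (pderiv' k (pderiv' k (φ α))) y₀ * F i α =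
        ∑ k, ∑ l, (p k i l + p l i k) * p k l i := by
      intro i
      rw [Finset.sum_comm]
      have : ∀ α, ∑ k, pderiv' i (pderiv' k (pderiv' k (φ α))) y₀ * F i α =
          ∑ k, ∑ l, (p k i l + p l i k) * (B k l α * F i α) := by
        intro α
        rw [← Finset.sum_mul, sum_third_pderiv'_eq hφ hdet hpde h1, Finset.sum_mul]
        refine Finset.sum_congr rfl fun k _ => ?_
        rw [Finset.sum_mul]
        refine Finset.sum_congr rfl fun l _ => ?_
        rw [hd1, hB]; ring
      simp only [this]
      rw [Finset.sum_comm]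
      refine Finset.sum_congr rfl fun k _ => ?_
      rw [Finset.sum_comm]
      refine Finset.sum_congr rfl fun l _ => ?_
      rw [← Finset.mul_sum, ← hp]
    rw [Finset.sum_comm]
    simp only [e1]
    have e2 : ∀ i, ∑ k, ∑ l, (p k i l + p l i k) * p k l i =
        2 * ∑ k, ∑ l, p i k l * p l k i := by
      intro i
      simp only [add_mul, Finset.sum_add_distrib]
      have e3 : ∑ k, ∑ l, p l i k * p k l i = ∑ k, ∑ l, p k i l * p k l i := by
        rw [Finset.sum_comm]
        exact Finset.sum_congr rfl fun k _ => Finset.sum_congr rfl fun l _ => by rw [hps l k]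
      rw [e3, ← two_mul]
      congr 1
      exact Finset.sum_congr rfl fun k _ => Finset.sum_congr rfl fun l _ => by
        rw [hps k i, hps k l]
    simp only [e2]
    rw [← Finset.mul_sum]
    congr 1
    exact Finset.sum_congr rfl fun i _ => Finset.sum_comm
  have hk : ∀ k, pderiv' k (pderiv' k fun y => (affineMetric C φ y).det ^ 5) y₀ =
      100 * (∑ i, p i k i) ^ 2 +
      5 * (2 * (∑ i, ∑ α, pderiv' i (pderiv' k (pderiv' k (φ α))) y₀ * F i α) +
        2 * ∑ i, ∑ α, B i k α ^ 2
        - 2 * ∑ i, ∑ j, p i k j * p j k i - ∑ i, ∑ j, p i k j ^ 2 - ∑ i, ∑ j, p j k i ^ 2) := by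
    intro k
    rw [second_pderiv'_det_pow_five (contDiff_affineMetric hφ) hdet k h1]
    simp only [hd1, second_pderiv'_affineMetric hφ]
    have e1 : ∑ i, (p i k i + p i k i) = 2 * ∑ i, p i k i := by
      rw [Finset.mul_sum]; exact Finset.sum_congr rfl fun i _ => by ring
    have e2 : ∑ i, ∑ j, (p j k i + p i k j) * (p i k j + p j k i) =
        2 * ∑ i, ∑ j, p i k j * p j k i + ∑ i, ∑ j, p i k j ^ 2 + ∑ i, ∑ j, p j k i ^ 2 := by
      simp only [Finset.mul_sum, ← Finset.sum_add_distrib]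
      exact Finset.sum_congr rfl fun i _ => Finset.sum_congr rfl fun j _ => by ring
    have e3 : ∑ i, 2 * (∑ α, pderiv' i (pderiv' k (pderiv' k (φ α))) y₀ * pderiv' i (φ α) y₀ +
        ∑ α, pderiv' k (pderiv' i (φ α)) y₀ ^ 2) =
        2 * (∑ i, ∑ α, pderiv' i (pderiv' k (pderiv' k (φ α))) y₀ * F i α) +
        2 * ∑ i, ∑ α, B i k α ^ 2 := by
      rw [← Finset.mul_sum, Finset.sum_add_distrib, mul_add]
      simp only [hF, hBs _ k, hB]
    rw [e1, e2, e3]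
    ring
  have hswap : ∑ k, ∑ i, ∑ j, p j k i ^ 2 = ∑ k, ∑ i, ∑ j, p i k j ^ 2 :=
    Finset.sum_congr rfl fun k _ => Finset.sum_comm
  have hrot : ∀ q : Fin n → Fin n → Fin n → ℝ,
      ∑ k, ∑ i, ∑ j, q i j k = ∑ i, ∑ j, ∑ k, q i j k := by
    intro q
    rw [Finset.sum_comm]
    exact Finset.sum_congr rfl fun i _ => Finset.sum_comm
  simp only [hk, ← hp]
  simp only [Finset.sum_add_distrib, Finset.sum_sub_distrib, ← Finset.mul_sum, hthird, hswap]
  rw [hrot fun i j k => p i k j * p j k i, hrot fun i j k => p i k j ^ 2,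
    Finset.sum_comm (f := fun k i => ∑ α, B i k α ^ 2)]
  ring

end

end Bochner

section BochnerGraph

open Matrix

variable {n m : ℕ}

theorem second_pderiv'_comp_affine {ψ : (Fin n → ℝ) → ℝ} (hψ : ContDiff ℝ (⊤ : ℕ∞) ψ)
    (a b : Fin n) (E : Matrix (Fin n) (Fin n) ℝ) (x₀ y : Fin n → ℝ) :
    pderiv' a (pderiv' b fun z => ψ (x₀ + E.mulVec z)) y =
      (Eᵀ * Matrix.of (fun i j => pderiv' i (pderiv' j ψ) (x₀ + E.mulVec y)) * E) a b := by
  have hd : Differentiable ℝ ψ := hψ.differentiable (by simp)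
  have h1 : pderiv' b (fun z => ψ (x₀ + E.mulVec z)) =
      fun z => ∑ j, E j b * pderiv' j ψ (x₀ + E.mulVec z) :=
    funext fun z => pderiv'_comp_affine b E x₀ z hd
  have hs : ∀ j, ContDiff ℝ (⊤ : ℕ∞) fun z => pderiv' j ψ (x₀ + E.mulVec z) := fun j =>
    (hψ.pderiv' j).comp (contDiff_const.add
      (LinearMap.toContinuousLinearMap (Matrix.mulVecLin E)).contDiff)
  rw [h1, pderiv'_sum Finset.univ a (Φ := fun j z => E j b * pderiv' j ψ (x₀ + E.mulVec z))
    fun j _ => (contDiff_const.mul (hs j)).diffAt_of_smooth y, Matrix.mul_apply]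
  refine Finset.sum_congr rfl fun j _ => ?_
  rw [pderiv'_const_mul a _ ((hs j).diffAt_of_smooth y),
    pderiv'_comp_affine a E x₀ y ((hψ.pderiv' j).differentiable (by simp)), Matrix.mul_apply,
    mul_comm]
  rfl

theorem sum_mul_eq_trace (A B : Matrix (Fin n) (Fin n) ℝ) :
    ∑ i, ∑ j, A i j * B i j = (A * Bᵀ).trace := by
  simp [Matrix.trace, Matrix.mul_apply]

/-- The metric trace of the Hessian of `ψ`. -/
def metricTraceHessian (f : (Fin n → ℝ) → (Fin m → ℝ)) (ψ : (Fin n → ℝ) → ℝ) (x : Fin n → ℝ) : ℝ :=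
  ∑ i, ∑ j, (graphMetric f x)⁻¹ i j * pderiv' i (pderiv' j ψ) x

/-- The minimal surface system for the graph of `f`. -/
def SolvesMinimalSystem (f : (Fin n → ℝ) → (Fin m → ℝ)) : Prop :=
  ∀ α x, metricTraceHessian f (fun y => f y α) x = 0

theorem exists_one_add_pow_mul_le {b : ℝ} (hb : b < 9) (n : ℕ) :
    ∃ ε : ℝ, 0 < ε ∧ (1 + ε) ^ n * b ≤ 9 := by
  have hc : ContinuousAt (fun ε : ℝ => (1 + ε) ^ n * b) 0 := by fun_prop
  have h1 : ∀ᶠ ε in nhds (0 : ℝ), (1 + ε) ^ n * b < 9 := by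
    refine hc.eventually_lt continuousAt_const ?_
    simpa using hb
  obtain ⟨ε, h2, h3⟩ := ((h1.filter_mono nhdsWithin_le_nhds).and
    (self_mem_nhdsWithin (s := Set.Ioi (0 : ℝ)))).exists
  exact ⟨ε, h3, h2.le⟩

theorem bochner_det_pow_five {f : (Fin n → ℝ) → (Fin m → ℝ)} (hf : ContDiff ℝ (⊤ : ℕ∞) f)
    (hmin : SolvesMinimalSystem f) {b : ℝ} (hb : b < 9) (hD : ∀ x, (graphMetric f x).det ≤ b) :
    ∃ κ : ℝ, 0 < κ ∧ ∀ x, κ * ∑ i, ∑ j, ∑ α, pderiv' i (pderiv' j fun y => f y α) x ^ 2 ≤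
      metricTraceHessian f (fun y => (graphMetric f y).det ^ 5) x := by
  obtain ⟨ε, hε, hεb⟩ := exists_one_add_pow_mul_le hb n
  refine ⟨10 * (ε / (9 * (1 + ε)) / 81), by positivity, fun x => ?_⟩
  obtain ⟨μ, E, hμ, hμprod, horth, hEE, hEdet, hgram, hcmp⟩ :=
    exists_adapted_frame (fun i α => pderiv' i (fun y => f y α) x)
      ((hD x).trans hb.le)
  rw [← graphMetric_eq_onePlusGram] at hμprod horth hEE hEdet
  set φ : Fin m → (Fin n → ℝ) → ℝ := fun α z => f (x + E.mulVec z) α with hφdef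
  have haff : ContDiff ℝ (⊤ : ℕ∞) fun z : Fin n → ℝ => x + E.mulVec z :=
    contDiff_const.add (LinearMap.toContinuousLinearMap (Matrix.mulVecLin E)).contDiff
  have hφ : ∀ α, ContDiff ℝ (⊤ : ℕ∞) (φ α) := fun α => (contDiff_component hf α).comp haff
  have hpd : ∀ a α z, pderiv' a (φ α) z =
      ∑ i, E i a * pderiv' i (fun y => f y α) (x + E.mulVec z) := fun a α z =>
    pderiv'_comp_affine a E x z ((contDiff_component hf α).differentiable (by simp))
  have hG : ∀ z, affineMetric (Eᵀ * E) φ z = Eᵀ * graphMetric f (x + E.mulVec z) * E := by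
    intro z
    rw [graphMetric_eq_onePlusGram, onePlusGram_eq, Matrix.mul_add, Matrix.add_mul,
      Matrix.mul_one]
    ext a c
    simp only [affineMetric, Matrix.of_apply, Matrix.add_apply]
    congr 1
    have : ∀ X : Matrix (Fin n) (Fin m) ℝ, Eᵀ * (X * Xᵀ) * E = (Eᵀ * X) * (Eᵀ * X)ᵀ := by
      intro X; rw [transpose_mul Eᵀ, transpose_transpose]; simp only [Matrix.mul_assoc]
    rw [this, Matrix.mul_apply]
    simp only [hpd, Matrix.mul_apply, Matrix.transpose_apply, Matrix.of_apply]
  have hEne : E.det ≠ 0 := by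
    intro h0; rw [h0] at hEdet; norm_num at hEdet
  have hEu : IsUnit E.det := isUnit_iff_ne_zero.2 hEne
  have hETu : IsUnit Eᵀ.det := by rwa [det_transpose]
  have hGdet : ∀ z, (affineMetric (Eᵀ * E) φ z).det =
      E.det ^ 2 * (graphMetric f (x + E.mulVec z)).det := by
    intro z; rw [hG, det_mul, det_mul, det_transpose]; ring
  have hGne : ∀ z, (affineMetric (Eᵀ * E) φ z).det ≠ 0 := fun z => by
    rw [hGdet]
    exact mul_ne_zero (pow_ne_zero 2 hEne) (isUnit_det_graphMetric f _).ne_zero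
  have hpde : ∀ α z, ∑ k, ∑ l, (affineMetric (Eᵀ * E) φ z)⁻¹ k l *
      pderiv' k (pderiv' l (φ α)) z = 0 := by
    intro α z
    simp only [hφdef, second_pderiv'_comp_affine (contDiff_component hf α)]
    rw [sum_mul_eq_trace, hG, Matrix.mul_inv_rev, Matrix.mul_inv_rev, transpose_mul,
      transpose_mul, transpose_transpose]
    rw [show ∀ A B : Matrix (Fin n) (Fin n) ℝ, E⁻¹ * (A * Eᵀ⁻¹) * (Eᵀ * (B * E)) =
      E⁻¹ * (A * (Eᵀ⁻¹ * Eᵀ) * B * E) from fun A B => by simp only [Matrix.mul_assoc],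
      Matrix.nonsing_inv_mul _ hETu, Matrix.mul_one, trace_mul_comm, Matrix.mul_assoc _ E,
      Matrix.mul_nonsing_inv _ hEu, Matrix.mul_one, ← sum_mul_eq_trace]
    exact hmin α _
  have h10 : affineMetric (Eᵀ * E) φ 0 = 1 := by
    rw [hG, mulVec_zero, add_zero, horth]
  have hF : ∀ i j, ∑ α, pderiv' i (φ α) 0 * pderiv' j (φ α) 0 =
      if i = j then μ i / (1 + μ i) else 0 := by
    intro i j
    rw [← hgram]
    simp only [hpd, mulVec_zero, add_zero]
  have hmain := sum_second_pderiv'_det_pow_five hφ hGne hpde h10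
    (fun i α => pderiv' i (φ α) 0) (fun _ _ => rfl)
    (fun i k α => pderiv' i (pderiv' k (φ α)) 0) (fun _ _ _ => rfl)
  have hineq := frame_bochner_inequality hε.le μ hμ (by
    rw [hμprod]
    exact (mul_le_mul_of_nonneg_left (hD x) (by positivity)).trans hεb)
    (fun i α => pderiv' i (φ α) 0) hF (fun i k α => pderiv' i (pderiv' k (φ α)) 0)
    (fun i k => funext fun α => pderiv'_comm i k (hφ α) 0)
  have hDs : ContDiff ℝ (⊤ : ℕ∞) fun y => (graphMetric f y).det :=
    ContDiff.matrix_det (contDiff_graphMetric hf)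
  have hL : ∑ k, pderiv' k (pderiv' k fun z => (affineMetric (Eᵀ * E) φ z).det ^ 5) 0 =
      (E.det ^ 2) ^ 5 * metricTraceHessian f (fun y => (graphMetric f y).det ^ 5) x := by
    have hD5 : ContDiff ℝ (⊤ : ℕ∞) fun y => (E.det ^ 2) ^ 5 * (graphMetric f y).det ^ 5 :=
      contDiff_const.mul (hDs.pow 5)
    have e1 : (fun z => (affineMetric (Eᵀ * E) φ z).det ^ 5) = fun z =>
        (fun y => (E.det ^ 2) ^ 5 * (graphMetric f y).det ^ 5) (x + E.mulVec z) := by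
      funext z; simp only [hGdet, mul_pow]
    rw [e1]
    simp only [second_pderiv'_comp_affine hD5, mulVec_zero, add_zero]
    rw [show ∀ A : Matrix (Fin n) (Fin n) ℝ, ∑ k, (Eᵀ * A * E) k k = (Eᵀ * A * E).trace from
      fun A => rfl, trace_mul_comm, ← Matrix.mul_assoc, hEE, metricTraceHessian, Finset.mul_sum]
    simp only [Matrix.trace, Matrix.mul_apply, Matrix.of_apply, diag_apply]
    refine Finset.sum_congr rfl fun i _ => ?_
    rw [Finset.mul_sum]
    refine Finset.sum_congr rfl fun j _ => ?_
    have e2 : pderiv' i (fun y => (E.det ^ 2) ^ 5 * (graphMetric f y).det ^ 5) =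
        fun y => (E.det ^ 2) ^ 5 * pderiv' i (fun y => (graphMetric f y).det ^ 5) y :=
      funext fun y => pderiv'_const_mul i _ ((hDs.pow 5).diffAt_of_smooth y)
    rw [e2, pderiv'_const_mul j _ (((hDs.pow 5).pderiv' i).diffAt_of_smooth x),
      pderiv'_comm j i (hDs.pow 5)]
    ring
  have hE1 : (E.det ^ 2) ^ 5 ≤ 1 := by
    refine pow_le_one₀ (sq_nonneg _) ?_
    rw [← hEdet]
    exact le_mul_of_one_le_right (sq_nonneg _) (one_le_det_graphMetric f x)
  have hE0 : 0 < (E.det ^ 2) ^ 5 := by positivity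
  have hsum : ∑ i, ∑ j, ∑ α, pderiv' i (pderiv' j fun y => f y α) x ^ 2 ≤
      81 * ∑ i, ∑ k, ∑ α, pderiv' i (pderiv' k (φ α)) 0 ^ 2 := by
    have e1 : ∀ Y : Fin n → Fin n → Fin m → ℝ,
        ∑ i, ∑ j, ∑ α, Y i j α = ∑ α, ∑ i, ∑ j, Y i j α := by
      intro Y
      rw [Finset.sum_comm]
      rw [Finset.sum_comm (s := (Finset.univ : Finset (Fin m)))]
      rw [Finset.sum_comm]
      exact Finset.sum_congr rfl fun i _ => Finset.sum_comm
    rw [e1, e1, Finset.mul_sum]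
    refine Finset.sum_le_sum fun α _ => ?_
    have := hcmp (Matrix.of fun i j => pderiv' i (pderiv' j fun y => f y α) x)
    simpa only [hφdef, second_pderiv'_comp_affine (contDiff_component hf α), mulVec_zero,
      add_zero, Matrix.of_apply] using this
  set S := ∑ i, ∑ k, ∑ α, pderiv' i (pderiv' k (φ α)) 0 ^ 2 with hS
  have hS0 : 0 ≤ S := Finset.sum_nonneg fun _ _ => Finset.sum_nonneg fun _ _ =>
    Finset.sum_nonneg fun _ _ => sq_nonneg _
  have hc : 0 < ε / (9 * (1 + ε)) := by positivity
  rw [hL] at hmain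
  set L := metricTraceHessian f (fun y => (graphMetric f y).det ^ 5) x
  have h11 : 10 * (ε / (9 * (1 + ε)) * S) ≤ (E.det ^ 2) ^ 5 * L := by
    rw [hmain]; linarith
  have hL0 : 0 ≤ L := by
    by_contra hneg
    push Not at hneg
    have := mul_neg_of_pos_of_neg hE0 hneg
    linarith [mul_nonneg hc.le hS0]
  have h12 : (E.det ^ 2) ^ 5 * L ≤ L := mul_le_of_le_one_left hL0 hE1
  have h13 := mul_le_mul_of_nonneg_left hsum hc.le
  linarith

end BochnerGraph

section DivergenceForm

open Matrix

variable {n m : ℕ} {f : (Fin n → ℝ) → (Fin m → ℝ)}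

theorem hasDerivAt_max_zero_pow (k : ℕ) (s : ℝ) :
    HasDerivAt (fun t : ℝ => max t 0 ^ (k + 2)) ((k + 2) * max s 0 ^ (k + 1)) s := by
  rcases lt_trichotomy s 0 with hs | hs | hs
  · rw [max_eq_right hs.le, zero_pow (Nat.succ_ne_zero _), mul_zero]
    refine (hasDerivAt_const s (0 : ℝ)).congr_of_eventuallyEq ?_
    filter_upwards [Iio_mem_nhds hs] with t ht
    rw [max_eq_right (le_of_lt ht), zero_pow (Nat.succ_ne_zero _)]
  · subst hs
    rw [max_self, zero_pow (Nat.succ_ne_zero _), mul_zero, hasDerivAt_iff_isLittleO_nhds_zero]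
    simp only [zero_add, max_self, smul_zero, sub_zero, zero_pow (Nat.succ_ne_zero _)]
    have h1 : (fun t : ℝ => max t 0 ^ (k + 2)) =O[nhds 0] fun t : ℝ => t ^ (k + 2) := by
      refine Asymptotics.IsBigO.of_bound 1 (.of_forall fun t => ?_)
      rw [one_mul, norm_pow, norm_pow]
      refine pow_le_pow_left₀ (norm_nonneg _) ?_ _
      rw [Real.norm_eq_abs, Real.norm_eq_abs, abs_of_nonneg (le_max_right _ _)]
      exact max_le (le_abs_self t) (abs_nonneg t)
    refine h1.trans_isLittleO ?_
    simpa using Asymptotics.isLittleO_pow_pow (𝕜 := ℝ) (show 1 < k + 2 by omega)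
  · have h1 : HasDerivAt (fun t : ℝ => t ^ (k + 2)) ((k + 2) * s ^ (k + 1)) s := by
      simpa using hasDerivAt_pow (k + 2) s
    rw [max_eq_left hs.le]
    refine h1.congr_of_eventuallyEq ?_
    filter_upwards [Ioi_mem_nhds hs] with t ht
    rw [max_eq_left (le_of_lt ht)]

theorem contDiff_one_max_zero_pow (k : ℕ) : ContDiff ℝ 1 fun t : ℝ => max t 0 ^ (k + 2) := by
  rw [contDiff_one_iff_deriv]
  refine ⟨fun s => (hasDerivAt_max_zero_pow k s).differentiableAt, ?_⟩
  rw [show deriv (fun t : ℝ => max t 0 ^ (k + 2)) = fun s : ℝ => ((k : ℝ) + 2) * max s 0 ^ (k + 1) from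
    funext fun s => (hasDerivAt_max_zero_pow k s).deriv]
  fun_prop

theorem contDiff_det_graphMetric (hf : ContDiff ℝ (⊤ : ℕ∞) f) :
    ContDiff ℝ (⊤ : ℕ∞) fun y => (graphMetric f y).det :=
  ContDiff.matrix_det (contDiff_graphMetric hf)

theorem contDiff_slopeFunction (hf : ContDiff ℝ (⊤ : ℕ∞) f) :
    ContDiff ℝ (⊤ : ℕ∞) (slopeFunction f) :=
  (contDiff_det_graphMetric hf).sqrt fun x => (isUnit_det_graphMetric f x).ne_zero

theorem slopeFunction_sq (f : (Fin n → ℝ) → (Fin m → ℝ)) (x : Fin n → ℝ) :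
    slopeFunction f x ^ 2 = (graphMetric f x).det :=
  Real.sq_sqrt (by linarith [one_le_det_graphMetric f x])

theorem one_le_slopeFunction (f : (Fin n → ℝ) → (Fin m → ℝ)) (x : Fin n → ℝ) :
    1 ≤ slopeFunction f x :=
  Real.one_le_sqrt.2 (one_le_det_graphMetric f x)

theorem pderiv'_graphMetric (hf : ContDiff ℝ (⊤ : ℕ∞) f) (k i j : Fin n) (x : Fin n → ℝ) :
    pderiv' k (fun y => graphMetric f y i j) x =
      ∑ α, pderiv' k (pderiv' i fun y => f y α) x * pderiv' j (fun y => f y α) x +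
      ∑ α, pderiv' k (pderiv' j fun y => f y α) x * pderiv' i (fun y => f y α) x :=
  pderiv'_affineMetric (C := 1) (contDiff_component hf) k i j x

theorem pderiv'_slopeFunction (hf : ContDiff ℝ (⊤ : ℕ∞) f) (k : Fin n) (x : Fin n → ℝ) :
    pderiv' k (slopeFunction f) x = slopeFunction f x * ∑ i, ∑ j, (graphMetric f x)⁻¹ i j *
      ∑ α, pderiv' k (pderiv' i fun y => f y α) x * pderiv' j (fun y => f y α) x := by
  have hv := (contDiff_slopeFunction hf).diffAt_of_smooth x
  have h1 : pderiv' k (fun y => (graphMetric f y).det) x =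
      2 * slopeFunction f x * pderiv' k (slopeFunction f) x := by
    have : (fun y => (graphMetric f y).det) = fun y => slopeFunction f y ^ 2 :=
      funext fun y => (slopeFunction_sq f y).symm
    rw [this, pderiv'_pow k 2 hv]; norm_num
  have h2 := pderiv'_det (contDiff_graphMetric hf)
    (fun y => (isUnit_det_graphMetric f y).ne_zero) k x
  rw [h1] at h2
  have hsym : ∀ i j, (graphMetric f x)⁻¹ j i = (graphMetric f x)⁻¹ i j := fun i j =>
    congrFun (congrFun (graphMetric_inv_transpose f x) i) j
  have h3 : ∑ i, ∑ j, (graphMetric f x)⁻¹ j i * pderiv' k (fun y => graphMetric f y i j) x =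
      2 * ∑ i, ∑ j, (graphMetric f x)⁻¹ i j *
      ∑ α, pderiv' k (pderiv' i fun y => f y α) x * pderiv' j (fun y => f y α) x := by
    simp only [pderiv'_graphMetric hf, mul_add, Finset.sum_add_distrib, two_mul]
    congr 1
    · simp only [hsym]
    · rw [Finset.sum_comm]
  rw [h3, ← slopeFunction_sq] at h2
  have hpos : 0 < slopeFunction f x := by linarith [one_le_slopeFunction f x]
  have h4 : 2 * slopeFunction f x ≠ 0 := by positivity
  apply mul_left_cancel₀ h4
  rw [h2]; ring

/-- The coefficients of the Laplace operator of the graph in divergence form. -/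
def divCoeff (f : (Fin n → ℝ) → (Fin m → ℝ)) (i j : Fin n) (x : Fin n → ℝ) : ℝ :=
  slopeFunction f x * (graphMetric f x)⁻¹ i j

theorem contDiff_divCoeff (hf : ContDiff ℝ (⊤ : ℕ∞) f) (i j : Fin n) :
    ContDiff ℝ (⊤ : ℕ∞) (divCoeff f i j) :=
  (contDiff_slopeFunction hf).mul (contDiff_graphMetric_inv hf i j)

theorem sum_pderiv'_divCoeff (hf : ContDiff ℝ (⊤ : ℕ∞) f) (hmin : SolvesMinimalSystem f)
    (j : Fin n) (x : Fin n → ℝ) : ∑ i, pderiv' i (divCoeff f i j) x = 0 := by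
  set W := (graphMetric f x)⁻¹ with hW
  have hsym : ∀ a b, W b a = W a b := fun a b =>
    congrFun (congrFun (graphMetric_inv_transpose f x) a) b
  obtain ⟨q, hq⟩ : ∃ q : Fin n → Fin n → Fin n → ℝ, ∀ i a b, q i a b =
      ∑ α, pderiv' i (pderiv' a fun y => f y α) x * pderiv' b (fun y => f y α) x :=
    ⟨_, fun _ _ _ => rfl⟩
  have hqs : ∀ i a b, q i a b = q a i b := fun i a b => by
    simp only [hq, pderiv'_comm i a (contDiff_component hf _)]
  have hdG : ∀ i a b, pderiv' i (fun y => graphMetric f y a b) x = q i a b + q i b a :=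
    fun i a b => by rw [pderiv'_graphMetric hf, hq, hq]
  have hdW : ∀ i a b, pderiv' i (fun y => (graphMetric f y)⁻¹ a b) x =
      -∑ c, (∑ d, W a d * (q i d c + q i c d)) * W c b := by
    intro i a b
    have := congrFun (congrFun (pderiv'_inv (contDiff_graphMetric hf)
      (fun y => (isUnit_det_graphMetric f y).ne_zero) i x) a) b
    simpa [Matrix.mul_apply, hdG] using this
  have hpde : ∀ b, ∑ i, ∑ d, W i d * q i d b = 0 := by
    intro b
    have : ∀ α, ∑ i, ∑ d, W i d *
        (pderiv' i (pderiv' d fun y => f y α) x * pderiv' b (fun y => f y α) x) = 0 := by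
      intro α
      simp only [← mul_assoc, ← Finset.sum_mul]
      rw [mul_eq_zero]; left
      exact hmin α x
    simp only [hq, Finset.mul_sum]
    rw [← Finset.sum_eq_zero fun α (_ : α ∈ Finset.univ) => this α, Finset.sum_comm
      (s := (Finset.univ : Finset (Fin m)))]
    exact Finset.sum_congr rfl fun i _ => Finset.sum_comm
  have hterm : ∀ i, pderiv' i (divCoeff f i j) x = slopeFunction f x *
      ((∑ a, ∑ b, W a b * q i a b) * W i j -
        ∑ c, (∑ d, W i d * (q i d c + q i c d)) * W c j) := by
    intro i
    have : divCoeff f i j = fun y => slopeFunction f y * (graphMetric f y)⁻¹ i j := rfl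
    rw [this, pderiv'_mul i ((contDiff_slopeFunction hf).diffAt_of_smooth x)
      ((contDiff_graphMetric_inv hf i j).diffAt_of_smooth x), pderiv'_slopeFunction hf, hdW]
    simp only [← hq, ← hW]
    ring
  simp only [hterm, ← Finset.mul_sum]
  rw [mul_eq_zero]; right
  rw [Finset.sum_sub_distrib, sub_eq_zero, Finset.sum_comm
    (f := fun i c => (∑ d, W i d * (q i d c + q i c d)) * W c j)]
  refine Finset.sum_congr rfl fun c _ => ?_
  rw [← Finset.sum_mul]
  congr 1
  simp only [mul_add, Finset.sum_add_distrib, hpde, zero_add]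
  exact Finset.sum_congr rfl fun a _ => Finset.sum_congr rfl fun b _ => by rw [hqs]

/-- Squared distance, in the ambient space, between the points of the graph over `x` and `y`. -/
def graphDistSq (f : (Fin n → ℝ) → (Fin m → ℝ)) (y x : Fin n → ℝ) : ℝ :=
  ∑ i, (x i - y i) ^ 2 + ∑ α, (f x α - f y α) ^ 2

theorem contDiff_graphDistSq (hf : ContDiff ℝ (⊤ : ℕ∞) f) (y : Fin n → ℝ) :
    ContDiff ℝ (⊤ : ℕ∞) (graphDistSq f y) := by
  refine (ContDiff.sum fun i _ => ?_).add (ContDiff.sum fun α _ => ?_)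
  · exact ((contDiff_apply ℝ ℝ i).sub contDiff_const).pow 2
  · exact ((contDiff_component hf α).sub contDiff_const).pow 2

theorem pderiv'_graphDistSq (hf : ContDiff ℝ (⊤ : ℕ∞) f) (y : Fin n → ℝ) (i : Fin n)
    (x : Fin n → ℝ) : pderiv' i (graphDistSq f y) x =
      2 * ((x i - y i) + ∑ α, (f x α - f y α) * pderiv' i (fun z => f z α) x) := by
  have hc : ∀ k : Fin n, ContDiff ℝ (⊤ : ℕ∞) fun z : Fin n → ℝ => z k := fun k =>
    contDiff_apply ℝ ℝ k
  have h1 : ∀ k : Fin n, ContDiff ℝ (⊤ : ℕ∞) fun z : Fin n → ℝ => z k - y k := fun k =>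
    (hc k).sub contDiff_const
  have h2 : ∀ α : Fin m, ContDiff ℝ (⊤ : ℕ∞) fun z : Fin n → ℝ => f z α - f y α := fun α =>
    (contDiff_component hf α).sub contDiff_const
  have hr : graphDistSq f y = fun x => ∑ i, (x i - y i) ^ 2 + ∑ α, (f x α - f y α) ^ 2 := rfl
  rw [hr, pderiv'_add i ((ContDiff.sum fun k _ => (h1 k).pow 2).diffAt_of_smooth x)
    ((ContDiff.sum fun α _ => (h2 α).pow 2).diffAt_of_smooth x),
    pderiv'_sum Finset.univ i (Φ := fun k z => (z k - y k) ^ 2)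
      fun k _ => ((h1 k).pow 2).diffAt_of_smooth x,
    pderiv'_sum Finset.univ i (Φ := fun α z => (f z α - f y α) ^ 2)
      fun α _ => ((h2 α).pow 2).diffAt_of_smooth x, mul_add, Finset.mul_sum]
  congr 1
  · have : ∀ k, pderiv' i (fun z => (z k - y k) ^ 2) x =
        if k = i then 2 * (x k - y k) else 0 := by
      intro k
      rw [pderiv'_pow i 2 ((h1 k).diffAt_of_smooth x), pderiv'_sub i ((hc k).diffAt_of_smooth x)
        (differentiableAt_const _), pderiv'_const, pderiv'_coord]
      split_ifs <;> norm_num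
    simp only [this]
    simp
  · refine Finset.sum_congr rfl fun α _ => ?_
    rw [pderiv'_pow i 2 ((h2 α).diffAt_of_smooth x),
      pderiv'_sub i ((contDiff_component hf α).diffAt_of_smooth x) (differentiableAt_const _),
      pderiv'_const]
    norm_num; ring

theorem metricTraceHessian_graphDistSq (hf : ContDiff ℝ (⊤ : ℕ∞) f) (hmin : SolvesMinimalSystem f)
    (y x : Fin n → ℝ) : metricTraceHessian f (graphDistSq f y) x = 2 * n := by
  have hc : ∀ k : Fin n, ContDiff ℝ (⊤ : ℕ∞) fun z : Fin n → ℝ => z k := fun k =>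
    contDiff_apply ℝ ℝ k
  have h1 : ∀ k : Fin n, ContDiff ℝ (⊤ : ℕ∞) fun z : Fin n → ℝ => z k - y k := fun k =>
    (hc k).sub contDiff_const
  have h2 : ∀ (j : Fin n) (α : Fin m), ContDiff ℝ (⊤ : ℕ∞) fun z : Fin n → ℝ =>
      (f z α - f y α) * pderiv' j (fun z => f z α) z := fun j α =>
    ((contDiff_component hf α).sub contDiff_const).mul ((contDiff_component hf α).pderiv' j)
  have hh : ∀ i j, pderiv' i (pderiv' j (graphDistSq f y)) x = 2 * graphMetric f x j i +
      2 * ∑ α, (f x α - f y α) * pderiv' i (pderiv' j fun z => f z α) x := by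
    intro i j
    rw [show pderiv' j (graphDistSq f y) = fun x => 2 * ((x j - y j) +
      ∑ α, (f x α - f y α) * pderiv' j (fun z => f z α) x) from
        funext fun x => pderiv'_graphDistSq hf y j x,
      pderiv'_const_mul i 2 (((h1 j).add (ContDiff.sum fun α _ => h2 j α)).diffAt_of_smooth x),
      pderiv'_add i ((h1 j).diffAt_of_smooth x)
        ((ContDiff.sum fun α _ => h2 j α).diffAt_of_smooth x),
      pderiv'_sum Finset.univ i (Φ := fun α x => (f x α - f y α) * pderiv' j (fun z => f z α) x)
        fun α _ => (h2 j α).diffAt_of_smooth x,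
      pderiv'_sub i ((hc j).diffAt_of_smooth x) (differentiableAt_const _), pderiv'_const,
      pderiv'_coord, sub_zero, ← mul_add, graphMetric, Matrix.of_apply, add_assoc,
      ← Finset.sum_add_distrib]
    congr 2
    refine Finset.sum_congr rfl fun α _ => ?_
    rw [pderiv'_mul i (((contDiff_component hf α).sub contDiff_const).diffAt_of_smooth x)
      (((contDiff_component hf α).pderiv' j).diffAt_of_smooth x),
      pderiv'_sub i ((contDiff_component hf α).diffAt_of_smooth x) (differentiableAt_const _),
      pderiv'_const]
    ring
  have h3 : ∑ i, ∑ j, (graphMetric f x)⁻¹ i j * graphMetric f x j i = n := by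
    have : ∑ i, ∑ j, (graphMetric f x)⁻¹ i j * graphMetric f x j i =
        ((graphMetric f x)⁻¹ * graphMetric f x).trace := by
      simp [Matrix.trace, Matrix.mul_apply]
    rw [this, Matrix.nonsing_inv_mul _ (isUnit_det_graphMetric f x), Matrix.trace_one]
    simp
  have h4 : ∑ i, ∑ j, (graphMetric f x)⁻¹ i j *
      ∑ α, (f x α - f y α) * pderiv' i (pderiv' j fun z => f z α) x = 0 := by
    have : ∀ α, ∑ i, ∑ j, (graphMetric f x)⁻¹ i j *
        ((f x α - f y α) * pderiv' i (pderiv' j fun z => f z α) x) = 0 := by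
      intro α
      simp only [mul_left_comm, ← Finset.mul_sum]
      rw [mul_eq_zero]; right
      exact hmin α x
    simp only [Finset.mul_sum]
    rw [← Finset.sum_eq_zero fun α (_ : α ∈ Finset.univ) => this α, Finset.sum_comm
      (s := (Finset.univ : Finset (Fin m)))]
    exact Finset.sum_congr rfl fun i _ => Finset.sum_comm
  simp only [metricTraceHessian, hh, mul_add, Finset.sum_add_distrib]
  have h5 : ∀ X : Fin n → Fin n → ℝ, ∑ i, ∑ j, (graphMetric f x)⁻¹ i j * (2 * X i j) =
      2 * ∑ i, ∑ j, (graphMetric f x)⁻¹ i j * X i j := by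
    intro X
    simp only [Finset.mul_sum]
    exact Finset.sum_congr rfl fun i _ => Finset.sum_congr rfl fun j _ => by ring
  rw [h5 fun i j => graphMetric f x j i, h5 fun i j =>
    ∑ α, (f x α - f y α) * pderiv' i (pderiv' j fun z => f z α) x, h3, h4]
  ring

/-- Squared length of the normal part of the position vector of the graph relative to the point
over `y`. -/
def normalDistSq (f : (Fin n → ℝ) → (Fin m → ℝ)) (y x : Fin n → ℝ) : ℝ :=
  graphDistSq f y x - (∑ i, ∑ j, (graphMetric f x)⁻¹ i j *
    (pderiv' i (graphDistSq f y) x * pderiv' j (graphDistSq f y) x)) / 4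

theorem normalDistSq_eq (hf : ContDiff ℝ (⊤ : ℕ∞) f) (y x : Fin n → ℝ) :
    ∃ c : Fin n → ℝ, normalDistSq f y x = ∑ i, (x i - y i - c i) ^ 2 +
      ∑ α, (f x α - f y α - ∑ i, c i * pderiv' i (fun z => f z α) x) ^ 2 := by
  set X : Fin n ⊕ Fin m → ℝ := Sum.elim (fun i => x i - y i) fun α => f x α - f y α with hX
  set T := tangentMatrix f x with hT
  set c := (graphMetric f x)⁻¹ *ᵥ (T *ᵥ X) with hc
  refine ⟨c, ?_⟩
  have hTX : ∀ i, pderiv' i (graphDistSq f y) x = 2 * (T *ᵥ X) i := by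
    intro i
    rw [pderiv'_graphDistSq hf]
    simp only [hT, mulVec, dotProduct, tangentMatrix, Matrix.of_apply, Fintype.sum_sum_type,
      graphTangent_inl, graphTangent_inr, hX, Sum.elim_inl, Sum.elim_inr]
    simp [mul_comm]
  have h1 : ∑ i, (x i - y i - c i) ^ 2 +
      ∑ α, (f x α - f y α - ∑ i, c i * pderiv' i (fun z => f z α) x) ^ 2 =
      (X - Tᵀ *ᵥ c) ⬝ᵥ (X - Tᵀ *ᵥ c) := by
    simp only [dotProduct, Fintype.sum_sum_type, Pi.sub_apply, hT,
      transpose_tangentMatrix_mulVec_inl, hX, Sum.elim_inl, Sum.elim_inr, sq]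
    congr 1
    have : ∀ α, ((tangentMatrix f x)ᵀ *ᵥ c) (Sum.inr α) =
        ∑ i, c i * pderiv' i (fun z => f z α) x := by
      intro α
      simp only [mulVec, dotProduct, Matrix.transpose_apply, tangentMatrix, Matrix.of_apply,
        graphTangent_inr, mul_comm]
    simp only [this]
  have h2 : graphDistSq f y x = X ⬝ᵥ X := by
    simp only [graphDistSq, dotProduct, Fintype.sum_sum_type, hX, Sum.elim_inl, Sum.elim_inr, sq]
  have h3 : X ⬝ᵥ (Tᵀ *ᵥ c) = (T *ᵥ X) ⬝ᵥ c := by rw [dotProduct_mulVec, vecMul_transpose]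
  have h4 : (Tᵀ *ᵥ c) ⬝ᵥ (Tᵀ *ᵥ c) = (T *ᵥ X) ⬝ᵥ c := by
    rw [dotProduct_mulVec, vecMul_transpose, mulVec_mulVec, hT, tangentMatrix_mul_transpose, hc,
      mulVec_mulVec _ (graphMetric f x), Matrix.mul_nonsing_inv _ (isUnit_det_graphMetric f x),
      one_mulVec]
  have h5 : (∑ i, ∑ j, (graphMetric f x)⁻¹ i j *
      (pderiv' i (graphDistSq f y) x * pderiv' j (graphDistSq f y) x)) / 4 =
      (T *ᵥ X) ⬝ᵥ c := by
    have hci : ∀ i, c i = ∑ j, (graphMetric f x)⁻¹ i j * (T *ᵥ X) j := fun _ => rfl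
    rw [div_eq_iff (by norm_num), dotProduct, Finset.sum_mul]
    refine Finset.sum_congr rfl fun i _ => ?_
    rw [hci, Finset.mul_sum, Finset.sum_mul]
    refine Finset.sum_congr rfl fun j _ => ?_
    rw [hTX, hTX]; ring
  rw [h1, normalDistSq, h5, h2, sub_dotProduct, dotProduct_sub, dotProduct_sub,
    dotProduct_comm (Tᵀ *ᵥ c) X, h3, h4]
  ring

theorem normalDistSq_nonneg (hf : ContDiff ℝ (⊤ : ℕ∞) f) (y x : Fin n → ℝ) :
    0 ≤ normalDistSq f y x := by
  obtain ⟨c, hc⟩ := normalDistSq_eq hf y x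
  rw [hc]
  exact add_nonneg (Finset.sum_nonneg fun _ _ => sq_nonneg _)
    (Finset.sum_nonneg fun _ _ => sq_nonneg _)

theorem eq_of_normalDistSq_eq_zero (hf : ContDiff ℝ (⊤ : ℕ∞) f) {y x : Fin n → ℝ}
    (h : normalDistSq f y x = 0) (α : Fin m) :
    f x α - f y α = ∑ i, (x i - y i) * pderiv' i (fun z => f z α) x := by
  obtain ⟨c, hc⟩ := normalDistSq_eq hf y x
  have h1 : 0 ≤ ∑ i, (x i - y i - c i) ^ 2 := Finset.sum_nonneg fun _ _ => sq_nonneg _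
  have h2 : 0 ≤ ∑ α, (f x α - f y α - ∑ i, c i * pderiv' i (fun z => f z α) x) ^ 2 :=
    Finset.sum_nonneg fun _ _ => sq_nonneg _
  have h3 := (Finset.sum_eq_zero_iff_of_nonneg fun i _ => sq_nonneg _).1
    (show ∑ i, (x i - y i - c i) ^ 2 = 0 by linarith)
  have h4 := (Finset.sum_eq_zero_iff_of_nonneg fun i _ => sq_nonneg _).1
    (show ∑ α, (f x α - f y α - ∑ i, c i * pderiv' i (fun z => f z α) x) ^ 2 = 0 by linarith)
    α (Finset.mem_univ α)
  rw [sq_eq_zero_iff, sub_eq_zero] at h4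
  rw [h4]
  refine Finset.sum_congr rfl fun i _ => ?_
  have := h3 i (Finset.mem_univ i)
  rw [sq_eq_zero_iff, sub_eq_zero] at this
  rw [this]

end DivergenceForm

section WeightedIdentity

open MeasureTheory

variable {n m : ℕ} {f : (Fin n → ℝ) → (Fin m → ℝ)}

/-- The truncated weight `(R² - r)₊`, where `r` is the squared extrinsic distance to the point of
the graph over `y`. -/
def truncWeight (f : (Fin n → ℝ) → (Fin m → ℝ)) (y : Fin n → ℝ) (R : ℝ) (x : Fin n → ℝ) : ℝ :=
  max (R ^ 2 - graphDistSq f y x) 0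

theorem sq_sub_le_graphDistSq (f : (Fin n → ℝ) → (Fin m → ℝ)) (y x : Fin n → ℝ) (i : Fin n) :
    (x i - y i) ^ 2 ≤ graphDistSq f y x := by
  have h1 : (x i - y i) ^ 2 ≤ ∑ i, (x i - y i) ^ 2 :=
    Finset.single_le_sum (f := fun i => (x i - y i) ^ 2) (fun _ _ => sq_nonneg _)
      (Finset.mem_univ i)
  have h2 : 0 ≤ ∑ α, (f x α - f y α) ^ 2 := Finset.sum_nonneg fun _ _ => sq_nonneg _
  simp only [graphDistSq]
  linarith

theorem graphDistSq_nonneg (f : (Fin n → ℝ) → (Fin m → ℝ)) (y x : Fin n → ℝ) :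
    0 ≤ graphDistSq f y x :=
  add_nonneg (Finset.sum_nonneg fun _ _ => sq_nonneg _) (Finset.sum_nonneg fun _ _ => sq_nonneg _)

theorem mem_closedBall_of_graphDistSq_le {y x : Fin n → ℝ} {R : ℝ} (hR : 0 ≤ R)
    (h : graphDistSq f y x ≤ R ^ 2) : x ∈ Metric.closedBall y R := by
  rw [Metric.mem_closedBall, dist_pi_le_iff hR]
  intro i
  rw [Real.dist_eq]
  exact abs_le_of_sq_le_sq ((sq_sub_le_graphDistSq f y x i).trans h) hR

theorem truncWeight_eq_zero {y x : Fin n → ℝ} {R : ℝ} (hR : 0 ≤ R)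
    (h : x ∉ Metric.closedBall y R) : truncWeight f y R x = 0 := by
  refine max_eq_right ?_
  by_contra! h1
  exact h (mem_closedBall_of_graphDistSq_le (f := f) hR (by linarith))

theorem truncWeight_nonneg (f : (Fin n → ℝ) → (Fin m → ℝ)) (y : Fin n → ℝ) (R : ℝ)
    (x : Fin n → ℝ) : 0 ≤ truncWeight f y R x := le_max_right _ _

theorem truncWeight_le (f : (Fin n → ℝ) → (Fin m → ℝ)) (y : Fin n → ℝ) (R : ℝ)
    (x : Fin n → ℝ) : truncWeight f y R x ≤ R ^ 2 :=
  max_le (by linarith [graphDistSq_nonneg f y x]) (sq_nonneg R)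

theorem continuous_truncWeight (hf : ContDiff ℝ (⊤ : ℕ∞) f) (y : Fin n → ℝ) (R : ℝ) :
    Continuous (truncWeight f y R) :=
  (continuous_const.sub (contDiff_graphDistSq hf y).continuous).max continuous_const

theorem integrable_truncWeight_pow_mul (hf : ContDiff ℝ (⊤ : ℕ∞) f) (y : Fin n → ℝ) {R : ℝ}
    (hR : 0 ≤ R) (k : ℕ) {φ : (Fin n → ℝ) → ℝ} (hφ : Continuous φ) :
    Integrable fun x => truncWeight f y R x ^ (k + 1) * φ x := by
  refine (((continuous_truncWeight hf y R).pow _).mul hφ).integrable_of_hasCompactSupport ?_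
  refine HasCompactSupport.intro (isCompact_closedBall y R) fun x hx => ?_
  rw [Pi.mul_apply, Pi.pow_apply, truncWeight_eq_zero hR hx, zero_pow (Nat.succ_ne_zero k),
    zero_mul]

theorem contDiff_truncWeight_pow (hf : ContDiff ℝ (⊤ : ℕ∞) f) (y : Fin n → ℝ) (R : ℝ) (k : ℕ) :
    ContDiff ℝ 1 fun x => truncWeight f y R x ^ (k + 2) :=
  (contDiff_one_max_zero_pow k).comp
    ((contDiff_const.sub (contDiff_graphDistSq hf y)).of_le (by simp))

theorem pderiv'_truncWeight_pow (hf : ContDiff ℝ (⊤ : ℕ∞) f) (y : Fin n → ℝ) (R : ℝ) (k : ℕ)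
    (i : Fin n) (x : Fin n → ℝ) : pderiv' i (fun x => truncWeight f y R x ^ (k + 2)) x =
      -((k + 2) * truncWeight f y R x ^ (k + 1) * pderiv' i (graphDistSq f y) x) := by
  have h := pderiv'_comp (φ := fun x => R ^ 2 - graphDistSq f y x) i
    (hasDerivAt_max_zero_pow k (R ^ 2 - graphDistSq f y x))
    ((contDiff_const.sub (contDiff_graphDistSq hf y)).diffAt_of_smooth x)
  rw [pderiv'_sub i (differentiableAt_const _) ((contDiff_graphDistSq hf y).diffAt_of_smooth x),
    pderiv'_const] at h
  unfold truncWeight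
  rw [h]; ring

theorem integral_divergence_truncWeight (hf : ContDiff ℝ (⊤ : ℕ∞) f) (hmin : SolvesMinimalSystem f)
    {u : (Fin n → ℝ) → ℝ} (hu : ContDiff ℝ (⊤ : ℕ∞) u) (y : Fin n → ℝ) {R : ℝ} (hR : 0 ≤ R) :
    ∫ x, slopeFunction f x * (truncWeight f y R x ^ 3 * metricTraceHessian f u x +
      6 * n * (u x * truncWeight f y R x ^ 2) -
      24 * (u x * truncWeight f y R x * (graphDistSq f y x - normalDistSq f y x))) = 0 := by
  set w := truncWeight f y R with hw
  set r := graphDistSq f y with hr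
  have hrc : ContDiff ℝ (⊤ : ℕ∞) r := contDiff_graphDistSq hf y
  have hw3 : ContDiff ℝ 1 fun x => w x ^ 3 := contDiff_truncWeight_pow hf y R 1
  have hw2 : ContDiff ℝ 1 fun x => w x ^ 2 := contDiff_truncWeight_pow hf y R 0
  have hle : ((1 : ℕ∞) : WithTop ℕ∞) ≤ ((⊤ : ℕ∞) : WithTop ℕ∞) := by simp
  have hA : ∀ j, ContDiff ℝ 1 fun x => w x ^ 3 * pderiv' j u x := fun j =>
    hw3.mul ((hu.pderiv' j).of_le hle)
  have huw : ContDiff ℝ 1 fun x => u x * w x ^ 2 := (hu.of_le hle).mul hw2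
  have hB : ∀ j, ContDiff ℝ 1 fun x => 3 * ((u x * w x ^ 2) * pderiv' j r x) := fun j =>
    contDiff_const.mul (huw.mul ((hrc.pderiv' j).of_le hle))
  have hY : ∀ j, ContDiff ℝ 1 fun x => w x ^ 3 * pderiv' j u x +
      3 * ((u x * w x ^ 2) * pderiv' j r x) := fun j => (hA j).add (hB j)
  have hT : ∀ i j, ContDiff ℝ 1 fun x => divCoeff f i j x * (w x ^ 3 * pderiv' j u x +
      3 * ((u x * w x ^ 2) * pderiv' j r x)) := fun i j =>
    ((contDiff_divCoeff hf i j).of_le hle).mul (hY j)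
  have hZ : ∀ i, ContDiff ℝ 1 fun x => ∑ j, divCoeff f i j x * (w x ^ 3 * pderiv' j u x +
      3 * ((u x * w x ^ 2) * pderiv' j r x)) := fun i => ContDiff.sum fun j _ => hT i j
  have hZc : ∀ i, HasCompactSupport fun x => ∑ j, divCoeff f i j x * (w x ^ 3 * pderiv' j u x +
      3 * ((u x * w x ^ 2) * pderiv' j r x)) := fun i => by
    refine HasCompactSupport.intro (isCompact_closedBall y R) fun x hx => ?_
    rw [hw, truncWeight_eq_zero hR hx]
    simp
  have hd : ∀ {φ : (Fin n → ℝ) → ℝ}, ContDiff ℝ 1 φ → ∀ x, DifferentiableAt ℝ φ x :=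
    fun h x => (h.differentiable (by simp)).differentiableAt
  have hInt := fun i => integral_pderiv'_eq_zero i (hZ i) (hZc i)
  have hdc : ∀ i, Continuous (pderiv' i fun x => ∑ j, divCoeff f i j x * (w x ^ 3 * pderiv' j u x +
      3 * ((u x * w x ^ 2) * pderiv' j r x))) := fun i => by
    unfold pderiv'
    exact ((hZ i).continuous_fderiv (by simp)).clm_apply continuous_const
  have hdi : ∀ i, Integrable (pderiv' i fun x => ∑ j, divCoeff f i j x *
      (w x ^ 3 * pderiv' j u x + 3 * ((u x * w x ^ 2) * pderiv' j r x))) := fun i => by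
    refine (hdc i).integrable_of_hasCompactSupport ?_
    unfold pderiv'
    exact ((hZc i).fderiv ℝ).comp_left (g := fun L : (Fin n → ℝ) →L[ℝ] ℝ => L (Pi.single i 1))
      (by simp)
  have hsum : ∫ x, ∑ i, pderiv' i (fun x => ∑ j, divCoeff f i j x *
      (w x ^ 3 * pderiv' j u x + 3 * ((u x * w x ^ 2) * pderiv' j r x))) x = 0 := by
    rw [integral_finsetSum _ fun i _ => hdi i]
    exact Finset.sum_eq_zero fun i _ => hInt i
  rw [← hsum]
  congr 1
  funext x
  have hYd : ∀ i j, pderiv' i (fun x => w x ^ 3 * pderiv' j u x +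
      3 * ((u x * w x ^ 2) * pderiv' j r x)) x =
      3 * w x ^ 2 * (pderiv' i u x * pderiv' j r x - pderiv' i r x * pderiv' j u x) +
      w x ^ 3 * pderiv' i (pderiv' j u) x +
      3 * (u x * w x ^ 2) * pderiv' i (pderiv' j r) x -
      6 * (u x * w x) * (pderiv' i r x * pderiv' j r x) := by
    intro i j
    have h3 : pderiv' i (fun x => w x ^ 3) x = -(3 * w x ^ 2 * pderiv' i r x) := by
      have := pderiv'_truncWeight_pow hf y R 1 i x
      norm_num at this
      exact this
    have h2 : pderiv' i (fun x => w x ^ 2) x = -(2 * w x * pderiv' i r x) := by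
      have := pderiv'_truncWeight_pow hf y R 0 i x
      norm_num at this
      exact this
    rw [pderiv'_add i (hd (hA j) x) (hd (hB j) x),
      pderiv'_const_mul i 3 (hd (huw.mul ((hrc.pderiv' j).of_le hle)) x),
      pderiv'_mul i (hd huw x) ((hrc.pderiv' j).diffAt_of_smooth x),
      pderiv'_mul i (hu.diffAt_of_smooth x) (hd hw2 x),
      pderiv'_mul i (hd hw3 x) ((hu.pderiv' j).diffAt_of_smooth x), h2, h3]
    ring
  have hZd : ∀ i, pderiv' i (fun x => ∑ j, divCoeff f i j x *
      (w x ^ 3 * pderiv' j u x + 3 * ((u x * w x ^ 2) * pderiv' j r x))) x =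
      ∑ j, (pderiv' i (divCoeff f i j) x *
        (w x ^ 3 * pderiv' j u x + 3 * ((u x * w x ^ 2) * pderiv' j r x)) +
      divCoeff f i j x * (3 * w x ^ 2 * (pderiv' i u x * pderiv' j r x -
        pderiv' i r x * pderiv' j u x) + w x ^ 3 * pderiv' i (pderiv' j u) x +
      3 * (u x * w x ^ 2) * pderiv' i (pderiv' j r) x -
      6 * (u x * w x) * (pderiv' i r x * pderiv' j r x))) := by
    intro i
    rw [pderiv'_sum Finset.univ i (Φ := fun j x => divCoeff f i j x *
      (w x ^ 3 * pderiv' j u x + 3 * ((u x * w x ^ 2) * pderiv' j r x))) fun j _ => hd (hT i j) x]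
    refine Finset.sum_congr rfl fun j _ => ?_
    rw [pderiv'_mul i ((contDiff_divCoeff hf i j).diffAt_of_smooth x) (hd (hY j) x), hYd]
  simp only [hZd]
  have hdiv : ∑ i, ∑ j, pderiv' i (divCoeff f i j) x *
        (w x ^ 3 * pderiv' j u x + 3 * ((u x * w x ^ 2) * pderiv' j r x)) = 0 := by
    rw [Finset.sum_comm]
    refine Finset.sum_eq_zero fun j _ => ?_
    rw [← Finset.sum_mul, sum_pderiv'_divCoeff hf hmin, zero_mul]
  have hsym : ∀ i j, divCoeff f j i x = divCoeff f i j x := fun i j => by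
    simp only [divCoeff]
    rw [show (graphMetric f x)⁻¹ j i = (graphMetric f x)⁻¹ i j from
      congrFun (congrFun (graphMetric_inv_transpose f x) i) j]
  have hcross : ∑ i, ∑ j, divCoeff f i j x * (pderiv' i u x * pderiv' j r x -
      pderiv' i r x * pderiv' j u x) = 0 := by
    simp only [mul_sub, Finset.sum_sub_distrib]
    rw [sub_eq_zero, Finset.sum_comm]
    exact Finset.sum_congr rfl fun i _ => Finset.sum_congr rfl fun j _ => by
      rw [hsym]; ring
  have hLu : ∑ i, ∑ j, divCoeff f i j x * pderiv' i (pderiv' j u) x =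
      slopeFunction f x * metricTraceHessian f u x := by
    simp only [divCoeff, metricTraceHessian, Finset.mul_sum, mul_assoc]
  have hLr : ∑ i, ∑ j, divCoeff f i j x * pderiv' i (pderiv' j r) x =
      slopeFunction f x * (2 * n) := by
    rw [← metricTraceHessian_graphDistSq hf hmin y x]
    simp only [divCoeff, metricTraceHessian, Finset.mul_sum, mul_assoc, hr]
  have hrr : ∑ i, ∑ j, divCoeff f i j x * (pderiv' i r x * pderiv' j r x) =
      slopeFunction f x * (4 * (r x - normalDistSq f y x)) := by
    have : 4 * (r x - normalDistSq f y x) = ∑ i, ∑ j, (graphMetric f x)⁻¹ i j *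
        (pderiv' i r x * pderiv' j r x) := by
      simp only [normalDistSq, hr]; ring
    rw [this]
    simp only [divCoeff, Finset.mul_sum, mul_assoc]
  have hsplit : ∀ i j, divCoeff f i j x * (3 * w x ^ 2 * (pderiv' i u x * pderiv' j r x -
        pderiv' i r x * pderiv' j u x) + w x ^ 3 * pderiv' i (pderiv' j u) x +
      3 * (u x * w x ^ 2) * pderiv' i (pderiv' j r) x -
      6 * (u x * w x) * (pderiv' i r x * pderiv' j r x)) =
      3 * w x ^ 2 * (divCoeff f i j x * (pderiv' i u x * pderiv' j r x -
        pderiv' i r x * pderiv' j u x)) + w x ^ 3 * (divCoeff f i j x * pderiv' i (pderiv' j u) x) +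
      3 * (u x * w x ^ 2) * (divCoeff f i j x * pderiv' i (pderiv' j r) x) -
      6 * (u x * w x) * (divCoeff f i j x * (pderiv' i r x * pderiv' j r x)) := fun i j => by ring
  simp only [Finset.sum_add_distrib, Finset.sum_sub_distrib, hsplit, hdiv, ← Finset.mul_sum,
    hcross, hLu, hLr, hrr]
  ring

/-- The weighted area of the graph. -/
def weightedArea (f : (Fin n → ℝ) → (Fin m → ℝ)) (u : (Fin n → ℝ) → ℝ) (y : Fin n → ℝ)
    (R : ℝ) : ℝ :=
  ∫ x, truncWeight f y R x ^ 2 * (u x * slopeFunction f x)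

theorem hasDerivAt_weightedArea (hf : ContDiff ℝ (⊤ : ℕ∞) f) {u : (Fin n → ℝ) → ℝ}
    (hu : Continuous u) (y : Fin n → ℝ) {R : ℝ} (hR : 0 < R) :
    HasDerivAt (weightedArea f u y)
      (∫ x, 4 * R * (truncWeight f y R x * (u x * slopeFunction f x))) R := by
  have huv : Continuous fun x => u x * slopeFunction f x :=
    hu.mul (contDiff_slopeFunction hf).continuous
  have hcw : ∀ S, Continuous (truncWeight f y S) := continuous_truncWeight hf y
  have hball : IsCompact (Metric.closedBall y (R + 1)) := isCompact_closedBall _ _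
  refine (hasDerivAt_integral_of_dominated_loc_of_deriv_le (μ := volume) (s := Metric.ball R R ∩
      Metric.ball R 1) (x₀ := R)
    (F := fun S x => truncWeight f y S x ^ 2 * (u x * slopeFunction f x))
    (F' := fun S x => 4 * S * (truncWeight f y S x * (u x * slopeFunction f x)))
    (bound := (Metric.closedBall y (R + 1)).indicator
      fun x => 4 * (R + 1) ^ 3 * |u x * slopeFunction f x|)
    ?_ ?_ ?_ ?_ ?_ ?_ ?_).2
  · exact Filter.inter_mem (Metric.ball_mem_nhds R hR) (Metric.ball_mem_nhds R one_pos)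
  · exact .of_forall fun S => (((hcw S).pow 2).mul huv).aestronglyMeasurable
  · exact integrable_truncWeight_pow_mul hf y hR.le 1 huv
  · exact (continuous_const.mul ((hcw R).mul huv)).aestronglyMeasurable
  · refine .of_forall fun x S hS => ?_
    have hS1 := hS.1
    have hS2 := hS.2
    rw [Metric.mem_ball, Real.dist_eq, abs_lt] at hS1 hS2
    by_cases hx : x ∈ Metric.closedBall y (R + 1)
    · rw [Set.indicator_of_mem hx, norm_mul, norm_mul, norm_mul, Real.norm_eq_abs,
        Real.norm_eq_abs, Real.norm_eq_abs, Real.norm_eq_abs,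
        abs_of_nonneg (truncWeight_nonneg f y S x),
        abs_of_pos (by linarith : (0 : ℝ) < S), abs_of_pos (by norm_num : (0 : ℝ) < 4)]
      rw [← mul_assoc]
      refine mul_le_mul_of_nonneg_right ?_ (abs_nonneg _)
      have h1 := truncWeight_le f y S x
      have h2 : S ≤ R + 1 := by linarith
      have h0 : 0 ≤ S := by linarith
      calc 4 * S * truncWeight f y S x ≤ 4 * S * S ^ 2 := by gcongr
        _ = 4 * S ^ 3 := by ring
        _ ≤ 4 * (R + 1) ^ 3 := by gcongr
    · rw [Set.indicator_of_notMem hx, truncWeight_eq_zero (by linarith)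
        fun h => hx (Metric.closedBall_subset_closedBall (by linarith) h)]
      simp
  · refine (integrable_indicator_iff hball.measurableSet).2 ?_
    exact (continuous_const.mul huv.abs).continuousOn.integrableOn_compact hball
  · refine .of_forall fun x S hS => ?_
    have h1 := (hasDerivAt_max_zero_pow 0 (S ^ 2 - graphDistSq f y x)).comp S
      (((hasDerivAt_pow 2 S).sub_const (graphDistSq f y x)))
    have h2 := h1.mul_const (u x * slopeFunction f x)
    refine h2.congr_deriv ?_
    simp only [truncWeight]
    norm_num
    ring

theorem integral_add_mul_sub_mul_add_mul {A B C D : (Fin n → ℝ) → ℝ} (hA : Integrable A)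
    (hB : Integrable B) (hC : Integrable C) (hD : Integrable D) (b c d : ℝ) :
    ∫ x, (A x + b * B x - c * C x + d * D x) =
      (∫ x, A x) + b * (∫ x, B x) - c * (∫ x, C x) + d * ∫ x, D x := by
  have hAB : Integrable fun x => A x + b * B x := hA.add (hB.const_mul b)
  have hABC : Integrable fun x => A x + b * B x - c * C x := hAB.sub (hC.const_mul c)
  rw [integral_add hABC (hD.const_mul d), integral_sub hAB (hC.const_mul c),
    integral_add hA (hB.const_mul b), integral_const_mul, integral_const_mul, integral_const_mul]

theorem continuous_normalDistSq (hf : ContDiff ℝ (⊤ : ℕ∞) f) (y : Fin n → ℝ) :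
    Continuous (normalDistSq f y) := by
  have hr := contDiff_graphDistSq hf y
  unfold normalDistSq
  exact hr.continuous.sub ((continuous_finsetSum _ fun i _ => continuous_finsetSum _ fun j _ =>
    (contDiff_graphMetric_inv hf i j).continuous.mul
      ((hr.pderiv' i).continuous.mul (hr.pderiv' j).continuous)).div_const 4)

theorem weightedArea_identity (hf : ContDiff ℝ (⊤ : ℕ∞) f) (hmin : SolvesMinimalSystem f)
    {u : (Fin n → ℝ) → ℝ} (hu : ContDiff ℝ (⊤ : ℕ∞) u) (y : Fin n → ℝ) {R : ℝ} (hR : 0 ≤ R) :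
    R * (∫ x, 4 * R * (truncWeight f y R x * (u x * slopeFunction f x))) -
      (n + 4) * weightedArea f u y R =
    (∫ x, truncWeight f y R x ^ 3 * (metricTraceHessian f u x * slopeFunction f x)) / 6 +
      4 * ∫ x, truncWeight f y R x * (normalDistSq f y x * (u x * slopeFunction f x)) := by
  have hv : Continuous (slopeFunction f) := (contDiff_slopeFunction hf).continuous
  have hL : Continuous (metricTraceHessian f u) := by
    unfold metricTraceHessian
    exact continuous_finsetSum _ fun i _ => continuous_finsetSum _ fun j _ =>
      (contDiff_graphMetric_inv hf i j).continuous.mul ((hu.pderiv' j).pderiv' i).continuous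
  have hN := continuous_normalDistSq hf y
  have huv := hu.continuous.mul hv
  have i3 : Integrable fun x => truncWeight f y R x ^ 3 *
      (metricTraceHessian f u x * slopeFunction f x) :=
    integrable_truncWeight_pow_mul hf y hR 2 (hL.mul hv)
  have i2 : Integrable fun x => truncWeight f y R x ^ 2 * (u x * slopeFunction f x) :=
    integrable_truncWeight_pow_mul hf y hR 1 huv
  have i1 : Integrable fun x => truncWeight f y R x * (u x * slopeFunction f x) := by
    simpa using integrable_truncWeight_pow_mul hf y hR 0 huv
  have i0 : Integrable fun x => truncWeight f y R x *
      (normalDistSq f y x * (u x * slopeFunction f x)) := by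
    simpa using integrable_truncWeight_pow_mul hf y hR 0 (hN.mul huv)
  have h := integral_divergence_truncWeight hf hmin hu y hR
  have hpt : ∀ x, slopeFunction f x * (truncWeight f y R x ^ 3 * metricTraceHessian f u x +
      6 * n * (u x * truncWeight f y R x ^ 2) -
      24 * (u x * truncWeight f y R x * (graphDistSq f y x - normalDistSq f y x))) =
      truncWeight f y R x ^ 3 * (metricTraceHessian f u x * slopeFunction f x) +
      (6 * n + 24) * (truncWeight f y R x ^ 2 * (u x * slopeFunction f x)) -
      24 * R ^ 2 * (truncWeight f y R x * (u x * slopeFunction f x)) +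
      24 * (truncWeight f y R x * (normalDistSq f y x * (u x * slopeFunction f x))) := by
    intro x
    have hwr : truncWeight f y R x * graphDistSq f y x =
        R ^ 2 * truncWeight f y R x - truncWeight f y R x ^ 2 := by
      unfold truncWeight
      rcases le_total (R ^ 2 - graphDistSq f y x) 0 with h0 | h0
      · rw [max_eq_right h0]; ring
      · rw [max_eq_left h0]; ring
    linear_combination (-24 * slopeFunction f x * u x) * hwr
  simp only [hpt] at h
  rw [integral_add_mul_sub_mul_add_mul i3 i2 i1 i0] at h
  rw [integral_const_mul, weightedArea]
  linear_combination h / (-6)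

end WeightedIdentity

section Monotonicity

open MeasureTheory

variable {n m : ℕ} {f : (Fin n → ℝ) → (Fin m → ℝ)}

/-- The scale-invariant weighted area ratio of the graph. -/
def areaRatio (f : (Fin n → ℝ) → (Fin m → ℝ)) (u : (Fin n → ℝ) → ℝ) (y : Fin n → ℝ)
    (R : ℝ) : ℝ :=
  weightedArea f u y R / R ^ (n + 4)

theorem hasDerivAt_areaRatio (hf : ContDiff ℝ (⊤ : ℕ∞) f) (hmin : SolvesMinimalSystem f)
    {u : (Fin n → ℝ) → ℝ} (hu : ContDiff ℝ (⊤ : ℕ∞) u) (y : Fin n → ℝ) {R : ℝ} (hR : 0 < R) :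
    HasDerivAt (areaRatio f u y)
      (((∫ x, truncWeight f y R x ^ 3 * (metricTraceHessian f u x * slopeFunction f x)) / 6 +
      4 * ∫ x, truncWeight f y R x * (normalDistSq f y x * (u x * slopeFunction f x))) /
        R ^ (n + 5)) R := by
  have h := (hasDerivAt_weightedArea hf hu.continuous y hR).div (hasDerivAt_pow (n + 4) R)
    (pow_pos hR _).ne'
  refine h.congr_deriv ?_
  rw [← weightedArea_identity hf hmin hu y hR.le]
  have h1 : n + 4 - 1 = n + 3 := rfl
  rw [h1]
  push_cast
  rw [div_eq_div_iff (by positivity) (by positivity)]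
  ring

theorem metricTraceHessian_one (f : (Fin n → ℝ) → (Fin m → ℝ)) (x : Fin n → ℝ) :
    metricTraceHessian f (fun _ => 1) x = 0 := by
  have : ∀ j : Fin n, pderiv' j (fun _ : Fin n → ℝ => (1 : ℝ)) = fun _ => 0 := fun j =>
    funext fun z => pderiv'_const j 1 z
  simp [metricTraceHessian, this, pderiv'_const]

theorem hasDerivAt_areaRatio_one (hf : ContDiff ℝ (⊤ : ℕ∞) f) (hmin : SolvesMinimalSystem f)
    (y : Fin n → ℝ) {R : ℝ} (hR : 0 < R) :
    HasDerivAt (areaRatio f (fun _ => 1) y)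
      (4 * (∫ x, truncWeight f y R x * (normalDistSq f y x * slopeFunction f x)) /
        R ^ (n + 5)) R := by
  simpa [metricTraceHessian_one] using
    hasDerivAt_areaRatio hf hmin (u := fun _ => 1) contDiff_const y hR

theorem integral_normalDistSq_nonneg (hf : ContDiff ℝ (⊤ : ℕ∞) f) (y : Fin n → ℝ) (R : ℝ) :
    0 ≤ ∫ x, truncWeight f y R x * (normalDistSq f y x * slopeFunction f x) :=
  integral_nonneg fun x => mul_nonneg (truncWeight_nonneg f y R x)
    (mul_nonneg (normalDistSq_nonneg hf y x) (zero_le_one.trans (one_le_slopeFunction f x)))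

theorem monotoneOn_of_hasDerivAt_nonneg {J J' : ℝ → ℝ} {a : ℝ}
    (h : ∀ R, a < R → HasDerivAt J (J' R) R) (h0 : ∀ R, a < R → 0 ≤ J' R) :
    MonotoneOn J (Set.Ioi a) := by
  refine monotoneOn_of_deriv_nonneg (convex_Ioi a)
    (fun R hR => (h R hR).continuousAt.continuousWithinAt) ?_ ?_
  · rw [interior_Ioi]
    exact fun R hR => (h R hR).differentiableAt.differentiableWithinAt
  · rw [interior_Ioi]
    intro R hR
    rw [(h R hR).deriv]
    exact h0 R hR

theorem monotoneOn_areaRatio_one (hf : ContDiff ℝ (⊤ : ℕ∞) f) (hmin : SolvesMinimalSystem f)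
    (y : Fin n → ℝ) : MonotoneOn (areaRatio f (fun _ => 1) y) (Set.Ioi 0) :=
  monotoneOn_of_hasDerivAt_nonneg (fun _ hR => hasDerivAt_areaRatio_one hf hmin y hR)
    fun R hR => div_nonneg (mul_nonneg (by norm_num) (integral_normalDistSq_nonneg hf y R))
      (pow_nonneg (le_of_lt hR) _)

theorem abs_pderiv'_le_three {x : Fin n → ℝ} (hD : (graphMetric f x).det ≤ 9) (i : Fin n)
    (α : Fin m) : |pderiv' i (fun y => f y α) x| ≤ 3 := by
  have h1 := one_add_sum_sq_le_det (fun i α => pderiv' i (fun y => f y α) x)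
  rw [← graphMetric_eq_onePlusGram] at h1
  have h2 : pderiv' i (fun y => f y α) x ^ 2 ≤ ∑ i, ∑ α, pderiv' i (fun y => f y α) x ^ 2 :=
    (Finset.single_le_sum (f := fun α => pderiv' i (fun y => f y α) x ^ 2)
      (fun _ _ => sq_nonneg _) (Finset.mem_univ α)).trans
    (Finset.single_le_sum (f := fun i => ∑ α, pderiv' i (fun y => f y α) x ^ 2)
      (fun _ _ => Finset.sum_nonneg fun _ _ => sq_nonneg _) (Finset.mem_univ i))
  exact abs_le_of_sq_le_sq (by linarith) (by norm_num)

theorem abs_sub_le_of_abs_pderiv'_le {φ : (Fin n → ℝ) → ℝ} (hφ : Differentiable ℝ φ) {C : ℝ}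
    (hC : ∀ x i, |pderiv' i φ x| ≤ C) (x y : Fin n → ℝ) : |φ x - φ y| ≤ n * C * ‖x - y‖ := by
  have h : ∀ z, ‖fderiv ℝ φ z‖ ≤ n * |C| := by
    intro z
    refine ContinuousLinearMap.opNorm_le_bound _ (by positivity) fun v => ?_
    rw [fderiv_eq_sum_pderiv', Real.norm_eq_abs]
    refine (Finset.abs_sum_le_sum_abs _ _).trans ?_
    refine (Finset.sum_le_sum (g := fun _ => |C| * ‖v‖) fun i _ => ?_).trans (by simp [mul_assoc])
    rw [abs_mul, mul_comm]
    exact mul_le_mul ((hC z i).trans (le_abs_self C)) (norm_le_pi_norm v i) (abs_nonneg _)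
      (abs_nonneg _)
  have h2 := convex_univ.norm_image_sub_le_of_norm_fderiv_le (𝕜 := ℝ)
    (fun z _ => hφ z) (fun z _ => h z) (Set.mem_univ y) (Set.mem_univ x)
  rw [Real.norm_eq_abs] at h2
  refine h2.trans_eq ?_
  rcases n.eq_zero_or_pos with hn | hn
  · subst hn; simp
  · rw [abs_of_nonneg ((abs_nonneg _).trans (hC x ⟨0, hn⟩))]

theorem graphDistSq_le (hf : ContDiff ℝ (⊤ : ℕ∞) f) (hD : ∀ x, (graphMetric f x).det ≤ 9)
    (y x : Fin n → ℝ) : graphDistSq f y x ≤ (1 + n + m * (3 * n) ^ 2) * ‖x - y‖ ^ 2 := by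
  have h1 : ∑ i, (x i - y i) ^ 2 ≤ n * ‖x - y‖ ^ 2 := by
    refine (Finset.sum_le_sum (g := fun _ => ‖x - y‖ ^ 2) fun i _ => ?_).trans (by simp)
    rw [← sq_abs]
    exact pow_le_pow_left₀ (abs_nonneg _) (norm_le_pi_norm (x - y) i) 2
  have h2 : ∑ α, (f x α - f y α) ^ 2 ≤ m * ((3 * n) ^ 2 * ‖x - y‖ ^ 2) := by
    refine (Finset.sum_le_sum (g := fun _ => (3 * n) ^ 2 * ‖x - y‖ ^ 2) fun α _ => ?_).trans
      (by simp)
    rw [← sq_abs, ← mul_pow, mul_comm (3 : ℝ)]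
    exact pow_le_pow_left₀ (abs_nonneg _) (abs_sub_le_of_abs_pderiv'_le
      ((contDiff_component hf α).differentiable (by simp))
      (fun z i => abs_pderiv'_le_three (hD z) i α) x y) 2
  simp only [graphDistSq]
  nlinarith [sq_nonneg ‖x - y‖]

theorem areaRatio_le (hf : ContDiff ℝ (⊤ : ℕ∞) f) {u : (Fin n → ℝ) → ℝ} (hu : Continuous u)
    {B : ℝ} (hB : ∀ x, u x * slopeFunction f x ≤ B) (hB0 : 0 ≤ B) (y : Fin n → ℝ) {R : ℝ}
    (hR : 0 < R) : areaRatio f u y R ≤ B * 2 ^ n := by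
  have huv : Continuous fun x => u x * slopeFunction f x :=
    hu.mul (contDiff_slopeFunction hf).continuous
  have hball : IsCompact (Metric.closedBall y R) := isCompact_closedBall _ _
  rw [areaRatio, div_le_iff₀ (by positivity)]
  have h1 : weightedArea f u y R ≤
      ∫ x, (Metric.closedBall y R).indicator (fun _ => R ^ 4 * B) x := by
    refine integral_mono (integrable_truncWeight_pow_mul hf y hR.le 1 huv)
      ((integrable_indicator_iff hball.measurableSet).2
        (integrableOn_const hball.measure_lt_top.ne)) fun x => ?_
    by_cases hx : x ∈ Metric.closedBall y R
    · rw [Set.indicator_of_mem hx]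
      have h2 : truncWeight f y R x ^ 2 ≤ R ^ 4 := by
        calc _ ≤ (R ^ 2) ^ 2 :=
              pow_le_pow_left₀ (truncWeight_nonneg f y R x) (truncWeight_le f y R x) 2
          _ = R ^ 4 := by ring
      calc _ ≤ truncWeight f y R x ^ 2 * B :=
            mul_le_mul_of_nonneg_left (hB x) (sq_nonneg _)
        _ ≤ R ^ 4 * B := mul_le_mul_of_nonneg_right h2 hB0
    · rw [Set.indicator_of_notMem hx]
      simp [truncWeight_eq_zero hR.le hx]
  refine h1.trans_eq ?_
  rw [integral_indicator hball.measurableSet, setIntegral_const, Measure.real,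
    Real.volume_pi_closedBall _ hR.le, ENNReal.toReal_ofReal (by positivity), Fintype.card_fin,
    smul_eq_mul]
  ring

theorem exists_decay_hessian_sq (hf : ContDiff ℝ (⊤ : ℕ∞) f) (hmin : SolvesMinimalSystem f) {b : ℝ}
    (hb : b < 9) (hD : ∀ x, (graphMetric f x).det ≤ b) :
    ∃ σ : ℝ, 0 < σ ∧ ∀ (y : Fin n → ℝ) (δ R₀ : ℝ), 0 < δ → ∃ R, R₀ ≤ R ∧ 0 < R ∧
      R ^ 2 * ∫ x in Metric.closedBall y (σ * R),
        ∑ i, ∑ j, ∑ α, pderiv' i (pderiv' j fun y => f y α) x ^ 2 ≤ δ * R ^ n := by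
  obtain ⟨κ, hκ, hboch⟩ := bochner_det_pow_five hf hmin hb hD
  have hD9 : ∀ x, (graphMetric f x).det ≤ 9 := fun x => (hD x).trans hb.le
  set Λ : ℝ := 1 + n + m * (3 * n) ^ 2 with hΛ
  have hΛ1 : 1 ≤ Λ := by
    have h1 : (0 : ℝ) ≤ n := by positivity
    have h2 : (0 : ℝ) ≤ m * (3 * n) ^ 2 := by positivity
    linarith
  have hΛ0 : 0 < Λ := by linarith
  refine ⟨1 / (2 * Λ), by positivity, fun y δ R₀ hδ => ?_⟩
  set σ : ℝ := 1 / (2 * Λ) with hσ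
  have hσΛ : Λ * σ ^ 2 ≤ 1 / 2 := by
    rw [hσ, div_pow, one_pow, mul_one_div, div_le_div_iff₀ (by positivity) (by norm_num)]
    nlinarith
  by_contra! hcon
  set H : (Fin n → ℝ) → ℝ :=
    fun x => ∑ i, ∑ j, ∑ α, pderiv' i (pderiv' j fun y => f y α) x ^ 2 with hH
  have hH0 : ∀ x, 0 ≤ H x := fun x => Finset.sum_nonneg fun _ _ => Finset.sum_nonneg fun _ _ =>
    Finset.sum_nonneg fun _ _ => sq_nonneg _
  have hHc : Continuous H := continuous_finsetSum _ fun i _ => continuous_finsetSum _ fun j _ =>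
    continuous_finsetSum _ fun α _ =>
      (((contDiff_component hf α).pderiv' j).pderiv' i).continuous.pow 2
  set u : (Fin n → ℝ) → ℝ := fun y => (graphMetric f y).det ^ 5 with hu
  have huc : ContDiff ℝ (⊤ : ℕ∞) u := (contDiff_det_graphMetric hf).pow 5
  have hu0 : ∀ x, 0 ≤ u x := fun x => pow_nonneg (by linarith [one_le_det_graphMetric f x]) 5
  have hv0 : ∀ x, 0 ≤ slopeFunction f x := fun x => zero_le_one.trans (one_le_slopeFunction f x)
  have hL0 : ∀ x, 0 ≤ metricTraceHessian f u x := fun x =>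
    (mul_nonneg hκ.le (hH0 x)).trans (hboch x)
  have hLc : Continuous (metricTraceHessian f u) := by
    unfold metricTraceHessian
    exact continuous_finsetSum _ fun i _ => continuous_finsetSum _ fun j _ =>
      (contDiff_graphMetric_inv hf i j).continuous.mul ((huc.pderiv' j).pderiv' i).continuous
  have huv : ∀ x, u x * slopeFunction f x ≤ 9 ^ 5 * 3 := by
    intro x
    refine mul_le_mul (pow_le_pow_left₀ (by linarith [one_le_det_graphMetric f x]) (hD9 x) 5) ?_
      (hv0 x) (by norm_num)
    refine (Real.sqrt_le_sqrt (hD9 x)).trans_eq ?_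
    rw [show (9 : ℝ) = 3 ^ 2 by norm_num, Real.sqrt_sq (by norm_num)]
  have hbound : ∀ R, 0 < R → areaRatio f u y R ≤ 9 ^ 5 * 3 * 2 ^ n := fun R hR =>
    areaRatio_le hf huc.continuous huv (by norm_num) y hR
  have hE : ∀ R, 0 < R → κ * R ^ 6 / 8 * (∫ x in Metric.closedBall y (σ * R), H x) ≤
      ∫ x, truncWeight f y R x ^ 3 * (metricTraceHessian f u x * slopeFunction f x) := by
    intro R hR
    have hi := integrable_truncWeight_pow_mul hf y hR.le 2
      (hLc.mul (contDiff_slopeFunction hf).continuous)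
    have hball : IsCompact (Metric.closedBall y (σ * R)) := isCompact_closedBall _ _
    refine le_trans ?_ (setIntegral_le_integral (s := Metric.closedBall y (σ * R)) hi
      (.of_forall fun x => mul_nonneg (pow_nonneg (truncWeight_nonneg f y R x) _)
        (mul_nonneg (hL0 x) (hv0 x))))
    rw [← integral_const_mul]
    refine setIntegral_mono_on ((hHc.continuousOn.integrableOn_compact hball).const_mul _)
      hi.integrableOn hball.measurableSet fun x hx => ?_
    rw [Metric.mem_closedBall, dist_eq_norm] at hx
    have hw : R ^ 2 / 2 ≤ truncWeight f y R x := by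
      refine le_trans ?_ (le_max_left _ _)
      have h1 := graphDistSq_le hf hD9 y x
      rw [← hΛ] at h1
      have h2 : ‖x - y‖ ^ 2 ≤ (σ * R) ^ 2 := pow_le_pow_left₀ (norm_nonneg _) hx 2
      have h3 : Λ * ‖x - y‖ ^ 2 ≤ Λ * (σ * R) ^ 2 := by gcongr
      have h4 : Λ * (σ * R) ^ 2 = (Λ * σ ^ 2) * R ^ 2 := by ring
      have h5 : (Λ * σ ^ 2) * R ^ 2 ≤ 1 / 2 * R ^ 2 := by gcongr
      linarith
    have hw3 : (R ^ 2 / 2) ^ 3 ≤ truncWeight f y R x ^ 3 := by gcongr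
    calc κ * R ^ 6 / 8 * H x = (R ^ 2 / 2) ^ 3 * (κ * H x * 1) := by ring
      _ ≤ truncWeight f y R x ^ 3 * (metricTraceHessian f u x * slopeFunction f x) :=
        mul_le_mul hw3 (mul_le_mul (hboch x) (one_le_slopeFunction f x) zero_le_one (hL0 x))
          (mul_nonneg (mul_nonneg hκ.le (hH0 x)) zero_le_one)
          (pow_nonneg (truncWeight_nonneg f y R x) _)
  set R₁ : ℝ := max R₀ 1 with hR₁
  have hR₁1 : 1 ≤ R₁ := le_max_right _ _
  set c : ℝ := κ * δ / 48 with hc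
  have hc0 : 0 < c := by positivity
  have hmono : MonotoneOn (fun R => areaRatio f u y R - c * Real.log R) (Set.Ioi R₁) := by
    refine monotoneOn_of_hasDerivAt_nonneg (fun R hR =>
      (hasDerivAt_areaRatio hf hmin huc y (by linarith : 0 < R)).sub
        ((Real.hasDerivAt_log (by linarith : 0 < R).ne').const_mul c)) fun R hR => ?_
    have hR0 : 0 < R := by linarith
    have h1 := (hcon R ((le_max_left _ _).trans hR.le) hR0).le
    have h2 := hE R hR0
    have h3 : 0 ≤ ∫ x, truncWeight f y R x * (normalDistSq f y x * (u x * slopeFunction f x)) :=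
      integral_nonneg fun x => mul_nonneg (truncWeight_nonneg f y R x)
        (mul_nonneg (normalDistSq_nonneg hf y x) (mul_nonneg (hu0 x) (hv0 x)))
    have h4 : κ * R ^ 4 / 48 * (δ * R ^ n) ≤
        κ * R ^ 4 / 48 * (R ^ 2 * ∫ x in Metric.closedBall y (σ * R), H x) :=
      mul_le_mul_of_nonneg_left h1 (by positivity)
    rw [sub_nonneg, ← div_eq_mul_inv, div_le_div_iff₀ hR0 (by positivity)]
    have h5 : c * R ^ (n + 5) = κ * R ^ 4 / 48 * (δ * R ^ n) * R := by rw [hc]; ring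
    rw [h5]
    exact mul_le_mul_of_nonneg_right (by linarith) hR0.le
  have hlim : Filter.Tendsto (fun R => c * Real.log R) Filter.atTop Filter.atTop :=
    Real.tendsto_log_atTop.const_mul_atTop hc0
  obtain ⟨R, hR, hRlog⟩ := ((Filter.eventually_ge_atTop (R₁ + 1)).and
    (hlim.eventually_gt_atTop (9 ^ 5 * 3 * 2 ^ n -
      (areaRatio f u y (R₁ + 1) - c * Real.log (R₁ + 1))))).exists
  have h1 := hmono (show R₁ + 1 ∈ Set.Ioi R₁ by simp) (show R ∈ Set.Ioi R₁ from
    lt_of_lt_of_le (by linarith) hR) hR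
  have h2 := hbound R (by linarith)
  simp only at h1
  linarith

/-- The sum of the absolute values of all second partial derivatives. -/
def hessianAbs (f : (Fin n → ℝ) → (Fin m → ℝ)) (x : Fin n → ℝ) : ℝ :=
  ∑ i, ∑ j, ∑ α, |pderiv' i (pderiv' j fun y => f y α) x|

theorem exists_decay_hessianAbs (hf : ContDiff ℝ (⊤ : ℕ∞) f) (hmin : SolvesMinimalSystem f) {b : ℝ}
    (hb : b < 9) (hD : ∀ x, (graphMetric f x).det ≤ b) :
    ∃ σ : ℝ, 0 < σ ∧ ∀ (y : Fin n → ℝ) (δ R₀ : ℝ), 0 < δ → ∃ R, R₀ ≤ R ∧ 0 < R ∧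
      R * ∫ x in Metric.closedBall y (σ * R), hessianAbs f x ≤ δ * R ^ n := by
  obtain ⟨σ, hσ, hdecay⟩ := exists_decay_hessian_sq hf hmin hb hD
  refine ⟨σ, hσ, fun y δ R₀ hδ => ?_⟩
  set M : ℝ := n * (n * m) * (2 * σ) ^ n + 1 with hM
  have hM0 : 0 < M := by positivity
  set ε : ℝ := 2 * δ / M with hε
  have hε0 : 0 < ε := by positivity
  obtain ⟨R, hR₀, hR, hRd⟩ := hdecay y (ε ^ 2) R₀ (by positivity)
  refine ⟨R, hR₀, hR, ?_⟩
  set H : (Fin n → ℝ) → ℝ :=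
    fun x => ∑ i, ∑ j, ∑ α, pderiv' i (pderiv' j fun y => f y α) x ^ 2 with hH
  have hball : IsCompact (Metric.closedBall y (σ * R)) := isCompact_closedBall _ _
  have hHc : Continuous H := continuous_finsetSum _ fun i _ => continuous_finsetSum _ fun j _ =>
    continuous_finsetSum _ fun α _ =>
      (((contDiff_component hf α).pderiv' j).pderiv' i).continuous.pow 2
  have hAc : Continuous (hessianAbs f) := by
    unfold hessianAbs
    exact continuous_finsetSum _ fun i _ => continuous_finsetSum _ fun j _ =>
      continuous_finsetSum _ fun α _ =>
        (((contDiff_component hf α).pderiv' j).pderiv' i).continuous.abs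
  have hpt : ∀ x, hessianAbs f x ≤ n * (n * m) * (ε / (2 * R)) + R / (2 * ε) * H x := by
    intro x
    have h1 : ∀ t : ℝ, |t| ≤ ε / (2 * R) + R / (2 * ε) * t ^ 2 := by
      intro t
      have h2 : ε / (2 * R) + R / (2 * ε) * t ^ 2 - |t| =
          (ε / R) / 2 * (1 - R / ε * |t|) ^ 2 := by
        field_simp
        rw [← sq_abs t]
        ring
      have h3 : 0 ≤ (ε / R) / 2 * (1 - R / ε * |t|) ^ 2 := by positivity
      linarith
    refine (Finset.sum_le_sum fun i _ => Finset.sum_le_sum fun j _ => Finset.sum_le_sum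
      fun α _ => h1 (pderiv' i (pderiv' j fun y => f y α) x)).trans_eq ?_
    simp only [Finset.sum_add_distrib, ← Finset.mul_sum, Finset.sum_const, Finset.card_univ,
      Fintype.card_fin, nsmul_eq_mul, hH]
    ring
  have hInt : ∫ x in Metric.closedBall y (σ * R), hessianAbs f x ≤
      n * (n * m) * (ε / (2 * R)) * (2 * (σ * R)) ^ n +
        R / (2 * ε) * ∫ x in Metric.closedBall y (σ * R), H x := by
    have hiH := hHc.continuousOn.integrableOn_compact (μ := volume) hball
    have hic : IntegrableOn (fun _ : Fin n → ℝ => n * (n * m) * (ε / (2 * R)))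
      (Metric.closedBall y (σ * R)) := integrableOn_const hball.measure_lt_top.ne
    refine (setIntegral_mono (hAc.continuousOn.integrableOn_compact hball)
      (hic.add (hiH.const_mul _)) hpt).trans_eq ?_
    rw [integral_add' hic (hiH.const_mul _), setIntegral_const, Measure.real,
      Real.volume_pi_closedBall _ (by positivity), ENNReal.toReal_ofReal (by positivity),
      Fintype.card_fin, smul_eq_mul, mul_comm]
    congr 1
    exact integral_const_mul _ _
  have h1 := mul_le_mul_of_nonneg_left hInt hR.le
  refine h1.trans ?_
  have h2 : R * (n * (n * m) * (ε / (2 * R)) * (2 * (σ * R)) ^ n +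
        R / (2 * ε) * ∫ x in Metric.closedBall y (σ * R), H x) =
      n * (n * m) * (2 * σ) ^ n * (ε / 2) * R ^ n +
        1 / (2 * ε) * (R ^ 2 * ∫ x in Metric.closedBall y (σ * R), H x) := by
    rw [show (2 * (σ * R)) ^ n = (2 * σ) ^ n * R ^ n by rw [← mul_pow]; ring]
    field_simp
  rw [h2]
  have h3 : 1 / (2 * ε) * (R ^ 2 * ∫ x in Metric.closedBall y (σ * R), H x) ≤
      1 / (2 * ε) * (ε ^ 2 * R ^ n) := mul_le_mul_of_nonneg_left hRd (by positivity)
  have h4 : 1 / (2 * ε) * (ε ^ 2 * R ^ n) = ε / 2 * R ^ n := by field_simp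
  have h5 : δ = M * (ε / 2) := by rw [hε]; field_simp
  rw [h5]
  have h6 : M * (ε / 2) * R ^ n = n * (n * m) * (2 * σ) ^ n * (ε / 2) * R ^ n + ε / 2 * R ^ n := by
    rw [hM]; ring
  linarith

end Monotonicity

section Poincare

open MeasureTheory

variable {n : ℕ}

theorem ofReal_abs_sub_le_lintegral_segment {φ : (Fin n → ℝ) → ℝ} (hφ : ContDiff ℝ (⊤ : ℕ∞) φ)
    {C : ℝ} (z h : Fin n → ℝ) (hh : ‖h‖ ≤ C) :
    ENNReal.ofReal |φ (z + h) - φ z| ≤ ∫⁻ t in Set.Icc (0 : ℝ) 1,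
      ENNReal.ofReal C * ENNReal.ofReal (∑ i, |pderiv' i φ (z + t • h)|) := by
  have hC : 0 ≤ C := (norm_nonneg h).trans hh
  have hd : ∀ t : ℝ, HasDerivAt (fun t : ℝ => φ (z + t • h)) (fderiv ℝ φ (z + t • h) h) t := by
    intro t
    have h1 : HasDerivAt (fun t : ℝ => z + t • h) h t := by
      simpa using ((hasDerivAt_id t).smul_const h).const_add z
    exact ((hφ.diffAt_of_smooth _).hasFDerivAt.comp_hasDerivAt t h1)
  have hline : Continuous fun t : ℝ => z + t • h := by fun_prop
  have hc : Continuous fun t : ℝ => fderiv ℝ φ (z + t • h) h :=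
    ((hφ.continuous_fderiv (by simp)).comp hline).clm_apply continuous_const
  have hG : Continuous fun t : ℝ => C * ∑ i, |pderiv' i φ (z + t • h)| :=
    continuous_const.mul (continuous_finsetSum _ fun i _ =>
      ((hφ.pderiv' i).continuous.comp hline).abs)
  have h1 : φ (z + h) - φ z = ∫ t in (0 : ℝ)..1, fderiv ℝ φ (z + t • h) h := by
    rw [intervalIntegral.integral_eq_sub_of_hasDerivAt (fun t _ => hd t)
      (hc.intervalIntegrable _ _)]
    simp
  have h2 : |φ (z + h) - φ z| ≤
      ∫ t in Set.Icc (0 : ℝ) 1, C * ∑ i, |pderiv' i φ (z + t • h)| := by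
    rw [h1, integral_Icc_eq_integral_Ioc, ← intervalIntegral.integral_of_le zero_le_one]
    refine (intervalIntegral.abs_integral_le_integral_abs zero_le_one).trans
      (intervalIntegral.integral_mono_on zero_le_one (hc.abs.intervalIntegrable _ _)
        (hG.intervalIntegrable _ _) fun t _ => ?_)
    rw [fderiv_eq_sum_pderiv', Finset.mul_sum]
    refine (Finset.abs_sum_le_sum_abs _ _).trans (Finset.sum_le_sum fun i _ => ?_)
    rw [abs_mul]
    exact mul_le_mul_of_nonneg_right ((norm_le_pi_norm h i).trans hh) (abs_nonneg _)
  refine (ENNReal.ofReal_le_ofReal h2).trans_eq ?_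
  rw [ofReal_integral_eq_lintegral_ofReal
    (hG.continuousOn.integrableOn_compact isCompact_Icc) (.of_forall fun t =>
      mul_nonneg hC (Finset.sum_nonneg fun _ _ => abs_nonneg _))]
  simp only [ENNReal.ofReal_mul hC]

theorem lintegral_lintegral_abs_sub_le {φ : (Fin n → ℝ) → ℝ} (hφ : ContDiff ℝ (⊤ : ℕ∞) φ)
    (y : Fin n → ℝ) (ρ : ℝ) :
    ∫⁻ z in Metric.closedBall y ρ, ∫⁻ x in Metric.closedBall y ρ, ENNReal.ofReal |φ x - φ z| ≤
      volume (Metric.closedBall (0 : Fin n → ℝ) (2 * ρ)) * (ENNReal.ofReal (2 * ρ) *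
        ∫⁻ x in Metric.closedBall y (3 * ρ), ENNReal.ofReal (∑ i, |pderiv' i φ x|)) := by
  set g : (Fin n → ℝ) → ENNReal := fun x => ENNReal.ofReal (∑ i, |pderiv' i φ x|) with hg
  have hgc : Continuous g := ENNReal.continuous_ofReal.comp
    (continuous_finsetSum _ fun i _ => (hφ.pderiv' i).continuous.abs)
  set c : ENNReal := ENNReal.ofReal (2 * ρ) with hc
  have hmB : ∀ (a : Fin n → ℝ) (r : ℝ), MeasurableSet (Metric.closedBall a r) :=
    fun a r => Metric.isClosed_closedBall.measurableSet
  have hF : Measurable fun p : ((Fin n → ℝ) × (Fin n → ℝ)) × ℝ =>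
      c * g (p.1.1 + p.2 • p.1.2) := by
    refine Measurable.const_mul (hgc.comp ?_).measurable _
    fun_prop
  have hstep : ∀ z ∈ Metric.closedBall y ρ,
      ∫⁻ x in Metric.closedBall y ρ, ENNReal.ofReal |φ x - φ z| ≤
      ∫⁻ h in Metric.closedBall (0 : Fin n → ℝ) (2 * ρ), ∫⁻ t in Set.Icc (0 : ℝ) 1,
        c * g (z + t • h) := by
    intro z hz
    rw [← lintegral_indicator (hmB _ _), ← lintegral_indicator (hmB _ _),
      ← lintegral_add_left_eq_self _ z]
    refine lintegral_mono fun h => ?_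
    by_cases hx : z + h ∈ Metric.closedBall y ρ
    · have hh : h ∈ Metric.closedBall (0 : Fin n → ℝ) (2 * ρ) := by
        rw [mem_closedBall_zero_iff]
        have h1 : h = (z + h - y) - (z - y) := by abel
        rw [Metric.mem_closedBall, dist_eq_norm] at hx hz
        rw [h1]
        exact (norm_sub_le _ _).trans (by linarith)
      rw [Set.indicator_of_mem hx, Set.indicator_of_mem hh]
      exact ofReal_abs_sub_le_lintegral_segment hφ z h (mem_closedBall_zero_iff.1 hh)
    · rw [Set.indicator_of_notMem hx]
      exact zero_le
  calc _ ≤ ∫⁻ z in Metric.closedBall y ρ, ∫⁻ h in Metric.closedBall (0 : Fin n → ℝ) (2 * ρ),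
        ∫⁻ t in Set.Icc (0 : ℝ) 1, c * g (z + t • h) :=
        setLIntegral_mono' (hmB _ _) hstep
    _ = ∫⁻ h in Metric.closedBall (0 : Fin n → ℝ) (2 * ρ), ∫⁻ z in Metric.closedBall y ρ,
        ∫⁻ t in Set.Icc (0 : ℝ) 1, c * g (z + t • h) :=
        lintegral_lintegral_swap hF.lintegral_prod_right'.aemeasurable
    _ = ∫⁻ h in Metric.closedBall (0 : Fin n → ℝ) (2 * ρ), ∫⁻ t in Set.Icc (0 : ℝ) 1,
        ∫⁻ z in Metric.closedBall y ρ, c * g (z + t • h) := by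
        refine lintegral_congr fun h => lintegral_lintegral_swap ?_
        refine (Measurable.const_mul (hgc.comp ?_).measurable _).aemeasurable
        fun_prop
    _ ≤ ∫⁻ h in Metric.closedBall (0 : Fin n → ℝ) (2 * ρ), ∫⁻ t in Set.Icc (0 : ℝ) 1,
        c * ∫⁻ x in Metric.closedBall y (3 * ρ), g x := by
        refine setLIntegral_mono' (hmB _ _) fun h hh => setLIntegral_mono' measurableSet_Icc
          fun t ht => ?_
        have hgt : Measurable fun z => g (z + t • h) := (hgc.comp (by fun_prop)).measurable
        rw [lintegral_const_mul _ hgt]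
        refine mul_le_mul_right ?_ _
        rw [← lintegral_indicator (hmB _ _), ← lintegral_indicator (hmB _ _),
          ← lintegral_add_right_eq_self ((Metric.closedBall y (3 * ρ)).indicator g) (t • h)]
        refine lintegral_mono fun z => ?_
        by_cases hz : z ∈ Metric.closedBall y ρ
        · have hz3 : z + t • h ∈ Metric.closedBall y (3 * ρ) := by
            rw [mem_closedBall_zero_iff] at hh
            rw [Metric.mem_closedBall, dist_eq_norm] at hz ⊢
            have h1 : z + t • h - y = (z - y) + t • h := by abel
            have h2 : ‖t • h‖ ≤ ‖h‖ := by
              rw [norm_smul, Real.norm_eq_abs, abs_of_nonneg ht.1]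
              exact mul_le_of_le_one_left (norm_nonneg h) ht.2
            rw [h1]
            exact (norm_add_le _ _).trans (by linarith)
          rw [Set.indicator_of_mem hz, Set.indicator_of_mem hz3]
        · rw [Set.indicator_of_notMem hz]
          exact zero_le
    _ = _ := by
        simp [mul_comm]

theorem exists_sum_integral_abs_sub_le {ι : Type*} [Fintype ι] {Φ : ι → (Fin n → ℝ) → ℝ}
    (hΦ : ∀ a, ContDiff ℝ (⊤ : ℕ∞) (Φ a)) (y : Fin n → ℝ) {ρ : ℝ} (hρ : 0 < ρ) :
    ∃ z ∈ Metric.closedBall y ρ, ∑ a, ∫ x in Metric.closedBall y ρ, |Φ a x - Φ a z| ≤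
      2 ^ (n + 1) * ρ * ∑ a, ∫ x in Metric.closedBall y (3 * ρ), ∑ i, |pderiv' i (Φ a) x| := by
  have hball : ∀ r, IsCompact (Metric.closedBall y r) := fun r => isCompact_closedBall _ _
  have hc1 : ∀ a z, Continuous fun x => |Φ a x - Φ a z| := fun a z =>
    ((hΦ a).continuous.sub continuous_const).abs
  have hc2 : ∀ a, Continuous fun x => ∑ i, |pderiv' i (Φ a) x| := fun a =>
    continuous_finsetSum _ fun i _ => ((hΦ a).pderiv' i).continuous.abs
  have e1 : ∀ a z, ENNReal.ofReal (∫ x in Metric.closedBall y ρ, |Φ a x - Φ a z|) =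
      ∫⁻ x in Metric.closedBall y ρ, ENNReal.ofReal |Φ a x - Φ a z| := fun a z =>
    ofReal_integral_eq_lintegral_ofReal ((hc1 a z).continuousOn.integrableOn_compact (hball ρ))
      (.of_forall fun _ => abs_nonneg _)
  have e2 : ∀ a, ENNReal.ofReal (∫ x in Metric.closedBall y (3 * ρ), ∑ i, |pderiv' i (Φ a) x|) =
      ∫⁻ x in Metric.closedBall y (3 * ρ), ENNReal.ofReal (∑ i, |pderiv' i (Φ a) x|) := fun a =>
    ofReal_integral_eq_lintegral_ofReal ((hc2 a).continuousOn.integrableOn_compact (hball _))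
      (.of_forall fun _ => Finset.sum_nonneg fun _ _ => abs_nonneg _)
  have hmeas : ∀ a, Measurable fun z => ∫⁻ x in Metric.closedBall y ρ,
      ENNReal.ofReal |Φ a x - Φ a z| := fun a => by
    refine Measurable.lintegral_prod_right' (f := fun p : (Fin n → ℝ) × (Fin n → ℝ) =>
      ENNReal.ofReal |Φ a p.2 - Φ a p.1|) ?_
    exact (ENNReal.continuous_ofReal.comp (((hΦ a).continuous.comp continuous_snd).sub
      ((hΦ a).continuous.comp continuous_fst)).abs).measurable
  have hvol : ∀ (a : Fin n → ℝ) {r : ℝ}, 0 < r → volume (Metric.closedBall a r) =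
      ENNReal.ofReal ((2 * r) ^ n) := fun a r hr => by
    rw [Real.volume_pi_closedBall _ hr.le, Fintype.card_fin]
  have hv0 : volume (Metric.closedBall y ρ) ≠ 0 := by
    rw [hvol y hρ]
    simp only [ne_eq, ENNReal.ofReal_eq_zero, not_le]
    positivity
  obtain ⟨z, hz, hle⟩ := exists_le_setLAverage (μ := volume) hv0 (hball ρ).measure_lt_top.ne
    (Finset.measurable_sum Finset.univ fun a _ => hmeas a).aemeasurable
  refine ⟨z, hz, ?_⟩
  set S : ℝ := ∑ a, ∫ x in Metric.closedBall y (3 * ρ), ∑ i, |pderiv' i (Φ a) x| with hS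
  have hS0 : 0 ≤ S := Finset.sum_nonneg fun a _ => integral_nonneg fun _ =>
    Finset.sum_nonneg fun _ _ => abs_nonneg _
  have h1 : ∫⁻ z in Metric.closedBall y ρ, ∑ a, ∫⁻ x in Metric.closedBall y ρ,
      ENNReal.ofReal |Φ a x - Φ a z| ≤ ENNReal.ofReal ((2 * (2 * ρ)) ^ n * (2 * ρ * S)) := by
    rw [lintegral_finsetSum _ fun a _ => hmeas a]
    refine (Finset.sum_le_sum fun a _ => lintegral_lintegral_abs_sub_le (hΦ a) y ρ).trans_eq ?_
    rw [← Finset.mul_sum, ← Finset.mul_sum, hvol 0 (by positivity),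
      ENNReal.ofReal_mul (p := (2 * (2 * ρ)) ^ n) (by positivity),
      ENNReal.ofReal_mul (p := 2 * ρ) (by positivity), hS, ENNReal.ofReal_sum_of_nonneg]
    · simp only [e2]
    · exact fun a _ => integral_nonneg fun _ => Finset.sum_nonneg fun _ _ => abs_nonneg _
  have h2 : ENNReal.ofReal (∑ a, ∫ x in Metric.closedBall y ρ, |Φ a x - Φ a z|) ≤
      ENNReal.ofReal (2 ^ (n + 1) * ρ * S) := by
    rw [ENNReal.ofReal_sum_of_nonneg fun a _ => integral_nonneg fun _ => abs_nonneg _]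
    simp only [e1]
    rw [setLAverage_eq] at hle
    refine hle.trans (ENNReal.div_le_of_le_mul ?_)
    refine h1.trans_eq ?_
    rw [hvol y hρ, ← ENNReal.ofReal_mul (by positivity)]
    congr 1
    rw [mul_pow 2 (2 * ρ)]
    ring
  exact (ENNReal.ofReal_le_ofReal_iff (by positivity)).1 h2

end Poincare

section AffineApproximation

open MeasureTheory

variable {n m : ℕ} {f : (Fin n → ℝ) → (Fin m → ℝ)}

/-- The affine map with gradient `A` and value `b` at `y`. -/
def affineMap (A : Fin n → Fin m → ℝ) (b : Fin m → ℝ) (y x : Fin n → ℝ) (α : Fin m) : ℝ :=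
  b α + ∑ i, (x i - y i) * A i α

theorem contDiff_affineMap (A : Fin n → Fin m → ℝ) (b : Fin m → ℝ) (y : Fin n → ℝ) (α : Fin m) :
    ContDiff ℝ (⊤ : ℕ∞) fun x => affineMap A b y x α :=
  contDiff_const.add (ContDiff.sum fun i _ =>
    ((contDiff_apply ℝ ℝ i).sub contDiff_const).mul contDiff_const)

theorem pderiv'_affineMap (A : Fin n → Fin m → ℝ) (b : Fin m → ℝ) (y : Fin n → ℝ) (α : Fin m)
    (i : Fin n) (x : Fin n → ℝ) : pderiv' i (fun x => affineMap A b y x α) x = A i α := by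
  have hc : ∀ k : Fin n, ContDiff ℝ (⊤ : ℕ∞) fun z : Fin n → ℝ => z k := fun k =>
    contDiff_apply ℝ ℝ k
  have h1 : ∀ k : Fin n, ContDiff ℝ (⊤ : ℕ∞) fun z : Fin n → ℝ => z k - y k := fun k =>
    (hc k).sub contDiff_const
  have h2 : ∀ k, pderiv' i (fun x => (x k - y k) * A k α) x = if k = i then A k α else 0 := by
    intro k
    rw [pderiv'_mul i ((h1 k).diffAt_of_smooth x) (differentiableAt_const _),
      pderiv'_sub i ((hc k).diffAt_of_smooth x) (differentiableAt_const _), pderiv'_const,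
      pderiv'_const, pderiv'_coord]
    split_ifs <;> simp
  unfold affineMap
  rw [pderiv'_add i (differentiableAt_const _) ((ContDiff.sum fun k _ =>
    (h1 k).mul contDiff_const).diffAt_of_smooth x), pderiv'_const,
    pderiv'_sum Finset.univ i (Φ := fun k x => (x k - y k) * A k α) fun k _ =>
      ((h1 k).mul contDiff_const).diffAt_of_smooth x]
  simp [h2]

theorem exists_affine_approximation (hf : ContDiff ℝ (⊤ : ℕ∞) f) (hmin : SolvesMinimalSystem f)
    {b : ℝ} (hb : b < 9) (hD : ∀ x, (graphMetric f x).det ≤ b) (y : Fin n → ℝ) {δ : ℝ} (hδ : 0 < δ)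
    (R₀ : ℝ) : ∃ ρ, R₀ ≤ ρ ∧ 0 < ρ ∧ ∃ (A : Fin n → Fin m → ℝ) (c : Fin m → ℝ),
      (∀ i α, |A i α| ≤ 3) ∧
      ∑ α, (∫ x in Metric.closedBall y ρ, |f x α - affineMap A c y x α|) ≤ δ * ρ ^ (n + 1) ∧
      ∑ α, ∑ i, (∫ x in Metric.closedBall y ρ, |pderiv' i (fun y => f y α) x - A i α|) ≤
        δ * ρ ^ n := by
  obtain ⟨σ, hσ, hdecay⟩ := exists_decay_hessianAbs hf hmin hb hD
  set C : ℝ := 2 ^ (n + 1) * (σ / 3) * (9 / σ) ^ n with hC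
  have hC0 : 0 < C := by positivity
  set δ' : ℝ := δ / (2 ^ (n + 1) * C) with hδ'
  have hδ'0 : 0 < δ' := by positivity
  obtain ⟨R, hR₀, hR, hRd⟩ := hdecay y δ' (9 * R₀ / σ) hδ'0
  set ρ : ℝ := σ * R / 9 with hρ
  have hρ0 : 0 < ρ := by positivity
  have hcomp := contDiff_component hf
  have hball : ∀ r, IsCompact (Metric.closedBall y r) := fun r => isCompact_closedBall _ _
  obtain ⟨z, -, hz⟩ := exists_sum_integral_abs_sub_le (ι := Fin m × Fin n)
    (Φ := fun p => pderiv' p.2 fun y => f y p.1) (fun p => (hcomp p.1).pderiv' p.2) y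
    (show 0 < 3 * ρ by positivity)
  set A : Fin n → Fin m → ℝ := fun i α => pderiv' i (fun y => f y α) z with hA
  have h1 : ∑ p : Fin m × Fin n, ∫ x in Metric.closedBall y (3 * (3 * ρ)),
      ∑ i, |pderiv' i (pderiv' p.2 fun y => f y p.1) x| =
      ∫ x in Metric.closedBall y (σ * R), hessianAbs f x := by
    rw [show 3 * (3 * ρ) = σ * R by rw [hρ]; ring, ← integral_finsetSum]
    · refine integral_congr_ae (.of_forall fun x => ?_)
      simp only [hessianAbs, Fintype.sum_prod_type]
      rw [Finset.sum_comm]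
      conv_rhs => rw [Finset.sum_comm]
      exact Finset.sum_congr rfl fun j _ => Finset.sum_comm
    · exact fun p _ => (continuous_finsetSum _ fun i _ =>
        (((hcomp p.1).pderiv' p.2).pderiv' i).continuous.abs).continuousOn.integrableOn_compact
          (hball _)
  have h2 : ∑ α, ∑ i, (∫ x in Metric.closedBall y (3 * ρ),
      |pderiv' i (fun y => f y α) x - A i α|) ≤ C * δ' * ρ ^ n := by
    rw [h1, Fintype.sum_prod_type] at hz
    refine hz.trans ?_
    have h3 : 2 ^ (n + 1) * (3 * ρ) * (∫ x in Metric.closedBall y (σ * R), hessianAbs f x) =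
        2 ^ (n + 1) * (σ / 3) * (R * ∫ x in Metric.closedBall y (σ * R), hessianAbs f x) := by
      rw [hρ]; ring
    have h4 : C * δ' * ρ ^ n = 2 ^ (n + 1) * (σ / 3) * (δ' * R ^ n) := by
      have : (9 / σ) ^ n * ρ ^ n = R ^ n := by
        rw [← mul_pow, hρ]
        congr 1
        field_simp
      rw [← this, hC]; ring
    rw [h3, h4]
    exact mul_le_mul_of_nonneg_left hRd (by positivity)
  have h2pow : (1 : ℝ) ≤ 2 ^ (n + 1) := one_le_pow₀ (by norm_num)
  have hCδ : 2 ^ (n + 1) * (C * δ') = δ := by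
    rw [hδ']; field_simp
  have hCδ' : C * δ' ≤ δ := by
    rw [← hCδ]
    exact le_mul_of_one_le_left (by positivity) h2pow
  obtain ⟨z', -, hz'⟩ := exists_sum_integral_abs_sub_le
    (Φ := fun α x => f x α - affineMap A 0 y x α)
    (fun α => (hcomp α).sub (contDiff_affineMap A 0 y α)) y hρ0
  refine ⟨ρ, ?_, hρ0, A, fun α => f z' α - affineMap A 0 y z' α,
    fun i α => abs_pderiv'_le_three ((hD z).trans hb.le) i α, ?_, ?_⟩
  · rw [div_le_iff₀ hσ] at hR₀
    rw [hρ]; linarith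
  · have h3 : ∀ α x, f x α - affineMap A (fun α => f z' α - affineMap A 0 y z' α) y x α =
        f x α - affineMap A 0 y x α - (f z' α - affineMap A 0 y z' α) := by
      intro α x
      simp only [affineMap, Pi.zero_apply]
      ring
    simp only [h3]
    refine hz'.trans ?_
    have h4 : ∑ α, (∫ x in Metric.closedBall y (3 * ρ),
        ∑ i, |pderiv' i (fun x => f x α - affineMap A 0 y x α) x|) =
        ∑ α, ∑ i, (∫ x in Metric.closedBall y (3 * ρ),
          |pderiv' i (fun y => f y α) x - A i α|) := by
      refine Finset.sum_congr rfl fun α _ => ?_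
      rw [← integral_finsetSum]
      · refine integral_congr_ae (.of_forall fun x => Finset.sum_congr rfl fun i _ => ?_)
        rw [pderiv'_sub i ((hcomp α).diffAt_of_smooth x)
          ((contDiff_affineMap A 0 y α).diffAt_of_smooth x), pderiv'_affineMap]
      · exact fun i _ => (((hcomp α).pderiv' i).continuous.sub
          continuous_const).abs.continuousOn.integrableOn_compact (hball _)
    rw [h4]
    calc _ ≤ 2 ^ (n + 1) * ρ * (C * δ' * ρ ^ n) :=
          mul_le_mul_of_nonneg_left h2 (by positivity)
      _ = 2 ^ (n + 1) * (C * δ') * ρ ^ (n + 1) := by ring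
      _ = _ := by rw [hCδ]
  · refine le_trans ?_ (h2.trans (mul_le_mul_of_nonneg_right hCδ' (by positivity)))
    refine Finset.sum_le_sum fun α _ => Finset.sum_le_sum fun i _ => ?_
    exact setIntegral_mono_set ((((hcomp α).pderiv' i).continuous.sub
      continuous_const).abs.continuousOn.integrableOn_compact (hball _))
      (.of_forall fun x => abs_nonneg _)
      (Metric.closedBall_subset_closedBall (by linarith)).eventuallyLE

end AffineApproximation

section PlanarSlope

open Matrix MeasureTheory

variable {n m : ℕ}

theorem exists_transpose_mul_self_eq_onePlusGram (F : Fin n → Fin m → ℝ) :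
    ∃ S : Matrix (Fin n) (Fin n) ℝ, Sᵀ * S = onePlusGram F := by
  obtain ⟨U, μ, hμ, hU, hU', h⟩ := exists_orthogonal_diagonalization F
  have h1 := transpose_mul_onePlusGram_mul hU h
  refine ⟨diagonal (fun i => Real.sqrt (1 + μ i)) * Uᵀ, ?_⟩
  have h2 : diagonal (fun i => Real.sqrt (1 + μ i)) * diagonal (fun i => Real.sqrt (1 + μ i)) =
      diagonal fun i => 1 + μ i := by
    rw [diagonal_mul_diagonal]
    congr 1
    funext i
    exact Real.mul_self_sqrt (by linarith [hμ i])
  calc (diagonal (fun i => Real.sqrt (1 + μ i)) * Uᵀ)ᵀ *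
        (diagonal (fun i => Real.sqrt (1 + μ i)) * Uᵀ)
      = U * (diagonal (fun i => Real.sqrt (1 + μ i)) *
        diagonal (fun i => Real.sqrt (1 + μ i))) * Uᵀ := by
        simp only [Matrix.mul_assoc, transpose_mul, diagonal_transpose, transpose_transpose]
    _ = U * Uᵀ * onePlusGram F * (U * Uᵀ) := by rw [h2, ← h1]; simp only [Matrix.mul_assoc]
    _ = onePlusGram F := by rw [hU', Matrix.one_mul, Matrix.mul_one]

/-- The slope of the plane with gradient `A`. -/
def planarSlope (A : Fin n → Fin m → ℝ) : ℝ := Real.sqrt (onePlusGram A).det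

theorem contDiff_planarSlope : ContDiff ℝ 1 (planarSlope (n := n) (m := m)) := by
  have h0 : ∀ i α, ContDiff ℝ 1 fun A : Fin n → Fin m → ℝ => A i α := fun i α =>
    (contDiff_apply_apply ℝ ℝ i α)
  have h : ContDiff ℝ 1 fun A : Fin n → Fin m → ℝ => (onePlusGram A).det := by
    simp only [Matrix.det_apply]
    refine ContDiff.sum fun σ _ => ContDiff.const_smul _ (contDiff_prod fun i _ => ?_)
    exact contDiff_const.add (ContDiff.sum fun α _ => (h0 _ α).mul (h0 _ α))
  exact h.sqrt fun A => (zero_lt_one.trans_le (one_le_det_onePlusGram A)).ne'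

theorem exists_abs_planarSlope_sub_le : ∃ L : ℝ, 0 ≤ L ∧ ∀ P Q : Fin n → Fin m → ℝ,
    (∀ i α, |P i α| ≤ 3) → (∀ i α, |Q i α| ≤ 3) →
      |planarSlope P - planarSlope Q| ≤ L * ∑ α, ∑ i, |P i α - Q i α| := by
  have hK : IsCompact (Metric.closedBall (0 : Fin n → Fin m → ℝ) 3) := isCompact_closedBall _ _
  obtain ⟨L, hL⟩ := hK.exists_bound_of_continuousOn
    ((contDiff_planarSlope (n := n) (m := m)).continuous_fderiv one_ne_zero).continuousOn
  have hmem : ∀ P : Fin n → Fin m → ℝ, (∀ i α, |P i α| ≤ 3) →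
      P ∈ Metric.closedBall (0 : Fin n → Fin m → ℝ) 3 := fun P hP => by
    rw [mem_closedBall_zero_iff, pi_norm_le_iff_of_nonneg (by norm_num)]
    exact fun i => (pi_norm_le_iff_of_nonneg (by norm_num)).2 fun α => hP i α
  have hL0 : 0 ≤ L := (norm_nonneg _).trans (hL 0 (by simp))
  refine ⟨L, hL0, fun P Q hP hQ => ?_⟩
  have h1 := (convex_closedBall (0 : Fin n → Fin m → ℝ) 3).norm_image_sub_le_of_norm_fderiv_le
    (fun x _ => (contDiff_planarSlope.differentiable one_ne_zero) x) hL (hmem Q hQ) (hmem P hP)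
  rw [Real.norm_eq_abs] at h1
  refine h1.trans (mul_le_mul_of_nonneg_left ?_ hL0)
  have h0 : ∀ i α, |P i α - Q i α| ≤ ∑ α, ∑ i, |P i α - Q i α| := fun i α =>
    (Finset.single_le_sum (f := fun i => |P i α - Q i α|) (fun _ _ => abs_nonneg _)
      (Finset.mem_univ i)).trans
    (Finset.single_le_sum (f := fun α => ∑ i, |P i α - Q i α|)
      (fun _ _ => Finset.sum_nonneg fun _ _ => abs_nonneg _) (Finset.mem_univ α))
  have hs : 0 ≤ ∑ α, ∑ i, |P i α - Q i α| :=
    Finset.sum_nonneg fun _ _ => Finset.sum_nonneg fun _ _ => abs_nonneg _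
  exact (pi_norm_le_iff_of_nonneg hs).2 fun i => (pi_norm_le_iff_of_nonneg hs).2 fun α => h0 i α

/-- The weighted area of the plane through `(0, c)` with gradient `A`. -/
def planeArea (A : Fin n → Fin m → ℝ) (c : Fin m → ℝ) (R : ℝ) : ℝ :=
  ∫ z : Fin n → ℝ, max (R ^ 2 - (∑ i, z i ^ 2 + ∑ α, (c α + ∑ i, z i * A i α) ^ 2)) 0 ^ 2 *
    planarSlope A

/-- The weighted area of the coordinate plane at scale one. -/
def flatArea (n : ℕ) : ℝ := ∫ z : Fin n → ℝ, max (1 - ∑ i, z i ^ 2) 0 ^ 2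

theorem integral_mulVec_mul_abs_det (S : Matrix (Fin n) (Fin n) ℝ) (hS : S.det ≠ 0)
    {g : (Fin n → ℝ) → ℝ} (hg : Continuous g) :
    (∫ z, g (S *ᵥ z)) * |S.det| = ∫ z, g z := by
  have h1 := Real.map_matrix_volume_pi_eq_smul_volume_pi hS
  have h2 : ∫ z, g z ∂(Measure.map (toLin' S) volume) = ∫ z, g (S *ᵥ z) := by
    rw [integral_map (LinearMap.continuous_of_finiteDimensional _).aemeasurable
      hg.aestronglyMeasurable]
    rfl
  rw [← h2, h1, integral_smul_measure, ENNReal.toReal_ofReal (abs_nonneg _), smul_eq_mul, abs_inv]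
  field_simp

theorem sum_sq_mulVec {S : Matrix (Fin n) (Fin n) ℝ} {A : Fin n → Fin m → ℝ}
    (hS : Sᵀ * S = onePlusGram A) (z : Fin n → ℝ) :
    ∑ i, (S *ᵥ z) i ^ 2 = ∑ i, z i ^ 2 + ∑ α, (∑ i, z i * A i α) ^ 2 := by
  have h1 : ∑ i, (S *ᵥ z) i ^ 2 = z ⬝ᵥ (onePlusGram A *ᵥ z) := by
    rw [← hS, ← mulVec_mulVec, dotProduct_mulVec, vecMul_transpose]
    simp [dotProduct, sq]
  have h2 : ∑ α, (∑ i, z i * A i α) ^ 2 = (z ᵥ* Matrix.of A) ⬝ᵥ (z ᵥ* Matrix.of A) := by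
    simp [dotProduct, sq, vecMul]
  rw [h1, h2, onePlusGram_eq, add_mulVec, dotProduct_add, one_mulVec, ← mulVec_mulVec,
    dotProduct_mulVec z (Matrix.of A), mulVec_transpose]
  simp [dotProduct, sq]

theorem integrable_max_sub_sum_sq (R : ℝ) (hR : 0 ≤ R) :
    Integrable fun w : Fin n → ℝ => max (R ^ 2 - ∑ i, w i ^ 2) 0 ^ 2 := by
  refine Continuous.integrable_of_hasCompactSupport (by fun_prop) ?_
  refine HasCompactSupport.intro (isCompact_closedBall (0 : Fin n → ℝ) R) fun x hx => ?_
  rw [max_eq_right, zero_pow two_ne_zero]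
  by_contra! h
  refine hx ?_
  rw [mem_closedBall_zero_iff, pi_norm_le_iff_of_nonneg hR]
  refine fun i => abs_le_of_sq_le_sq (le_trans ?_ (by linarith)) hR
  exact Finset.single_le_sum (f := fun i => x i ^ 2) (fun _ _ => sq_nonneg _) (Finset.mem_univ i)

theorem integral_max_sub_sum_sq {R : ℝ} (hR : 0 < R) :
    ∫ w : Fin n → ℝ, max (R ^ 2 - ∑ i, w i ^ 2) 0 ^ 2 = R ^ (n + 4) * flatArea n := by
  have h := Measure.integral_comp_smul (volume : Measure (Fin n → ℝ))
    (fun w => max (R ^ 2 - ∑ i, w i ^ 2) 0 ^ 2) R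
  have h1 : ∀ w : Fin n → ℝ, max (R ^ 2 - ∑ i, (R • w) i ^ 2) 0 ^ 2 =
      R ^ 4 * max (1 - ∑ i, w i ^ 2) 0 ^ 2 := by
    intro w
    have : R ^ 2 - ∑ i, (R • w) i ^ 2 = R ^ 2 * (1 - ∑ i, w i ^ 2) := by
      simp only [Pi.smul_apply, smul_eq_mul, mul_pow, ← Finset.mul_sum]; ring
    rw [this, show max (R ^ 2 * (1 - ∑ i, w i ^ 2)) 0 = R ^ 2 * max (1 - ∑ i, w i ^ 2) 0 by
      rw [mul_max_of_nonneg _ _ (sq_nonneg R), mul_zero]]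
    ring
  simp only [h1, integral_const_mul, Module.finrank_fin_fun, smul_eq_mul] at h
  rw [abs_of_pos (by positivity)] at h
  field_simp at h
  rw [flatArea, ← h]; ring

theorem exists_planeArea_eq (A : Fin n → Fin m → ℝ) (c : Fin m → ℝ) : ∃ k : ℝ, 0 ≤ k ∧
    (c = 0 → k = 0) ∧
      ∀ R, planeArea A c R = ∫ w : Fin n → ℝ, max (R ^ 2 - k - ∑ i, w i ^ 2) 0 ^ 2 := by
  obtain ⟨S, hS⟩ := exists_transpose_mul_self_eq_onePlusGram A
  have hdet : S.det ^ 2 = (onePlusGram A).det := by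
    rw [← hS, det_mul, det_transpose, sq]
  have hslope : planarSlope A = |S.det| := by
    rw [planarSlope, ← hdet, Real.sqrt_sq_eq_abs]
  have hdet0 : S.det ≠ 0 := by
    intro h
    have := one_le_det_onePlusGram A
    rw [← hdet, h] at this
    norm_num at this
  have hu : IsUnit S.det := isUnit_iff_ne_zero.2 hdet0
  set w₀ : Fin n → ℝ := Sᵀ⁻¹ *ᵥ (Matrix.of A *ᵥ c) with hw₀
  have hw : Sᵀ *ᵥ w₀ = Matrix.of A *ᵥ c := by
    rw [hw₀, mulVec_mulVec, mul_nonsing_inv _ (by rwa [det_transpose]), one_mulVec]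
  set k : ℝ := ∑ α, c α ^ 2 - ∑ i, w₀ i ^ 2 with hk
  have hq : ∀ z : Fin n → ℝ, ∑ i, z i ^ 2 + ∑ α, (c α + ∑ i, z i * A i α) ^ 2 =
      ∑ i, ((S *ᵥ z) i + w₀ i) ^ 2 + k := by
    intro z
    have h1 : ∑ i, (S *ᵥ z) i * w₀ i = ∑ α, c α * ∑ i, z i * A i α := by
      have e1 : ∑ i, (S *ᵥ z) i * w₀ i = z ⬝ᵥ (Sᵀ *ᵥ w₀) := by
        rw [dotProduct_mulVec, vecMul_transpose]; rfl
      rw [e1, hw, dotProduct_mulVec, dotProduct_comm]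
      simp [dotProduct, vecMul]
    have h2 := sum_sq_mulVec hS z
    simp only [add_sq, Finset.sum_add_distrib, mul_assoc, ← Finset.mul_sum]
    rw [h1, h2, hk]; ring
  refine ⟨k, ?_, ?_, fun R => ?_⟩
  · have h1 := hq (S⁻¹ *ᵥ (-w₀))
    rw [mulVec_mulVec, mul_nonsing_inv _ hu, one_mulVec] at h1
    simp only [Pi.neg_apply, neg_add_cancel, zero_pow two_ne_zero, Finset.sum_const_zero,
      zero_add] at h1
    rw [← h1]
    positivity
  · intro hc
    have : w₀ = 0 := by rw [hw₀, hc]; simp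
    rw [hk, this, hc]; simp
  · have hg : Continuous fun w : Fin n → ℝ =>
        max (R ^ 2 - (∑ i, (w i + w₀ i) ^ 2 + k)) 0 ^ 2 := by fun_prop
    rw [planeArea, integral_mul_const, hslope]
    simp only [hq]
    rw [integral_mulVec_mul_abs_det S hdet0 hg, ← integral_add_right_eq_self
      (fun w : Fin n → ℝ => max (R ^ 2 - k - ∑ i, w i ^ 2) 0 ^ 2) w₀]
    simp only [Pi.add_apply, sub_sub, add_comm k]

theorem planeArea_le (A : Fin n → Fin m → ℝ) (c : Fin m → ℝ) {R : ℝ} (hR : 0 < R) :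
    planeArea A c R ≤ R ^ (n + 4) * flatArea n := by
  obtain ⟨k, hk, -, h⟩ := exists_planeArea_eq A c
  rw [h, ← integral_max_sub_sum_sq hR]
  refine integral_mono_of_nonneg (Filter.Eventually.of_forall fun _ => sq_nonneg _)
    (integrable_max_sub_sum_sq R hR.le) (Filter.Eventually.of_forall fun w => ?_)
  exact pow_le_pow_left₀ (le_max_right _ _) (max_le_max (by linarith) le_rfl) 2

theorem planeArea_zero (A : Fin n → Fin m → ℝ) {R : ℝ} (hR : 0 < R) :
    planeArea A 0 R = R ^ (n + 4) * flatArea n := by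
  obtain ⟨k, -, hk, h⟩ := exists_planeArea_eq A 0
  rw [h, hk rfl, sub_zero, integral_max_sub_sum_sq hR]

end PlanarSlope

section PlaneComparison

open MeasureTheory

variable {n m : ℕ} {f : (Fin n → ℝ) → (Fin m → ℝ)}

theorem abs_max_sub_sq_sq_sub_le {c R s t : ℝ} (hR : 0 ≤ R) (hc : c ≤ R ^ 2) (hs : 0 ≤ s)
    (ht : 0 ≤ t) :
    |max (c - s ^ 2) 0 ^ 2 - max (c - t ^ 2) 0 ^ 2| ≤ 4 * R ^ 3 * |s - t| := by
  wlog hst : s ≤ t generalizing s t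
  · rw [abs_sub_comm, abs_sub_comm s]
    exact this ht hs (le_of_not_ge hst)
  set a := max (c - s ^ 2) 0 with ha
  set b := max (c - t ^ 2) 0 with hb
  have hb0 : 0 ≤ b := le_max_right _ _
  have hba : b ≤ a := max_le_max (by nlinarith) le_rfl
  have haR : a ≤ R ^ 2 := max_le (by nlinarith) (sq_nonneg R)
  have hbt : c - t ^ 2 ≤ b := le_max_left _ _
  have hab : a - b ≤ 2 * R * (t - s) := by
    rcases le_or_gt (c - s ^ 2) 0 with h | h
    · have : a = 0 := max_eq_right h
      nlinarith [mul_nonneg hR (sub_nonneg.2 hst)]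
    · have h1 : a = c - s ^ 2 := max_eq_left h.le
      have hsR : s ≤ R := by nlinarith
      rcases le_or_gt t R with h2 | h2
      · nlinarith [mul_nonneg (sub_nonneg.2 hst) (sub_nonneg.2 h2),
          mul_nonneg (sub_nonneg.2 hst) (sub_nonneg.2 hsR)]
      · nlinarith [mul_nonneg (sub_nonneg.2 hsR) (sub_nonneg.2 hsR),
          mul_nonneg hR (sub_nonneg.2 h2.le)]
  rw [abs_of_nonneg (by nlinarith), abs_sub_comm, abs_of_nonneg (sub_nonneg.2 hst)]
  calc a ^ 2 - b ^ 2 = (a - b) * (a + b) := by ring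
    _ ≤ (2 * R * (t - s)) * (2 * R ^ 2) :=
        mul_le_mul hab (by linarith) (by linarith)
          (mul_nonneg (by positivity) (sub_nonneg.2 hst))
    _ = 4 * R ^ 3 * (t - s) := by ring

theorem abs_sqrt_sum_sq_sub_le (p q : Fin m → ℝ) :
    |Real.sqrt (∑ α, p α ^ 2) - Real.sqrt (∑ α, q α ^ 2)| ≤ ∑ α, |p α - q α| := by
  have h := abs_norm_sub_norm_le (WithLp.toLp 2 p : EuclideanSpace ℝ (Fin m)) (WithLp.toLp 2 q)
  rw [EuclideanSpace.norm_eq, EuclideanSpace.norm_eq, EuclideanSpace.norm_eq] at h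
  simp only [Real.norm_eq_abs, sq_abs, PiLp.sub_apply] at h
  refine h.trans (Real.sqrt_le_iff.2 ⟨Finset.sum_nonneg fun _ _ => abs_nonneg _, ?_⟩)
  simpa only [sq_abs] using Finset.sum_sq_le_sq_sum_of_nonneg
    (s := Finset.univ) (f := fun α => |p α - q α|) fun α _ => abs_nonneg _

theorem abs_max_sub_sum_sq_sub_le {c R : ℝ} (hR : 0 ≤ R) (hc : c ≤ R ^ 2) (p q : Fin m → ℝ) :
    |max (c - ∑ α, p α ^ 2) 0 ^ 2 - max (c - ∑ α, q α ^ 2) 0 ^ 2| ≤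
      4 * R ^ 3 * ∑ α, |p α - q α| := by
  have h := abs_max_sub_sq_sq_sub_le hR hc (Real.sqrt_nonneg (∑ α, p α ^ 2))
    (Real.sqrt_nonneg (∑ α, q α ^ 2))
  rw [Real.sq_sqrt (Finset.sum_nonneg fun _ _ => sq_nonneg _),
    Real.sq_sqrt (Finset.sum_nonneg fun _ _ => sq_nonneg _)] at h
  exact h.trans (mul_le_mul_of_nonneg_left (abs_sqrt_sum_sq_sub_le p q) (by positivity))

theorem truncWeight_eq (f : (Fin n → ℝ) → (Fin m → ℝ)) (y : Fin n → ℝ) (R : ℝ) (x : Fin n → ℝ) :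
    truncWeight f y R x =
      max (R ^ 2 - ∑ i, (x i - y i) ^ 2 - ∑ α, (f x α - f y α) ^ 2) 0 := by
  rw [truncWeight, graphDistSq, sub_sub]

theorem planeArea_eq_integral (A : Fin n → Fin m → ℝ) (b d : Fin m → ℝ) (y : Fin n → ℝ) (R : ℝ) :
    planeArea A (b - d) R = ∫ x, max (R ^ 2 - ∑ i, (x i - y i) ^ 2 -
      ∑ α, (affineMap A b y x α - d α) ^ 2) 0 ^ 2 * planarSlope A := by
  rw [planeArea, ← integral_sub_right_eq_self _ y]
  refine integral_congr_ae (Filter.Eventually.of_forall fun x => ?_)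
  simp only [affineMap, Pi.sub_apply, sub_sub, sub_add_eq_add_sub]

/-- The weighted area of a graph differs from that of a plane by at most the `L¹` distance of the
two defining maps, measured to first order. -/
theorem abs_weightedArea_sub_planeArea_le (hf : ContDiff ℝ (⊤ : ℕ∞) f)
    (hD : ∀ x, (graphMetric f x).det ≤ 9) {L : ℝ} (hL0 : 0 ≤ L)
    (hL : ∀ P Q : Fin n → Fin m → ℝ, (∀ i α, |P i α| ≤ 3) → (∀ i α, |Q i α| ≤ 3) →
      |planarSlope P - planarSlope Q| ≤ L * ∑ α, ∑ i, |P i α - Q i α|)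
    {A : Fin n → Fin m → ℝ} (hA : ∀ i α, |A i α| ≤ 3) (b : Fin m → ℝ) (y : Fin n → ℝ) {R : ℝ}
    (hR : 0 ≤ R) :
    |weightedArea f (fun _ => 1) y R - planeArea A (b - f y) R| ≤
      12 * R ^ 3 * ∑ α, (∫ x in Metric.closedBall y R, |f x α - affineMap A b y x α|) +
      L * R ^ 4 * ∑ α, ∑ i,
        (∫ x in Metric.closedBall y R, |pderiv' i (fun y => f y α) x - A i α|) := by
  have hcomp := contDiff_component hf
  set w' : (Fin n → ℝ) → ℝ := fun x => max (R ^ 2 - ∑ i, (x i - y i) ^ 2 -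
      ∑ α, (affineMap A b y x α - f y α) ^ 2) 0 with hw'
  have hw'c : Continuous w' := by
    have := fun α => (contDiff_affineMap A b y α).continuous
    fun_prop
  have hsq : ∀ (x : Fin n → ℝ) (i : Fin n), (x i - y i) ^ 2 ≤ ∑ i, (x i - y i) ^ 2 := fun x i =>
    Finset.single_le_sum (f := fun i => (x i - y i) ^ 2) (fun _ _ => sq_nonneg _)
      (Finset.mem_univ i)
  have hw'0 : ∀ x, x ∉ Metric.closedBall y R → w' x = 0 := by
    intro x hx
    refine max_eq_right ?_
    by_contra! h
    refine hx ?_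
    rw [Metric.mem_closedBall, dist_pi_le_iff hR]
    intro i
    have : 0 ≤ ∑ α, (affineMap A b y x α - f y α) ^ 2 := by positivity
    exact abs_le_of_sq_le_sq ((hsq x i).trans (by linarith)) hR
  have hw'n : ∀ x, 0 ≤ w' x := fun x => le_max_right _ _
  have hw'R : ∀ x, w' x ≤ R ^ 2 := fun x => by
    have h1 : 0 ≤ ∑ α, (affineMap A b y x α - f y α) ^ 2 := by positivity
    have h2 : 0 ≤ ∑ i, (x i - y i) ^ 2 := by positivity
    exact max_le (by linarith) (sq_nonneg R)
  have hI1 : Integrable fun x => truncWeight f y R x ^ 2 * (1 * slopeFunction f x) :=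
    integrable_truncWeight_pow_mul hf y hR 1
      (continuous_const.mul (contDiff_slopeFunction hf).continuous)
  have hI2 : Integrable fun x => w' x ^ 2 * planarSlope A := by
    refine Continuous.integrable_of_hasCompactSupport (by fun_prop) ?_
    refine HasCompactSupport.intro (isCompact_closedBall y R) fun x hx => ?_
    rw [hw'0 x hx]; simp
  have hpt : ∀ x, |truncWeight f y R x ^ 2 * (1 * slopeFunction f x) - w' x ^ 2 * planarSlope A| ≤
      12 * R ^ 3 * ∑ α, |f x α - affineMap A b y x α| +
      L * R ^ 4 * ∑ α, ∑ i, |pderiv' i (fun y => f y α) x - A i α| := by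
    intro x
    have h1 : |truncWeight f y R x ^ 2 - w' x ^ 2| ≤
        4 * R ^ 3 * ∑ α, |f x α - affineMap A b y x α| := by
      have h2 : 0 ≤ ∑ i, (x i - y i) ^ 2 := by positivity
      have h := abs_max_sub_sum_sq_sub_le (c := R ^ 2 - ∑ i, (x i - y i) ^ 2) hR (by linarith)
        (fun α => f x α - f y α) fun α => affineMap A b y x α - f y α
      simp only [sub_sub_sub_cancel_right] at h
      rwa [truncWeight_eq]
    have h3 : |slopeFunction f x - planarSlope A| ≤
        L * ∑ α, ∑ i, |pderiv' i (fun y => f y α) x - A i α| :=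
      hL _ A (fun i α => abs_pderiv'_le_three (hD x) i α) hA
    have h4 : |slopeFunction f x| ≤ 3 := by
      refine abs_le_of_sq_le_sq ?_ (by norm_num)
      rw [slopeFunction_sq]
      linarith [hD x]
    have h5 : |w' x ^ 2| ≤ R ^ 4 := by
      rw [abs_of_nonneg (sq_nonneg _)]
      calc w' x ^ 2 ≤ (R ^ 2) ^ 2 := pow_le_pow_left₀ (hw'n x) (hw'R x) 2
        _ = R ^ 4 := by ring
    calc |truncWeight f y R x ^ 2 * (1 * slopeFunction f x) - w' x ^ 2 * planarSlope A|
        = |(truncWeight f y R x ^ 2 - w' x ^ 2) * slopeFunction f x +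
            w' x ^ 2 * (slopeFunction f x - planarSlope A)| := by congr 1; ring
      _ ≤ |truncWeight f y R x ^ 2 - w' x ^ 2| * |slopeFunction f x| +
            |w' x ^ 2| * |slopeFunction f x - planarSlope A| := by
          rw [← abs_mul, ← abs_mul]; exact abs_add_le _ _
      _ ≤ (4 * R ^ 3 * ∑ α, |f x α - affineMap A b y x α|) * 3 +
            R ^ 4 * (L * ∑ α, ∑ i, |pderiv' i (fun y => f y α) x - A i α|) :=
          add_le_add (mul_le_mul h1 h4 (abs_nonneg _) (by positivity))
            (mul_le_mul h5 h3 (abs_nonneg _) (by positivity))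
      _ = _ := by ring
  have hball : IsCompact (Metric.closedBall y R) := isCompact_closedBall _ _
  have hi1 : ∀ α, IntegrableOn (fun x => |f x α - affineMap A b y x α|) (Metric.closedBall y R) :=
    fun α => (((hcomp α).continuous.sub
      (contDiff_affineMap A b y α).continuous).abs).continuousOn.integrableOn_compact hball
  have hi2 : ∀ α i, IntegrableOn (fun x => |pderiv' i (fun y => f y α) x - A i α|)
      (Metric.closedBall y R) := fun α i =>
    ((((hcomp α).pderiv' i).continuous.sub
      continuous_const).abs).continuousOn.integrableOn_compact hball
  have hs1 := (integrable_finsetSum Finset.univ fun α _ => hi1 α).const_mul (12 * R ^ 3)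
  have hs2 := (integrable_finsetSum Finset.univ fun α _ =>
    integrable_finsetSum Finset.univ fun i _ => hi2 α i).const_mul (L * R ^ 4)
  have hzero : ∀ x, x ∉ Metric.closedBall y R →
      truncWeight f y R x ^ 2 * (1 * slopeFunction f x) - w' x ^ 2 * planarSlope A = 0 := by
    intro x hx
    rw [truncWeight_eq_zero hR hx, hw'0 x hx]; simp
  rw [weightedArea, planeArea_eq_integral A b (f y) y R, ← integral_sub hI1 hI2,
    ← setIntegral_eq_integral_of_forall_compl_eq_zero hzero]
  refine (norm_integral_le_of_norm_le (hs1.add hs2)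
    (Filter.Eventually.of_forall fun x => (Real.norm_eq_abs _).trans_le (hpt x))).trans
      (le_of_eq ?_)
  rw [integral_add' hs1 hs2, integral_const_mul, integral_const_mul,
    integral_finsetSum _ fun α _ => hi1 α,
    integral_finsetSum _ fun α _ => integrable_finsetSum Finset.univ fun i _ => hi2 α i]
  congr 3
  funext α
  exact integral_finsetSum _ fun i _ => hi2 α i

end PlaneComparison

section Conclusion

open MeasureTheory

variable {n m : ℕ} {f : (Fin n → ℝ) → (Fin m → ℝ)}

theorem setIntegral_abs_le_mul_pow (y : Fin n → ℝ) {R C : ℝ} (hR : 0 ≤ R)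
    {φ : (Fin n → ℝ) → ℝ} (h : ∀ x ∈ Metric.closedBall y R, |φ x| ≤ C) :
    ∫ x in Metric.closedBall y R, |φ x| ≤ C * (2 * R) ^ n := by
  have h1 := norm_setIntegral_le_of_norm_le_const (μ := volume) (s := Metric.closedBall y R)
    (f := fun x => |φ x|) (C := C) (isCompact_closedBall y R).measure_lt_top
    fun x hx => by simpa using h x hx
  rw [measureReal_def, Real.volume_pi_closedBall _ hR, Fintype.card_fin,
    ENNReal.toReal_ofReal (by positivity)] at h1
  exact (le_abs_self _).trans h1

theorem exists_affine_approximation_small (hf : ContDiff ℝ (⊤ : ℕ∞) f) (y : Fin n → ℝ) {δ : ℝ}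
    (hδ : 0 < δ) {R₀ : ℝ} (hR₀ : 0 < R₀) : ∃ ρ, 0 < ρ ∧ ρ ≤ R₀ ∧
      ∑ α, (∫ x in Metric.closedBall y ρ,
        |f x α - affineMap (fun i α => pderiv' i (fun y => f y α) y) (f y) y x α|) ≤
          δ * ρ ^ (n + 1) ∧
      ∑ α, ∑ i, (∫ x in Metric.closedBall y ρ,
        |pderiv' i (fun y => f y α) x - pderiv' i (fun y => f y α) y|) ≤ δ * ρ ^ n := by
  have hcomp := contDiff_component hf
  set η : ℝ := δ / (2 ^ n * ((m + 1) * (n + 1))) with hη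
  have hη0 : 0 < η := by positivity
  have h1 : ∀ᶠ x in nhds y, ∀ α i,
      |pderiv' i (fun y => f y α) x - pderiv' i (fun y => f y α) y| ≤ η := by
    rw [Filter.eventually_all]
    intro α
    rw [Filter.eventually_all]
    intro i
    filter_upwards [Metric.continuousAt_iff'.1 ((hcomp α).pderiv' i).continuous.continuousAt η hη0]
      with x hx
    rw [Real.dist_eq] at hx
    exact hx.le
  have h2 : ∀ᶠ x in nhds y, ∀ α,
      |f x α - affineMap (fun i α => pderiv' i (fun y => f y α) y) (f y) y x α| ≤
        η * ‖x - y‖ := by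
    rw [Filter.eventually_all]
    intro α
    filter_upwards [((hcomp α).diffAt_of_smooth y).hasFDerivAt.isLittleO.def hη0] with x hx
    rw [fderiv_eq_sum_pderiv', Real.norm_eq_abs, sub_sub] at hx
    exact hx
  obtain ⟨r, hr, hball⟩ := Metric.eventually_nhds_iff_ball.1 (h1.and h2)
  refine ⟨min (r / 2) R₀, by positivity, min_le_right _ _, ?_⟩
  set ρ := min (r / 2) R₀ with hρ
  have hρ0 : 0 < ρ := by positivity
  have hsub : ∀ x ∈ Metric.closedBall y ρ, x ∈ Metric.ball y r := fun x hx =>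
    Metric.closedBall_subset_ball ((min_le_left _ _).trans_lt (by linarith)) hx
  have hδη : δ = η * 2 ^ n * ((m + 1) * (n + 1)) := by rw [hη]; field_simp
  have hm : (m : ℝ) ≤ (m + 1) * (n + 1) := by
    have : (0 : ℝ) ≤ m * n := by positivity
    have : (0 : ℝ) ≤ n := by positivity
    nlinarith
  have hmn : (m : ℝ) * n ≤ (m + 1) * (n + 1) := by
    have : (0 : ℝ) ≤ m := by positivity
    have : (0 : ℝ) ≤ n := by positivity
    nlinarith
  constructor
  · have h3 : ∀ α, ∫ x in Metric.closedBall y ρ,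
        |f x α - affineMap (fun i α => pderiv' i (fun y => f y α) y) (f y) y x α| ≤
          η * ρ * (2 * ρ) ^ n := fun α =>
      setIntegral_abs_le_mul_pow y hρ0.le fun x hx => ((hball x (hsub x hx)).2 α).trans
        (mul_le_mul_of_nonneg_left (mem_closedBall_iff_norm.1 hx) hη0.le)
    refine (Finset.sum_le_sum fun α _ => h3 α).trans ?_
    rw [Finset.sum_const, Finset.card_univ, Fintype.card_fin, nsmul_eq_mul, hδη]
    calc (m : ℝ) * (η * ρ * (2 * ρ) ^ n) = η * 2 ^ n * ρ ^ (n + 1) * m := by ring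
      _ ≤ η * 2 ^ n * ρ ^ (n + 1) * ((m + 1) * (n + 1)) :=
          mul_le_mul_of_nonneg_left hm (by positivity)
      _ = _ := by ring
  · have h3 : ∀ α i, ∫ x in Metric.closedBall y ρ,
        |pderiv' i (fun y => f y α) x - pderiv' i (fun y => f y α) y| ≤ η * (2 * ρ) ^ n :=
      fun α i => setIntegral_abs_le_mul_pow y hρ0.le fun x hx => (hball x (hsub x hx)).1 α i
    refine (Finset.sum_le_sum fun α _ => Finset.sum_le_sum fun i _ => h3 α i).trans ?_
    rw [Finset.sum_const, Finset.sum_const, Finset.card_univ, Finset.card_univ, Fintype.card_fin,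
      Fintype.card_fin, nsmul_eq_mul, nsmul_eq_mul, hδη]
    calc (m : ℝ) * (n * (η * (2 * ρ) ^ n)) = η * 2 ^ n * ρ ^ n * (m * n) := by ring
      _ ≤ η * 2 ^ n * ρ ^ n * ((m + 1) * (n + 1)) :=
          mul_le_mul_of_nonneg_left hmn (by positivity)
      _ = _ := by ring

theorem exists_abs_areaRatio_sub_le (hf : ContDiff ℝ (⊤ : ℕ∞) f)
    (hD : ∀ x, (graphMetric f x).det ≤ 9) : ∃ C : ℝ, 0 < C ∧
      ∀ (A : Fin n → Fin m → ℝ) (b : Fin m → ℝ) (y : Fin n → ℝ) (R δ : ℝ), 0 < R →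
        (∀ i α, |A i α| ≤ 3) →
        ∑ α, (∫ x in Metric.closedBall y R, |f x α - affineMap A b y x α|) ≤ δ * R ^ (n + 1) →
        ∑ α, ∑ i, (∫ x in Metric.closedBall y R, |pderiv' i (fun y => f y α) x - A i α|) ≤
          δ * R ^ n →
        |areaRatio f (fun _ => 1) y R - planeArea A (b - f y) R / R ^ (n + 4)| ≤ C * δ := by
  obtain ⟨L, hL0, hL⟩ := exists_abs_planarSlope_sub_le (n := n) (m := m)
  refine ⟨12 + L, by positivity, fun A b y R δ hR hA h1 h2 => ?_⟩
  rw [areaRatio, ← sub_div, abs_div, abs_of_pos (pow_pos hR (n + 4)), div_le_iff₀ (by positivity)]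
  calc _ ≤ 12 * R ^ 3 * (δ * R ^ (n + 1)) + L * R ^ 4 * (δ * R ^ n) :=
        (abs_weightedArea_sub_planeArea_le hf hD hL0 hL hA b y hR.le).trans
          (add_le_add (mul_le_mul_of_nonneg_left h1 (by positivity))
            (mul_le_mul_of_nonneg_left h2 (by positivity)))
    _ = _ := by ring

theorem areaRatio_eq_flatArea (hf : ContDiff ℝ (⊤ : ℕ∞) f) (hmin : SolvesMinimalSystem f)
    {b : ℝ} (hb : b < 9) (hD : ∀ x, (graphMetric f x).det ≤ b) (y : Fin n → ℝ) {R : ℝ}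
    (hR : 0 < R) : areaRatio f (fun _ => 1) y R = flatArea n := by
  have hD9 : ∀ x, (graphMetric f x).det ≤ 9 := fun x => (hD x).trans hb.le
  have hmono := monotoneOn_areaRatio_one hf hmin y
  obtain ⟨C, hC, hcmp⟩ := exists_abs_areaRatio_sub_le hf hD9
  refine le_antisymm (le_of_forall_pos_le_add fun ε hε => ?_)
    (le_of_forall_pos_le_add fun ε hε => ?_)
  · obtain ⟨ρ, hRρ, hρ, A, c, hA, h1, h2⟩ :=
      exists_affine_approximation hf hmin hb hD y (div_pos hε hC) R
    have h3 := hcmp A c y ρ _ hρ hA h1 h2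
    have h4 : planeArea A (c - f y) ρ / ρ ^ (n + 4) ≤ flatArea n := by
      rw [div_le_iff₀ (by positivity), mul_comm]
      exact planeArea_le A _ hρ
    rw [mul_div_cancel₀ _ hC.ne'] at h3
    linarith [hmono hR hρ hRρ, (abs_le.1 h3).2]
  · obtain ⟨ρ, hρ, hρR, h1, h2⟩ := exists_affine_approximation_small hf y (div_pos hε hC) hR
    have h3 := hcmp _ (f y) y ρ _ hρ (fun i α => abs_pderiv'_le_three (hD9 y) i α) h1 h2
    rw [sub_self, planeArea_zero _ hρ, mul_div_cancel_left₀ _ (pow_pos hρ _).ne',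
      mul_div_cancel₀ _ hC.ne'] at h3
    linarith [hmono hρ hR hρR, (abs_le.1 h3).1]

theorem normalDistSq_eq_zero (hf : ContDiff ℝ (⊤ : ℕ∞) f) (hmin : SolvesMinimalSystem f)
    {b : ℝ} (hb : b < 9) (hD : ∀ x, (graphMetric f x).det ≤ b) (y x : Fin n → ℝ) :
    normalDistSq f y x = 0 := by
  set R : ℝ := graphDistSq f y x + 1 with hRdef
  have hr0 := graphDistSq_nonneg f y x
  have hR : 0 < R := by positivity
  have hconst : HasDerivAt (areaRatio f (fun _ => 1) y) 0 R :=
    (hasDerivAt_const R (flatArea n)).congr_of_eventuallyEq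
      (Filter.eventually_of_mem (Ioi_mem_nhds hR) fun s hs =>
        areaRatio_eq_flatArea hf hmin hb hD y hs)
  have h1 := (hasDerivAt_areaRatio_one hf hmin y hR).unique hconst
  have h2 : ∫ x, truncWeight f y R x * (normalDistSq f y x * slopeFunction f x) = 0 := by
    rcases div_eq_zero_iff.1 h1 with h | h
    · linarith
    · exact absurd h (pow_pos hR _).ne'
  have hcont : Continuous fun x => normalDistSq f y x * slopeFunction f x :=
    (continuous_normalDistSq hf y).mul (contDiff_slopeFunction hf).continuous
  have hInt := integrable_truncWeight_pow_mul hf y hR.le 0 hcont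
  simp only [zero_add, pow_one] at hInt
  have h3 := (integral_eq_zero_iff_of_nonneg (fun x => mul_nonneg (truncWeight_nonneg f y R x)
    (mul_nonneg (normalDistSq_nonneg hf y x)
      (zero_le_one.trans (one_le_slopeFunction f x)))) hInt).1 h2
  have h4 := congrFun (((continuous_truncWeight hf y R).mul hcont).ae_eq_iff_eq volume
    continuous_zero |>.1 h3) x
  have hw : 0 < truncWeight f y R x := lt_max_of_lt_left (by rw [hRdef]; nlinarith)
  have hs : 0 < slopeFunction f x := zero_lt_one.trans_le (one_le_slopeFunction f x)
  simpa [hw.ne', hs.ne'] using h4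

theorem exists_eq_mulVec_add (hf : ContDiff ℝ (⊤ : ℕ∞) f) (hmin : SolvesMinimalSystem f)
    {b : ℝ} (hb : b < 9) (hD : ∀ x, (graphMetric f x).det ≤ b) :
    ∃ (A : Matrix (Fin m) (Fin n) ℝ) (c : Fin m → ℝ), ∀ x, f x = A.mulVec x + c := by
  refine ⟨Matrix.of fun α i => pderiv' i (fun z => f z α) 0, f 0, fun y => ?_⟩
  funext α
  have h := eq_of_normalDistSq_eq_zero hf (normalDistSq_eq_zero hf hmin hb hD y 0) α
  simp only [Pi.zero_apply, zero_sub, neg_mul, Finset.sum_neg_distrib] at h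
  simp only [Pi.add_apply, Matrix.mulVec, dotProduct, Matrix.of_apply]
  simp only [mul_comm (pderiv' _ _ _)]
  linarith

end Conclusion

/-- **Bernstein type theorem** (Theorem 1.1): an entire graph in `ℝ^{n+m}` (`n ≥ 3`, `m ≥ 2`)
with parallel mean curvature and slope `Δ_f ≤ β₀ < 3` is an affine `n`-plane. -/
theorem bernstein_parallel_mean_curvature_slope_lt_three
    {n m : ℕ} (hn : 3 ≤ n) (hm : 2 ≤ m)
    (f : (Fin n → ℝ) → (Fin m → ℝ)) (hf : ContDiff ℝ (⊤ : ℕ∞) f)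
    (hpmc : HasParallelMeanCurvature f)
    (β₀ : ℝ) (hβ₀ : β₀ < 3)
    (hslope : ∀ x : Fin n → ℝ, slopeFunction f x ≤ β₀) :
    ∃ (A : Matrix (Fin m) (Fin n) ℝ) (b : Fin m → ℝ),
      ∀ x : Fin n → ℝ, f x = A.mulVec x + b := by
  have hβ : 1 ≤ β₀ := (one_le_slopeFunction f 0).trans (hslope 0)
  refine exists_eq_mulVec_add hf
    (fun α x => sum_inv_mul_second_pderiv'_eq_zero (meanCurvature_eq_zero hf hpmc x) α)
    (b := β₀ ^ 2) (by nlinarith) fun x => ?_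
  rw [← slopeFunction_sq]
  exact pow_le_pow_left₀ (zero_le_one.trans (one_le_slopeFunction f x)) (hslope x) 2
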